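/- Let K be a number field such that condition cond_A(K) or condition cond_B(K) holds, and assume that either E₀(K) = E₀(ℚ), or the class number of K is 1. Let L be a quadratic extension of K and let n ≥ 6. If (b₁², …, b_n²) is a non-elementary arithmetic progression of squares of length n properly defined over L, then n = 6, K is isomorphic to the 12th cyclotomic field ℚ(ζ₁₂), L is isomorphic to ℚ(ζ₁₂)(√5), and the progression is equivalent over L to (−5, −3, −1, 1, 3, 5). -/

import Mathlib

noncomputable section

/-- `x` lies in the image of `ℚ`. -/
def inQ {L : Type*} [DivisionRing L] [CharZero L] (x : L) : Prop :=
  ∃ q : ℚ, (q : L) = x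

/-- `cond_A(K)`: every `K`-point of `E₁`, `E₁⁻¹`, `E₄`, `E₆`, `E₆⁻¹` is rational. -/
def condA (K : Type*) [Field K] [CharZero K] : Prop :=
  (∀ x y : K, y ^ 2 = x ^ 3 - x ^ 2 + x → inQ x ∧ inQ y) ∧
  (∀ x y : K, y ^ 2 = x ^ 3 + x ^ 2 + x → inQ x ∧ inQ y) ∧
  (∀ x y : K, y ^ 2 = x ^ 3 - x ^ 2 - 64 * x + 220 → inQ x ∧ inQ y) ∧
  (∀ x y : K, y ^ 2 = x ^ 3 - x ^ 2 - 4 * x + 4 → inQ x ∧ inQ y) ∧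
  (∀ x y : K, y ^ 2 = x ^ 3 + x ^ 2 - 4 * x - 4 → inQ x ∧ inQ y)

/-- `cond_B(K)`: `E₁(K)` and `E₁⁻¹(K)` are finite (rank `0`), and `[K:ℚ] < 8` or `[K:ℚ]` odd. -/
def condB (K : Type*) [Field K] [CharZero K] : Prop :=
  {p : K × K | p.2 ^ 2 = p.1 ^ 3 - p.1 ^ 2 + p.1}.Finite ∧
  {p : K × K | p.2 ^ 2 = p.1 ^ 3 + p.1 ^ 2 + p.1}.Finite ∧
  (Module.finrank ℚ K < 8 ∨ Odd (Module.finrank ℚ K))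

theorem fourNum {p q m n : ℤ} (hp : p ≠ 0) (h : p * q = m * n) :
    ∃ α β γ δ : ℤ, p = α * β ∧ q = γ * δ ∧ m = α * γ ∧ n = β * δ := by
  obtain ⟨α, β, ⟨γ, hγ⟩, ⟨δ, hδ⟩, hpe⟩ := exists_dvd_and_dvd_of_dvd_mul (Dvd.intro q h)
  refine ⟨α, β, γ, δ, hpe, ?_, hγ, hδ⟩
  have : p * q = p * (γ * δ) := by rw [h, hγ, hδ, hpe]; ring
  exact mul_left_cancel₀ hp this

/-- from `a²U = b²V` with `a,b` coprime. -/
theorem sqSplit {a b U V : ℤ} (hc : IsCoprime a b) (hb : b ≠ 0) (h : a ^ 2 * U = b ^ 2 * V) :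
    ∃ j, U = b ^ 2 * j ∧ V = a ^ 2 * j := by
  have hd : b ^ 2 ∣ U := by
    have : b ^ 2 ∣ a ^ 2 * U := ⟨V, h⟩
    exact (hc.symm.pow (m := 2) (n := 2)).dvd_of_dvd_mul_left this
  obtain ⟨j, hj⟩ := hd
  refine ⟨j, hj, ?_⟩
  have : b ^ 2 * V = b ^ 2 * (a ^ 2 * j) := by rw [← h, hj]; ring
  exact mul_left_cancel₀ (pow_ne_zero 2 hb) this

theorem dvd3 {j a b : ℤ} (hc : IsCoprime a b) (h1 : j ∣ 3 * a ^ 2) (h2 : j ∣ 3 * b ^ 2) : j ∣ 3 := by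
  obtain ⟨u, v, huv⟩ := hc.pow (m := 2) (n := 2)
  have : (3 : ℤ) = u * (3 * a ^ 2) + v * (3 * b ^ 2) := by linear_combination (-3) * huv
  rw [this]
  exact dvd_add (Dvd.dvd.mul_left h1 u) (Dvd.dvd.mul_left h2 v)

theorem dvd3_cases {j : ℤ} (h : j ∣ 3) : j = 1 ∨ j = 3 ∨ j = -1 ∨ j = -3 := by
  have h1 : j ≤ 3 := Int.le_of_dvd (by norm_num) h
  have h2 : -j ≤ 3 := Int.le_of_dvd (by norm_num) ((neg_dvd).mpr h)
  have h3 : j ≠ 0 := by rintro rfl; simp at h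
  have : -3 ≤ j := by omega
  interval_cases j <;> simp_all

theorem sq_mod4 (a : ℤ) : (a % 2 = 0 ∧ a ^ 2 % 4 = 0) ∨ (a % 2 = 1 ∧ a ^ 2 % 8 = 1) := by
  rcases Int.emod_two_eq_zero_or_one a with h | h
  · left
    refine ⟨h, ?_⟩
    obtain ⟨k, rfl⟩ : ∃ k, a = 2 * k := ⟨a / 2, by omega⟩
    have : (2 * k) ^ 2 = 4 * k ^ 2 := by ring
    omega
  · right
    refine ⟨h, ?_⟩
    obtain ⟨k, rfl⟩ : ∃ k, a = 2 * k + 1 := ⟨a / 2, by omega⟩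
    have h2 : (k * (k + 1)) % 2 = 0 := Int.even_iff.mp (Int.even_mul_succ_self k)
    have : (2 * k + 1) ^ 2 = 4 * (k * (k + 1)) + 1 := by ring
    omega

/-- key coprime positive step for system 1 -/
theorem sys1_split {a b d e : ℤ} (hab : IsCoprime a b) (hde : IsCoprime d e) (hb : b ≠ 0)
    (ha : a ≠ 0)
    (h : a ^ 2 * (d ^ 2 + e ^ 2) = b ^ 2 * (d ^ 2 + 4 * e ^ 2)) :
    d ^ 2 + e ^ 2 = b ^ 2 ∧ d ^ 2 + 4 * e ^ 2 = a ^ 2 := by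
  obtain ⟨j, h1, h2⟩ := sqSplit hab hb h
  have hj : j ∣ 3 := by
    refine dvd3 hde ⟨4 * b ^ 2 - a ^ 2, ?_⟩ ⟨a ^ 2 - b ^ 2, ?_⟩
    · linear_combination 4 * h1 - h2
    · linear_combination h2 - h1
  have hbp : 0 < b ^ 2 := by positivity
  have hap : 0 < a ^ 2 := by positivity
  rcases dvd3_cases hj with rfl | rfl | rfl | rfl
  · exact ⟨by linarith, by linarith⟩
  · exfalso
    have hd3 : d % 3 = 0 ∧ e % 3 = 0 := by
      have h3 : (d ^ 2 + e ^ 2) % 3 = 0 := by omega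
      have hd : d % 3 = 0 ∨ d % 3 = 1 ∨ d % 3 = 2 := by omega
      have he : e % 3 = 0 ∨ e % 3 = 1 ∨ e % 3 = 2 := by omega
      rcases hd with hd | hd | hd <;> rcases he with he | he | he <;>
        simp [pow_two, Int.add_emod, Int.mul_emod, hd, he] at h3 ⊢
    obtain ⟨u, v, huv⟩ := hde
    have : (3 : ℤ) ∣ 1 := by
      rw [← huv]
      exact dvd_add (Dvd.dvd.mul_left (Int.dvd_of_emod_eq_zero hd3.1) u)
        (Dvd.dvd.mul_left (Int.dvd_of_emod_eq_zero hd3.2) v)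
    norm_num at this
  · exfalso
    have : 0 ≤ d ^ 2 + e ^ 2 := by positivity
    linarith
  · exfalso
    have : 0 ≤ d ^ 2 + e ^ 2 := by positivity
    linarith

theorem cop_factor {m n a c b d : ℤ} (h : IsCoprime m n) (hm : m = a * c) (hn : n = b * d) :
    IsCoprime a b ∧ IsCoprime a d ∧ IsCoprime c b ∧ IsCoprime c d := by
  subst hm hn
  refine ⟨?_, ?_, ?_, ?_⟩
  · exact h.of_mul_left_left.of_mul_right_left
  · exact h.of_mul_left_left.of_mul_right_right
  · exact h.of_mul_left_right.of_mul_right_left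
  · exact h.of_mul_left_right.of_mul_right_right

theorem pyth {x y z : ℤ} (h : x ^ 2 + y ^ 2 = z ^ 2) (hc : IsCoprime x y) (hx : x % 2 = 1) :
    ∃ m n : ℤ, x = m ^ 2 - n ^ 2 ∧ y = 2 * m * n ∧ z ^ 2 = (m ^ 2 + n ^ 2) ^ 2 ∧ IsCoprime m n := by
  have hz : z ≠ 0 := by
    rintro rfl
    have : x ^ 2 = 0 := by nlinarith [sq_nonneg x, sq_nonneg y]
    have : x = 0 := by simpa using this
    omega
  have hp : PythagoreanTriple x y |z| := by
    unfold PythagoreanTriple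
    rw [← sq, ← sq, ← sq, sq_abs]; exact h
  obtain ⟨m, n, h1, h2, h3, h4, -⟩ := hp.coprime_classification' (Int.isCoprime_iff_gcd_eq_one.mp hc) hx
    (abs_pos.mpr hz)
  refine ⟨m, n, h1, h2, ?_, Int.isCoprime_iff_gcd_eq_one.mpr h4⟩
  rw [← sq_abs, h3]

theorem sys1 (N : ℕ) : ∀ s g h r : ℤ, (s * g).natAbs ≤ N → s ^ 2 + g ^ 2 = h ^ 2 →
    s ^ 2 + 4 * g ^ 2 = r ^ 2 → s = 0 ∨ g = 0 := by
  induction N with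
  | zero =>
    intro s g h r hN _ _
    have : s * g = 0 := by omega
    simpa using this
  | succ N ih =>
    intro s g h r hN h1 h2
    by_contra hcon
    push Not at hcon
    obtain ⟨hs, hg⟩ := hcon
    -- reduce to coprime
    have key : ∀ s g h r : ℤ, (s * g).natAbs ≤ N + 1 → s ≠ 0 → g ≠ 0 → IsCoprime s g →
        s ^ 2 + g ^ 2 = h ^ 2 → s ^ 2 + 4 * g ^ 2 = r ^ 2 → False := by
      intro s g h r hN hs hg hc h1 h2
      have hsg : s * g ≠ 0 := mul_ne_zero hs hg
      rcases Int.emod_two_eq_zero_or_one s with hpar | hpar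
      · obtain ⟨s', rfl⟩ : ∃ k, s = 2 * k := ⟨s / 2, by omega⟩
        have hr : r % 2 = 0 := by
          rcases sq_mod4 r with ⟨a, _⟩ | ⟨_, b⟩
          · exact a
          · have : (2 * s') ^ 2 + 4 * g ^ 2 = 4 * (s' ^ 2 + g ^ 2) := by ring
            omega
        obtain ⟨r', rfl⟩ : ∃ k, r = 2 * k := ⟨r / 2, by omega⟩
        have := ih g s' r' h (by
          have : 2 * s' * g = 2 * (g * s') := by ring
          rw [this] at hN hsg
          omega) (by linarith) (by linarith)
        rcases this with h | h
        · exact hg h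
        · exact hs (by simp [h])
      · have hc2 : IsCoprime s (2 * g) := by
          refine IsCoprime.mul_right ?_ hc
          exact (Int.isCoprime_iff_gcd_eq_one.mpr (by
            have := Int.odd_iff.mpr hpar
            exact Int.isCoprime_iff_gcd_eq_one.mp (Int.isCoprime_two_right.mpr this)))
        obtain ⟨m, n, e1, e2, -, cmn⟩ := pyth h1 hc hpar
        obtain ⟨p, q, e3, e4, -, cpq⟩ := pyth (z := r) (by linarith : s ^ 2 + (2 * g) ^ 2 = r ^ 2) hc2 hpar
        have hpq : p * q = 2 * (m * n) := by linarith
        have hm : m ≠ 0 := by rintro rfl; simp at e2; exact hg e2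
        have hn : n ≠ 0 := by rintro rfl; simp at e2; exact hg e2
        have hbig : ∀ d e : ℤ, d * e ∣ m * n → d ≠ 0 → e ≠ 0 → (d * e).natAbs ≤ N := by
          intro d e hde hd he
          have hle : (d * e).natAbs ≤ (m * n).natAbs :=
            Nat.le_of_dvd (Int.natAbs_pos.mpr (mul_ne_zero hm hn)) (Int.natAbs_dvd_natAbs.mpr hde)
          have h3 : (s * g).natAbs = s.natAbs * (2 * (m * n).natAbs) := by
            rw [Int.natAbs_mul, e2, mul_assoc, Int.natAbs_mul 2]; rfl
          have h4 : 1 ≤ s.natAbs := Int.natAbs_pos.mpr hs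
          have h5 : 1 ≤ (m * n).natAbs := Int.natAbs_pos.mpr (mul_ne_zero hm hn)
          nlinarith
        have heq : m ^ 2 - n ^ 2 = p ^ 2 - q ^ 2 := by linarith
        rcases Int.emod_two_eq_zero_or_one p with hp2 | hp2
        · obtain ⟨p', rfl⟩ : ∃ k, p = 2 * k := ⟨p / 2, by omega⟩
          have hp' : p' ≠ 0 := by
            rintro rfl
            exact mul_ne_zero hm hn (by linarith)
          obtain ⟨α, β, γ, δ, rfl, rfl, rfl, rfl⟩ := fourNum hp' (by linarith : p' * q = m * n)
          obtain ⟨c1, c2, c3, c4⟩ := cop_factor cmn rfl rfl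
          have hα := left_ne_zero_of_mul hm
          have hγ := right_ne_zero_of_mul hm
          have hβ := left_ne_zero_of_mul hn
          have hδ := right_ne_zero_of_mul hn
          obtain ⟨f1, f2⟩ := sys1_split (a := γ) (b := β) (d := δ) (e := α) c3 c2.symm hβ hγ
            (by linear_combination heq)
          rcases ih δ α β γ (hbig _ _ ⟨γ * β, by ring⟩ hδ hα) f1 f2 with h | h
          · exact hδ h
          · exact hα h
        · have hq2 : q % 2 = 0 := by
            rcases Int.emod_two_eq_zero_or_one q with h | h
            · exact h
            · have := Int.mul_emod p q 2
              rw [hp2, h] at this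
              omega
          obtain ⟨q', rfl⟩ : ∃ k, q = 2 * k := ⟨q / 2, by omega⟩
          have hq' : q' ≠ 0 := by
            rintro rfl
            exact mul_ne_zero hm hn (by linarith)
          obtain ⟨α, β, γ, δ, rfl, rfl, rfl, rfl⟩ := fourNum hq' (by linarith : q' * p = m * n)
          obtain ⟨c1, c2, c3, c4⟩ := cop_factor cmn rfl rfl
          have hα := left_ne_zero_of_mul hm
          have hγ := right_ne_zero_of_mul hm
          have hβ := left_ne_zero_of_mul hn
          have hδ := right_ne_zero_of_mul hn
          obtain ⟨f1, f2⟩ := sys1_split (a := δ) (b := α) (d := γ) (e := β) c2.symm c3 hα hδ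
            (by linear_combination (-1) * heq)
          rcases ih γ β α δ (hbig _ _ ⟨α * δ, by ring⟩ hγ hβ) f1 f2 with h | h
          · exact hγ h
          · exact hβ h
    obtain ⟨D, s', g', hD, hc, rfl, rfl⟩ : ∃ D s' g' : ℤ, D ≠ 0 ∧ IsCoprime s' g' ∧ s = s' * D ∧ g = g' * D := by
      have hpos : 0 < Int.gcd s g := Int.gcd_pos_of_ne_zero_left _ hs
      obtain ⟨s', g', hc, e1, e2⟩ := Int.exists_gcd_one hpos
      exact ⟨_, s', g', by exact_mod_cast hpos.ne', Int.isCoprime_iff_gcd_eq_one.mpr hc, e1, e2⟩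
    have d1 : D ^ 2 ∣ h ^ 2 := ⟨s' ^ 2 + g' ^ 2, by linear_combination -h1⟩
    have d2 : D ^ 2 ∣ r ^ 2 := ⟨s' ^ 2 + 4 * g' ^ 2, by linear_combination -h2⟩
    obtain ⟨h', rfl⟩ := (Int.pow_dvd_pow_iff two_ne_zero).mp d1
    obtain ⟨r', rfl⟩ := (Int.pow_dvd_pow_iff two_ne_zero).mp d2
    refine key s' g' h' r' ?_ (left_ne_zero_of_mul hs) (left_ne_zero_of_mul hg) hc ?_ ?_
    · refine le_trans ?_ hN
      apply Nat.le_of_dvd (Int.natAbs_pos.mpr (mul_ne_zero hs hg))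
      exact Int.natAbs_dvd_natAbs.mpr ⟨D * D, by ring⟩
    · exact mul_left_cancel₀ (pow_ne_zero 2 hD) (by linear_combination h1)
    · exact mul_left_cancel₀ (pow_ne_zero 2 hD) (by linear_combination h2)

theorem sys2 (N : ℕ) : ∀ s g p q : ℤ, g.natAbs ≤ N → p ^ 2 + g ^ 2 = s ^ 2 →
    q ^ 2 + 4 * g ^ 2 = s ^ 2 → g = 0 := by
  induction N with
  | zero =>
    intro s g p q hN _ _
    omega
  | succ N ih =>
    intro s g p q hN h1 h2
    by_contra hg
    have key : ∀ s g p q : ℤ, g.natAbs ≤ N + 1 → g ≠ 0 → IsCoprime s g →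
        p ^ 2 + g ^ 2 = s ^ 2 → q ^ 2 + 4 * g ^ 2 = s ^ 2 → False := by
      intro s g p q hN hg hc h1 h2
      have hsq := sq_mod4 s
      have hgq := sq_mod4 g
      have hpq := sq_mod4 p
      have hqq := sq_mod4 q
      have hnb : ¬ (s % 2 = 0 ∧ g % 2 = 0) := by
        rintro ⟨h, h'⟩
        obtain ⟨u, v, huv⟩ := hc
        have : (2 : ℤ) ∣ 1 := by
          rw [← huv]
          exact dvd_add (Dvd.dvd.mul_left (Int.dvd_of_emod_eq_zero h) u)
            (Dvd.dvd.mul_left (Int.dvd_of_emod_eq_zero h') v)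
        norm_num at this
      have hs1 : s % 2 = 1 := by omega
      have hg0 : g % 2 = 0 := by omega
      have hp1 : p % 2 = 1 := by omega
      have hq1 : q % 2 = 1 := by omega
      have cpg : IsCoprime p g := by
        have : IsCoprime (p ^ 2) (g ^ 2) := by
          have h3 : p ^ 2 = s ^ 2 + g ^ 2 * (-1) := by linarith
          rw [h3]
          exact (IsCoprime.add_mul_left_left_iff).mpr (hc.pow (m := 2) (n := 2))
        exact (IsCoprime.pow_iff two_pos two_pos).mp this
      have cqg : IsCoprime q g := by
        have : IsCoprime (q ^ 2) (g ^ 2) := by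
          have h3 : q ^ 2 = s ^ 2 + g ^ 2 * (-4) := by linarith
          rw [h3]
          exact (IsCoprime.add_mul_left_left_iff).mpr (hc.pow (m := 2) (n := 2))
        exact (IsCoprime.pow_iff two_pos two_pos).mp this
      have cq2g : IsCoprime q (2 * g) := by
        refine IsCoprime.mul_right ?_ cqg
        exact Int.isCoprime_two_right.mpr (Int.odd_iff.mpr hq1)
      obtain ⟨m, n, e1, e2, e5, cmn⟩ := pyth h1 cpg hp1
      obtain ⟨k, l, e3, e4, e6, ckl⟩ := pyth (z := s) (by linarith : q ^ 2 + (2 * g) ^ 2 = s ^ 2) cq2g hq1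
      have hm : m ≠ 0 := by rintro rfl; simp at e2; exact hg e2
      have hn : n ≠ 0 := by rintro rfl; simp at e2; exact hg e2
      have heq : m ^ 2 + n ^ 2 = k ^ 2 + l ^ 2 := by
        have : (m ^ 2 + n ^ 2) ^ 2 = (k ^ 2 + l ^ 2) ^ 2 := by rw [← e5, e6]
        exact (sq_eq_sq₀ (by positivity) (by positivity)).mp this
      have hkl : k * l = 2 * (m * n) := by linarith
      have hsum : ∃ k l : ℤ, k % 2 = 0 ∧ l % 2 = 1 ∧ k * l = 2 * (m * n) ∧
          m ^ 2 + n ^ 2 = k ^ 2 + l ^ 2 := by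
        have hk := sq_mod4 k
        have hl := sq_mod4 l
        rcases Int.emod_two_eq_zero_or_one k with h | h
        · exact ⟨k, l, h, by omega, hkl, heq⟩
        · exact ⟨l, k, by omega, h, by linarith, by linarith⟩
      clear hkl heq e6 e4 e3 ckl
      obtain ⟨k, l, hk0, hl1, hkl, heq⟩ := hsum
      obtain ⟨k', rfl⟩ : ∃ k', k = 2 * k' := ⟨k / 2, by omega⟩
      have hk' : k' ≠ 0 := by
        rintro rfl
        exact mul_ne_zero hm hn (by linarith)
      have hbig : ∀ d : ℤ, d ∣ m * n → d.natAbs ≤ N := by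
        intro d hde
        have hle : d.natAbs ≤ (m * n).natAbs :=
          Nat.le_of_dvd (Int.natAbs_pos.mpr (mul_ne_zero hm hn)) (Int.natAbs_dvd_natAbs.mpr hde)
        have h3 : g.natAbs = 2 * (m * n).natAbs := by
          rw [e2, mul_assoc, Int.natAbs_mul 2]; rfl
        have h5 : 1 ≤ (m * n).natAbs := Int.natAbs_pos.mpr (mul_ne_zero hm hn)
        omega
      obtain ⟨α, β, γ, δ, rfl, rfl, rfl, rfl⟩ := fourNum hk' (by linarith : k' * l = m * n)
      obtain ⟨c1, c2, c3, c4⟩ := cop_factor cmn rfl rfl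
      have hα := left_ne_zero_of_mul hm
      have hγ := right_ne_zero_of_mul hm
      have hβ := left_ne_zero_of_mul hn
      have hδ := right_ne_zero_of_mul hn
      have hγδ : γ % 2 = 1 ∧ δ % 2 = 1 := by
        have := Int.mul_emod γ δ 2
        rcases Int.emod_two_eq_zero_or_one γ with h | h <;>
        rcases Int.emod_two_eq_zero_or_one δ with h' | h' <;> rw [h, h'] at this <;> omega
      have q1 := sq_mod4 α
      have q2 := sq_mod4 β
      have q3 := sq_mod4 γ
      have q4 := sq_mod4 δ
      obtain ⟨j, f1, f2⟩ := sqSplit (a := δ) (b := α) (U := γ ^ 2 - β ^ 2) (V := γ ^ 2 - 4 * β ^ 2)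
        c2.symm hα (by linear_combination -heq)
      have hj : j ∣ 3 := by
        refine dvd3 c3 ⟨4 * α ^ 2 - δ ^ 2, ?_⟩ ⟨α ^ 2 - δ ^ 2, ?_⟩
        · linear_combination 4 * f1 - f2
        · linear_combination f1 - f2
      rcases dvd3_cases hj with rfl | rfl | rfl | rfl
      · exact hβ (ih γ β α δ (hbig _ ⟨α * γ * δ, by ring⟩) (by linarith) (by linarith))
      · omega
      · omega
      · exact hα (ih δ α β γ (hbig _ ⟨β * γ * δ, by ring⟩) (by linarith) (by linarith))
    obtain ⟨D, s', g', hD, hc, rfl, rfl⟩ : ∃ D s' g' : ℤ, D ≠ 0 ∧ IsCoprime s' g' ∧ s = s' * D ∧ g = g' * D := by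
      have hpos : 0 < Int.gcd s g := Int.gcd_pos_of_ne_zero_right _ hg
      obtain ⟨s', g', hc, e1, e2⟩ := Int.exists_gcd_one hpos
      exact ⟨_, s', g', by exact_mod_cast hpos.ne', Int.isCoprime_iff_gcd_eq_one.mpr hc, e1, e2⟩
    have d1 : D ^ 2 ∣ p ^ 2 := ⟨s' ^ 2 - g' ^ 2, by linear_combination h1⟩
    have d2 : D ^ 2 ∣ q ^ 2 := ⟨s' ^ 2 - 4 * g' ^ 2, by linear_combination h2⟩
    obtain ⟨p', rfl⟩ := (Int.pow_dvd_pow_iff two_ne_zero).mp d1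
    obtain ⟨q', rfl⟩ := (Int.pow_dvd_pow_iff two_ne_zero).mp d2
    refine key s' g' p' q' ?_ (left_ne_zero_of_mul hg) hc ?_ ?_
    · refine le_trans ?_ hN
      apply Nat.le_of_dvd (Int.natAbs_pos.mpr hg)
      exact Int.natAbs_dvd_natAbs.mpr ⟨D, by ring⟩
    · exact mul_left_cancel₀ (pow_ne_zero 2 hD) (by linear_combination h1)
    · exact mul_left_cancel₀ (pow_ne_zero 2 hD) (by linear_combination h2)

theorem rat_int_sq {q : ℚ} {n : ℤ} (h : (n : ℚ) = q ^ 2) : ∃ m : ℤ, n = m ^ 2 := by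
  have : IsSquare ((n : ℤ) : ℚ) := ⟨q, by rw [h, sq]⟩
  rw [Rat.isSquare_intCast_iff] at this
  obtain ⟨m, hm⟩ := this
  exact ⟨m, by rw [hm, sq]⟩

/-- `ξ²+1` and `ξ²+4` both squares in ℚ only for `ξ=0`. -/
theorem sys1Q {x y z : ℚ} (h1 : x ^ 2 + 1 = y ^ 2) (h2 : x ^ 2 + 4 = z ^ 2) : x = 0 := by
  have hd : (x.den : ℚ) ≠ 0 := by exact_mod_cast x.den_ne_zero
  have hx : x = x.num / x.den := (Rat.num_div_den x).symm
  have hn : (x.num : ℚ) = x * x.den := by field_simp at hx; linarith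
  obtain ⟨m, hm⟩ := rat_int_sq (n := x.num ^ 2 + (x.den : ℤ) ^ 2) (q := y * x.den) (by
    push_cast; rw [hn]; linear_combination (x.den : ℚ) ^ 2 * h1)
  obtain ⟨k, hk⟩ := rat_int_sq (n := x.num ^ 2 + 4 * (x.den : ℤ) ^ 2) (q := z * x.den) (by
    push_cast; rw [hn]; linear_combination (x.den : ℚ) ^ 2 * h2)
  rcases sys1 _ _ _ _ _ le_rfl hm hk with h | h
  · exact Rat.num_eq_zero.mp h
  · exact absurd h (by exact_mod_cast x.den_ne_zero)

theorem sys2Q {x y z : ℚ} (h1 : x ^ 2 - 1 = y ^ 2) (h2 : x ^ 2 - 4 = z ^ 2) : False := by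
  have hd : (x.den : ℚ) ≠ 0 := by exact_mod_cast x.den_ne_zero
  have hx : x = x.num / x.den := (Rat.num_div_den x).symm
  have hn : (x.num : ℚ) = x * x.den := by field_simp at hx; linarith
  obtain ⟨m, hm⟩ := rat_int_sq (n := x.num ^ 2 - (x.den : ℤ) ^ 2) (q := y * x.den) (by
    push_cast; rw [hn]; linear_combination (x.den : ℚ) ^ 2 * h1)
  obtain ⟨k, hk⟩ := rat_int_sq (n := x.num ^ 2 - 4 * (x.den : ℤ) ^ 2) (q := z * x.den) (by
    push_cast; rw [hn]; linear_combination (x.den : ℚ) ^ 2 * h2)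
  have := sys2 _ x.num x.den m k le_rfl (by linarith) (by linarith)
  exact absurd this (by exact_mod_cast x.den_ne_zero)

/-- a discrete order function with values in `ℤ` (junk at zero) -/
structure OrdFn (K : Type*) [Field K] where
  ord : K → ℤ
  mul' : ∀ x y : K, x ≠ 0 → y ≠ 0 → ord (x * y) = ord x + ord y
  add' : ∀ x y : K, x ≠ 0 → y ≠ 0 → x + y ≠ 0 → min (ord x) (ord y) ≤ ord (x + y)
  two_pos : 0 < ord 2
  not8 : ¬ (8 : ℤ) ∣ ord 2

open NumberField IsDedekindDomain in
theorem exists_prime_not8 (K : Type*) [Field K] [NumberField K]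
    (hd : Module.finrank ℚ K < 8 ∨ Odd (Module.finrank ℚ K)) :
    ∃ P : HeightOneSpectrum (𝓞 K), (2 : 𝓞 K) ∈ P.asIdeal ∧
      ¬ 8 ∣ multiplicity P.asIdeal (Ideal.span {(2 : 𝓞 K)}) := by
  classical
  have hp : Prime (2 : ℤ) := Int.prime_two
  set p : Ideal ℤ := Ideal.span {(2 : ℤ)} with hpdef
  have hp0 : p ≠ ⊥ := by simp [hpdef]
  have : p.IsPrime := (Ideal.span_singleton_prime (by norm_num)).2 hp
  have : p.IsMaximal := Ideal.IsPrime.isMaximal inferInstance hp0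
  have hmap : p.map (algebraMap ℤ (𝓞 K)) = Ideal.span {(2 : 𝓞 K)} := by
    rw [hpdef, Ideal.map_span]; simp
  have hmap0 : p.map (algebraMap ℤ (𝓞 K)) ≠ ⊥ := by rw [hmap]; simp
  have : Fintype (p.primesOver (𝓞 K)) :=
    (IsDedekindDomain.primesOver_finite p (𝓞 K)).fintype
  have hsum := Ideal.sum_ramification_inertia_eq_finrank (R := ℤ) (S := 𝓞 K) p
  rw [RingOfIntegers.rank] at hsum
  by_contra hcon
  push Not at hcon
  have key : ∀ q : p.primesOver (𝓞 K), 8 ∣ q.1.ramificationIdx ℤ := by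
    intro q
    have := q.2.1
    have := q.2.2
    have hq0 : q.1 ≠ ⊥ := Ideal.ne_bot_of_liesOver_of_ne_bot hp0 q.1
    have h2 := hcon ⟨q.1, q.2.1, hq0⟩ (by
      have : Ideal.span {(2 : 𝓞 K)} ≤ q.1 := by
        rw [← hmap]; exact Ideal.map_le_of_le_comap (le_of_eq (Ideal.over_def q.1 p))
      exact this (Ideal.mem_span_singleton_self _))
    rw [Ideal.IsDedekindDomain.ramificationIdx_eq_multiplicity p q.1 hmap0, hmap]
    exact h2
  have h8 : 8 ∣ Module.finrank ℚ K := by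
    rw [← hsum]
    exact Finset.dvd_sum fun q _ => Dvd.dvd.mul_right (key q) _
  have hpos : 0 < Module.finrank ℚ K := Module.finrank_pos
  rcases hd with h | h
  · exact absurd (Nat.le_of_dvd hpos h8) (by omega)
  · rw [Nat.odd_iff] at h; omega

open NumberField IsDedekindDomain in
theorem exists_ordFn (K : Type*) [Field K] [NumberField K]
    (hd : Module.finrank ℚ K < 8 ∨ Odd (Module.finrank ℚ K)) : Nonempty (OrdFn K) := by
  obtain ⟨P, hP, h8⟩ := exists_prime_not8 K hd
  have h2 : WithZero.log (P.valuation K 2) = -(multiplicity P.asIdeal (Ideal.span {(2 : 𝓞 K)}) : ℤ) := by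
    have h : P.valuation K 2 = P.intValuation 2 := by
      rw [← P.valuation_of_algebraMap (K := K)]
      congr 1
    rw [h, P.intValuation_eq_exp_neg_multiplicity two_ne_zero, WithZero.log_exp]
  refine ⟨⟨fun x => - WithZero.log (P.valuation K x), ?_, ?_, ?_, ?_⟩⟩
  · intro x y hx hy
    have hx' : P.valuation K x ≠ 0 := by simpa using hx
    have hy' : P.valuation K y ≠ 0 := by simpa using hy
    simp only [map_mul, WithZero.log_mul hx' hy']
    ring
  · intro x y hx hy hxy
    have hx' : P.valuation K x ≠ 0 := by simpa using hx
    have hy' : P.valuation K y ≠ 0 := by simpa using hy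
    have hxy' : P.valuation K (x + y) ≠ 0 := by simpa using hxy
    rcases (le_max_iff.1 (Valuation.map_add (P.valuation K) x y)) with h | h
    · have := (WithZero.log_le_log hxy' hx').2 h
      exact (min_le_left _ _).trans (by simpa using this)
    · have := (WithZero.log_le_log hxy' hy').2 h
      exact (min_le_right _ _).trans (by simpa using this)
  · rw [h2, neg_neg]
    have : multiplicity P.asIdeal (Ideal.span {(2 : 𝓞 K)}) ≠ 0 := fun h => h8 (by simp [h])
    positivity
  · rw [h2, neg_neg]
    exact_mod_cast h8

set_option linter.unusedSectionVars false

namespace OrdFn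
variable {K : Type*} [Field K] [CharZero K] (o : OrdFn K)

/-- exact order -/
def E (n : ℤ) (x : K) : Prop := x ≠ 0 ∧ o.ord x = n
/-- order at least `n` -/
def G (n : ℤ) (x : K) : Prop := x = 0 ∨ n ≤ o.ord x

variable {o}

theorem E.ne {n : ℤ} {x : K} (h : o.E n x) : x ≠ 0 := h.1

theorem E_self {x : K} (hx : x ≠ 0) : o.E (o.ord x) x := ⟨hx, rfl⟩

theorem E.mul {n m : ℤ} {x y : K} (hx : o.E n x) (hy : o.E m y) : o.E (n + m) (x * y) :=
  ⟨mul_ne_zero hx.1 hy.1, by rw [o.mul' x y hx.1 hy.1, hx.2, hy.2]⟩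

theorem E.uniq {n m : ℤ} {x : K} (hx : o.E n x) (hy : o.E m x) : n = m := hx.2.symm.trans hy.2

theorem E.G {n m : ℤ} {x : K} (hx : o.E n x) (h : m ≤ n) : o.G m x := Or.inr (by rw [hx.2]; exact h)

theorem E.not_G {n m : ℤ} {x : K} (hx : o.E n x) (h : n < m) (hg : o.G m x) : False := by
  rcases hg with h0 | h0
  · exact hx.1 h0
  · rw [hx.2] at h0; omega

theorem E_one : o.E 0 (1 : K) := by
  refine ⟨one_ne_zero, ?_⟩
  have := o.mul' 1 1 one_ne_zero one_ne_zero
  rw [one_mul] at this; omega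

theorem E_neg_one : o.E 0 (-1 : K) := by
  have h0 : (-1 : K) ≠ 0 := neg_ne_zero.2 one_ne_zero
  refine ⟨h0, ?_⟩
  have := o.mul' (-1) (-1) h0 h0
  rw [neg_mul_neg, one_mul] at this
  have h1 := (E_one (o := o)).2
  omega

theorem E.neg {n : ℤ} {x : K} (hx : o.E n x) : o.E n (-x) := by
  have := (E_neg_one (o := o)).mul hx
  rwa [neg_one_mul, zero_add] at this

theorem G.mono {n m : ℤ} {x : K} (hx : o.G n x) (h : m ≤ n) : o.G m x := by
  rcases hx with h0 | h0
  · exact Or.inl h0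
  · exact Or.inr (h.trans h0)

theorem G.neg {n : ℤ} {x : K} (hx : o.G n x) : o.G n (-x) := by
  rcases hx with h0 | h0
  · exact Or.inl (by simp [h0])
  · by_cases hx0 : x = 0
    · exact Or.inl (by simp [hx0])
    · exact ((E_self hx0).neg).G h0

theorem G.mul {n m : ℤ} {x y : K} (hx : o.G n x) (hy : o.G m y) : o.G (n + m) (x * y) := by
  by_cases hx0 : x = 0
  · exact Or.inl (by simp [hx0])
  by_cases hy0 : y = 0
  · exact Or.inl (by simp [hy0])
  have h1 := hx.resolve_left hx0
  have h2 := hy.resolve_left hy0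
  exact ((E_self hx0).mul (E_self hy0)).G (by omega)

theorem G.add {n : ℤ} {x y : K} (hx : o.G n x) (hy : o.G n y) : o.G n (x + y) := by
  by_cases hx0 : x = 0
  · rw [hx0, zero_add]; exact hy
  by_cases hy0 : y = 0
  · rw [hy0, add_zero]; exact hx
  by_cases hxy : x + y = 0
  · exact Or.inl hxy
  have h1 := hx.resolve_left hx0
  have h2 := hy.resolve_left hy0
  exact Or.inr ((le_min h1 h2).trans (o.add' x y hx0 hy0 hxy))

theorem E.add {n : ℤ} {x y : K} (hx : o.E n x) (hy : o.G (n + 1) y) : o.E n (x + y) := by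
  have hg : o.G n (x + y) := (hx.G le_rfl).add (hy.mono (by omega))
  have hne : x + y ≠ 0 := by
    intro h
    have : x = -y := by linear_combination h
    exact hx.not_G (by omega) (this ▸ hy.neg)
  have hle := hg.resolve_left hne
  refine ⟨hne, le_antisymm ?_ hle⟩
  by_contra hcon
  push Not at hcon
  have h1 : o.G (n + 1) (x + y) := Or.inr (by omega)
  have h2 : o.G (n + 1) (x + y + -y) := h1.add hy.neg
  rw [add_neg_cancel_right] at h2
  exact hx.not_G (by omega) h2

theorem E.add' {n m : ℤ} {x y : K} (hx : o.E n x) (hy : o.E m y) (h : n < m) : o.E n (x + y) :=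
  hx.add (hy.G (by omega))

theorem E_two : o.E (o.ord 2) (2 : K) := E_self two_ne_zero

theorem E_four : o.E (2 * o.ord 2) (4 : K) := by
  have := (E_two (o := o)).mul E_two
  convert this using 1
  · ring
  · norm_num

theorem E_eight : o.E (3 * o.ord 2) (8 : K) := by
  have := (E_two (o := o)).mul E_four
  convert this using 1
  · ring
  · norm_num

theorem E_of_odd {a : K} (h : ∃ b : K, o.G 0 b ∧ a = 1 + 2 * b) : o.E 0 a := by
  obtain ⟨b, hb, rfl⟩ := h
  have h2 := (E_two (o := o)).G le_rfl
  exact E_one.add ((h2.mul hb).mono (by have := o.two_pos; omega))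

/-- if `x(x+c)` has order `n` and `c` has order `m` with `n < 2m` then `x` has order `n/2` -/
theorem half_ord {n m : ℤ} {x c : K} (hp : o.E n (x * (x + c))) (hc : o.E m c) (h : n < 2 * m) :
    ∃ k, o.E k x ∧ 2 * k = n := by
  have hx0 : x ≠ 0 := left_ne_zero_of_mul hp.1
  have hx := E_self (o := o) hx0
  rcases lt_or_ge (o.ord x) m with h1 | h1
  · have h2 := hx.add' hc h1
    have h3 := (hx.mul h2).uniq hp
    exact ⟨_, hx, by omega⟩
  · exfalso
    have h2 : o.G m x := hx.G h1
    have h3 : o.G m (x + c) := h2.add (hc.G le_rfl)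
    exact hp.not_G h ((h2.mul h3).mono (by omega))

end OrdFn

section LemmaN
variable {K : Type*} [Field K] [CharZero K]

/-- `q(X) = X(X²-X+1)` -/
def qE (X : K) : K := X * (X ^ 2 - X + 1)
/-- doubling on `x`-coordinates (for `s Y² = q(X)`) -/
def dE (X : K) : K := (X ^ 2 - 1) ^ 2 / (4 * qE X)
/-- points -/
def fE (s : K) : Set K := {X | IsSquare (s * qE X)}

theorem dE_mem {s X : K} (hs : s ^ 2 = 1) (hX : X ∈ fE s) (h0 : qE X ≠ 0) : dE X ∈ fE s := by
  obtain ⟨y, hy⟩ := hX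
  have hy0 : y ≠ 0 := by
    rintro rfl
    have : s ≠ 0 := by rintro rfl; norm_num at hs
    have := mul_ne_zero this h0
    simp [hy] at this
  have hs0 : s ≠ 0 := by rintro rfl; norm_num at hs
  have hM : (X ^ 2 - 1) ^ 4 - 4 * qE X * (X ^ 2 - 1) ^ 2 + 16 * qE X ^ 2
      = (X ^ 4 - 2 * X ^ 3 + 6 * X ^ 2 - 2 * X + 1) ^ 2 := by unfold qE; ring
  refine ⟨(X ^ 2 - 1) * (X ^ 4 - 2 * X ^ 3 + 6 * X ^ 2 - 2 * X + 1) / (8 * y ^ 3), ?_⟩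
  have e1 : s * qE (dE X) = s * ((X ^ 2 - 1) ^ 2 *
      (X ^ 4 - 2 * X ^ 3 + 6 * X ^ 2 - 2 * X + 1) ^ 2) / (64 * qE X ^ 3) := by
    rw [← hM]
    show s * (dE X * (dE X ^ 2 - dE X + 1)) = _
    unfold dE
    field_simp
    ring
  rw [e1, show (X ^ 2 - 1) * (X ^ 4 - 2 * X ^ 3 + 6 * X ^ 2 - 2 * X + 1) / (8 * y ^ 3) *
    ((X ^ 2 - 1) * (X ^ 4 - 2 * X ^ 3 + 6 * X ^ 2 - 2 * X + 1) / (8 * y ^ 3)) =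
    ((X ^ 2 - 1) ^ 2 * (X ^ 4 - 2 * X ^ 3 + 6 * X ^ 2 - 2 * X + 1) ^ 2) / (64 * (y * y) ^ 3) by
      field_simp; ring, ← hy]
  have e2 : (s * qE X) ^ 3 = s * qE X ^ 3 := by linear_combination (s * qE X ^ 3) * hs
  have e3 : (s * qE X ^ 3) = qE X ^ 3 / s := by
    field_simp; linear_combination hs
  rw [e2, e3]
  field_simp

open OrdFn

theorem no_neg_ord {s : K} (o : OrdFn K) (hs : s ^ 2 = 1) (hfin : (fE s).Finite) {X : K} (hX : X ∈ fE s)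
    {m : ℤ} (hm : m < 0) (h : o.E m X) : False := by
  have he := o.two_pos
  have step : ∀ (m : ℤ) (X : K), m < 0 → o.E m X → o.E (m - 2 * o.ord 2) (dE X) ∧ qE X ≠ 0 := by
    intro m X hm h
    have h2 : o.E (2 * m) (X ^ 2 - 1) := by
      have := (h.mul h).add' E_neg_one (by omega)
      convert this using 1 <;> ring
    have h3 : o.E (2 * m) (X ^ 2 - X + 1) := by
      have := ((h.mul h).add' h.neg (by omega)).add' E_one (by omega)
      convert this using 1 <;> ring
    have h4 := h.mul h3
    have h5 := (E_four (o := o)).mul h4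
    have hq : qE X ≠ 0 := h4.1
    refine ⟨?_, hq⟩
    have h6 : o.E (2 * m + 2 * m) (dE X * (4 * qE X)) := by
      have : dE X * (4 * qE X) = (X ^ 2 - 1) * (X ^ 2 - 1) := by
        unfold dE; field_simp
      rw [this]; exact h2.mul h2
    have hd0 : dE X ≠ 0 := left_ne_zero_of_mul h6.1
    have h7 := ((E_self (o := o) hd0).mul h5).uniq h6
    exact ⟨hd0, by omega⟩
  have hit : ∀ n : ℕ, (dE^[n] X) ∈ fE s ∧ o.E (m - 2 * o.ord 2 * n) (dE^[n] X) := by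
    intro n
    induction n with
    | zero => exact ⟨hX, by simpa using h⟩
    | succ n ih =>
      rw [Function.iterate_succ_apply']
      have hneg : m - 2 * o.ord 2 * n < 0 := by
        have : 0 ≤ 2 * o.ord 2 * (n : ℤ) := by positivity
        omega
      obtain ⟨h1, h2⟩ := step _ _ hneg ih.2
      refine ⟨dE_mem hs ih.1 h2, ?_⟩
      convert h1 using 1
      push_cast; ring
  have hinj : Function.Injective (fun n : ℕ => dE^[n] X) := by
    intro a b hab
    have h1 := (hit a).2
    have h2 := (hit b).2
    simp only at hab
    rw [hab] at h1
    have h3 := h1.uniq h2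
    have h4 : (2 * o.ord 2) * ((a : ℤ) - b) = 0 := by linear_combination -h3
    rcases mul_eq_zero.1 h4 with h5 | h5
    · omega
    · omega
  exact Set.infinite_of_injective_forall_mem hinj (fun n => (hit n).1) hfin

theorem dE_mul {X : K} (h : qE X ≠ 0) : dE X * (4 * qE X) = (X ^ 2 - 1) * (X ^ 2 - 1) := by
  unfold dE; field_simp

theorem ord_nonpos {s : K} (o : OrdFn K) (hs : s ^ 2 = 1) (hfin : (fE s).Finite) {X : K}
    (hX : X ∈ fE s) (h0 : qE X ≠ 0) : o.E 0 X := by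
  have he := o.two_pos
  have hX0 : X ≠ 0 := left_ne_zero_of_mul h0
  have hE := E_self (o := o) hX0
  rcases lt_trichotomy (o.ord X) 0 with h | h | h
  · exact (no_neg_ord o hs hfin hX h hE).elim
  · rwa [h] at hE
  · exfalso
    have h2 : o.E 0 (X ^ 2 - 1) := by
      have := (E_neg_one (o := o)).add' (hE.mul hE) (by omega)
      convert this using 1; ring
    have h3 : o.E 0 (X ^ 2 - X + 1) := by
      have := ((E_one (o := o)).add' hE.neg (by omega)).add' (hE.mul hE) (by omega)
      convert this using 1; ring
    have h5 := (E_four (o := o)).mul (hE.mul h3)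
    have h6 := h2.mul h2
    rw [← dE_mul h0] at h6
    have hd0 : dE X ≠ 0 := left_ne_zero_of_mul h6.1
    have h7 := ((E_self (o := o) hd0).mul h5).uniq h6
    exact no_neg_ord o hs hfin (dE_mem hs hX h0) (by omega : o.ord (dE X) < 0) (E_self hd0)

theorem ord_u {s : K} (o : OrdFn K) (hs : s ^ 2 = 1) (hfin : (fE s).Finite) {X : K}
    (hX : X ∈ fE s) (h0 : qE X ≠ 0) (h1 : qE (dE X) ≠ 0) :
    o.E 0 (qE X) ∧ ∃ f, o.E f (X - 1) ∧ 2 * f = o.ord 2 := by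
  have he := o.two_pos
  have hE := ord_nonpos o hs hfin hX h0
  have hE' := ord_nonpos o hs hfin (dE_mem hs hX h0) h1
  have hq0 : X ^ 2 - X + 1 ≠ 0 := right_ne_zero_of_mul h0
  have hqE := E_self (o := o) hq0
  have h6 := hE'.mul ((E_four (o := o)).mul (hE.mul hqE))
  change o.E _ (dE X * (4 * qE X)) at h6
  rw [dE_mul h0] at h6
  have hx1 : X ^ 2 - 1 ≠ 0 := left_ne_zero_of_mul h6.1
  have h7 := E_self (o := o) hx1
  have h8 := (h7.mul h7).uniq h6
  have hge : 0 ≤ o.ord (X ^ 2 - X + 1) := by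
    have : o.G 0 (X ^ 2 - X + 1) := by
      have := (((hE.mul hE).G (by omega : (0:ℤ) ≤ 0 + 0)).add (hE.neg.G le_rfl)).add (E_one.G le_rfl)
      convert this using 1; ring
    exact this.resolve_left hq0
  have hz : o.ord (X ^ 2 - X + 1) = 0 := by
    by_contra hne
    have hX2 : o.E 0 (X - 2) := by
      have := hE.add' E_two.neg he
      convert this using 1; ring
    have h9 := hX2.add' hqE (by omega)
    rw [show X - 2 + (X ^ 2 - X + 1) = X ^ 2 - 1 by ring] at h9
    have := h9.uniq h7
    omega
  rw [hz] at h8 hqE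
  refine ⟨hE.mul hqE, ?_⟩
  rw [show X ^ 2 - 1 = (X - 1) * ((X - 1) + 2) by ring] at h7 h8
  obtain ⟨k, hk, hk2⟩ := half_ord h7 E_two (by omega)
  exact ⟨k, hk, by omega⟩

theorem lemmaN {s : K} (o : OrdFn K) (hs : s = 1 ∨ s = -1) (hfin : (fE s).Finite) {X : K}
    (hX : X ∈ fE s) (h0 : qE X ≠ 0) (h1 : qE (dE X) ≠ 0) (h2 : qE (dE (dE X)) ≠ 0) : False := by
  have hs2 : s ^ 2 = 1 := by rcases hs with rfl | rfl <;> norm_num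
  have he := o.two_pos
  have h8 := o.not8
  obtain ⟨hq, f, hu, hf⟩ := ord_u o hs2 hfin hX h0 h1
  obtain ⟨hq', f', hu', hf'⟩ := ord_u o hs2 hfin (dE_mem hs2 hX h0) h1 h2
  have hXE := ord_nonpos o hs2 hfin hX h0
  obtain rfl : f' = f := by omega
  obtain ⟨u, rfl⟩ : ∃ u, X = 1 + u := ⟨X - 1, by ring⟩
  rw [add_sub_cancel_left] at hu
  have hd := dE_mul h0
  have hqu : qE (1 + u) = 1 + 2 * u + 2 * u ^ 2 + u ^ 3 := by unfold qE; ring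
  have e4 := (E_four (o := o))
  have e8 := (E_eight (o := o))
  have e2 := (E_two (o := o))
  have k1 := hu'.mul (e4.mul hq)
  have k2 : o.E (5 * f') ((u * u - 2) * ((u * u - 2) + 4)) := by
    have := (k1.add' (e4.mul (hu.mul hu)) (by omega)).add' (e8.mul hu) (by omega)
    convert this using 1
    · omega
    · linear_combination -hd + 4 * hqu
  obtain ⟨k, hk, hk2⟩ := half_ord k2 e4 (by omega)
  have hk' : o.E k (u * u + 2) := by
    have := hk.add' e4 (by omega)
    convert this using 1; ring
  obtain ⟨y, hy⟩ := hX
  rcases hs with rfl | rfl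
  · have k3 : o.E (f' + k) ((y - 1) * ((y - 1) + 2)) := by
      have := (hu.mul hk').add' (e2.mul (hu.mul hu)) (by omega)
      convert this using 1
      rw [hqu] at hy
      linear_combination -hy
    obtain ⟨t, _, ht⟩ := half_ord k3 e2 (by omega)
    omega
  · have k3 : o.E k ((y - 1 - u) * ((y - 1 - u) + 2 * (1 + u))) := by
      have g1 := ((hu.mul hk').neg.G (by omega : k + 1 ≤ f' + k)).add
        ((e2.mul (hu.mul hu)).neg.G (by omega))
      have g2 := g1.add ((e2.mul hu).neg.G (by omega))
      have := hk'.neg.add g2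
      convert this using 1
      rw [hqu] at hy
      linear_combination -hy
    obtain ⟨t, _, ht⟩ := half_ord k3 (e2.mul hXE) (by omega)
    omega

/-- a rational number with even denominator is not an `X`-coordinate -/
theorem no_rat_pt {s : K} (o : OrdFn K) (hs : s ^ 2 = 1) (hfin : (fE s).Finite) {X a b : K}
    (hX : X ∈ fE s) (ha : o.E 0 a) (h : X * b = a) {m : ℤ} (hb : o.E m b) (hm : 0 < m) : False := by
  have hx0 : X ≠ 0 := by rintro rfl; apply ha.1; rw [← h]; simp
  have := ((E_self (o := o) hx0).mul hb)
  rw [h] at this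
  have := this.uniq ha
  exact no_neg_ord o hs hfin hX (by omega : o.ord X < 0) (E_self hx0)

end LemmaN

/-- finiteness bookkeeping from condB -/
theorem fE_one_finite {K : Type*} [Field K] [CharZero K]
    (h : {p : K × K | p.2 ^ 2 = p.1 ^ 3 - p.1 ^ 2 + p.1}.Finite) : (fE (1 : K)).Finite := by
  refine (h.image Prod.fst).subset ?_
  rintro X ⟨y, hy⟩
  refine ⟨(X, y), ?_, rfl⟩
  simp only [Set.mem_ofPred_eq]
  unfold qE at hy
  linear_combination -hy

theorem fE_neg_one_finite {K : Type*} [Field K] [CharZero K]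
    (h : {p : K × K | p.2 ^ 2 = p.1 ^ 3 + p.1 ^ 2 + p.1}.Finite) : (fE (-1 : K)).Finite := by
  refine (h.image (fun p => - p.1)).subset ?_
  rintro X ⟨y, hy⟩
  refine ⟨(-X, y), ?_, by simp⟩
  simp only [Set.mem_ofPred_eq]
  unfold qE at hy
  linear_combination -hy

set_option linter.unusedSectionVars false
set_option linter.unnecessarySimpa false
set_option linter.unusedVariables false


section Towers
variable {L : Type*} [Field L] [CharZero L]

/-- `F + Fθ` as an intermediate field, when `θ² ∈ F` -/
def quad (F : IntermediateField ℚ L) (θ : L) (h : θ ^ 2 ∈ F) : IntermediateField ℚ L where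
  carrier := {x | ∃ a ∈ F, ∃ b ∈ F, x = a + b * θ}
  mul_mem' := by
    rintro x y ⟨a, ha, b, hb, rfl⟩ ⟨c, hc, d, hd, rfl⟩
    exact ⟨a * c + b * d * θ ^ 2, F.add_mem (F.mul_mem ha hc) (F.mul_mem (F.mul_mem hb hd) h),
      a * d + b * c, F.add_mem (F.mul_mem ha hd) (F.mul_mem hb hc), by ring⟩
  add_mem' := by
    rintro x y ⟨a, ha, b, hb, rfl⟩ ⟨c, hc, d, hd, rfl⟩
    exact ⟨a + c, F.add_mem ha hc, b + d, F.add_mem hb hd, by ring⟩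
  algebraMap_mem' r := ⟨algebraMap ℚ L r, F.algebraMap_mem r, 0, F.zero_mem, by simp⟩
  inv_mem' := by
    rintro x ⟨a, ha, b, hb, rfl⟩
    by_cases h0 : a ^ 2 - b ^ 2 * θ ^ 2 = 0
    · by_cases hb0 : b = 0
      · subst hb0
        exact ⟨a⁻¹, F.inv_mem ha, 0, F.zero_mem, by simp⟩
      · have hθ : θ ∈ F := by
          have h1 : (a / b - θ) * (a / b + θ) = 0 := by
            field_simp; linear_combination h0
          rcases mul_eq_zero.1 h1 with h2 | h2
          · rw [← sub_eq_zero.1 h2]; exact F.div_mem ha hb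
          · have : θ = -(a / b) := by linear_combination h2
            rw [this]; exact F.neg_mem (F.div_mem ha hb)
        exact ⟨(a + b * θ)⁻¹, F.inv_mem (F.add_mem ha (F.mul_mem hb hθ)), 0, F.zero_mem, by simp⟩
    · have hd : a ^ 2 - b ^ 2 * θ ^ 2 ∈ F :=
        F.sub_mem (pow_mem ha 2) (F.mul_mem (pow_mem hb 2) h)
      refine ⟨a / (a ^ 2 - b ^ 2 * θ ^ 2), F.div_mem ha hd,
        -b / (a ^ 2 - b ^ 2 * θ ^ 2), F.div_mem (F.neg_mem hb) hd, ?_⟩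
      have hne : a + b * θ ≠ 0 := by
        intro h1; apply h0; linear_combination (a - b * θ) * h1
      rw [inv_eq_iff_eq_inv, eq_comm, inv_eq_iff_eq_inv, eq_comm]
      field_simp
      ring

theorem mem_quad {F : IntermediateField ℚ L} {θ : L} {h : θ ^ 2 ∈ F} {x : L} :
    x ∈ quad F θ h ↔ ∃ a ∈ F, ∃ b ∈ F, x = a + b * θ := Iff.rfl

theorem le_quad {F : IntermediateField ℚ L} {θ : L} {h : θ ^ 2 ∈ F} : F ≤ quad F θ h :=
  fun x hx => ⟨x, hx, 0, F.zero_mem, by simp⟩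

theorem self_mem_quad {F : IntermediateField ℚ L} {θ : L} {h : θ ^ 2 ∈ F} : θ ∈ quad F θ h :=
  ⟨0, F.zero_mem, 1, F.one_mem, by simp⟩

theorem mem_botQ {x : L} : x ∈ (⊥ : IntermediateField ℚ L) ↔ ∃ q : ℚ, (q : L) = x := by
  rw [IntermediateField.mem_bot]; simp

theorem ratCast_memF (F : IntermediateField ℚ L) (q : ℚ) : (q : L) ∈ F := by
  have := F.algebraMap_mem q
  simpa using this

/-- coordinates are unique -/
theorem quad_uniq {F : IntermediateField ℚ L} {θ a b c d : L} (hθ : θ ∉ F) (ha : a ∈ F) (hb : b ∈ F)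
    (hc : c ∈ F) (hd : d ∈ F) (h : a + b * θ = c + d * θ) : a = c ∧ b = d := by
  by_cases hbd : b = d
  · subst hbd; exact ⟨by linear_combination h, rfl⟩
  · exfalso; apply hθ
    have h1 : b - d ≠ 0 := sub_ne_zero.2 hbd
    have : θ = (c - a) / (b - d) := by field_simp; linear_combination h
    rw [this]; exact F.div_mem (F.sub_mem hc ha) (F.sub_mem hb hd)

/-- norm of a square is a square -/
theorem quad_norm {F : IntermediateField ℚ L} {θ A B x : L} (h : θ ^ 2 ∈ F) (hθ : θ ∉ F)
    (hA : A ∈ F) (hB : B ∈ F) (hx : x ∈ quad F θ h) (hsq : A + B * θ = x ^ 2) :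
    ∃ c ∈ F, A ^ 2 - θ ^ 2 * B ^ 2 = c ^ 2 := by
  obtain ⟨a, ha, b, hb, rfl⟩ := hx
  have h2 : A + B * θ = (a ^ 2 + b ^ 2 * θ ^ 2) + (2 * a * b) * θ := by rw [hsq]; ring
  have h2F : (2 : L) ∈ F := by have := ratCast_memF F 2; simpa using this
  obtain ⟨e1, e2⟩ := quad_uniq hθ hA hB
    (F.add_mem (pow_mem ha 2) (F.mul_mem (pow_mem hb 2) h))
    (F.mul_mem (F.mul_mem h2F ha) hb) h2
  refine ⟨a ^ 2 - b ^ 2 * θ ^ 2, F.sub_mem (pow_mem ha 2) (F.mul_mem (pow_mem hb 2) h), ?_⟩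
  rw [e1, e2]; ring

/-- square descent -/
theorem quad_SD {F : IntermediateField ℚ L} {θ α x : L} (h : θ ^ 2 ∈ F)
    (hα : α ∈ F) (hx : x ∈ quad F θ h) (hsq : α = x ^ 2) :
    (∃ c ∈ F, α = c ^ 2) ∨ (∃ c ∈ F, α = θ ^ 2 * c ^ 2) := by
  by_cases hθ : θ ∈ F
  · left
    obtain ⟨a, ha, b, hb, rfl⟩ := hx
    exact ⟨_, F.add_mem ha (F.mul_mem hb hθ), hsq⟩
  · obtain ⟨a, ha, b, hb, rfl⟩ := hx
    have h2 : α + 0 * θ = (a ^ 2 + b ^ 2 * θ ^ 2) + (2 * a * b) * θ := by rw [hsq]; ring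
    have h2F : (2 : L) ∈ F := by have := ratCast_memF F 2; simpa using this
    obtain ⟨e1, e2⟩ := quad_uniq hθ hα F.zero_mem
      (F.add_mem (pow_mem ha 2) (F.mul_mem (pow_mem hb 2) h))
      (F.mul_mem (F.mul_mem h2F ha) hb) h2
    have e3 : a * b = 0 := by
      have : (2 : L) * (a * b) = 0 := by linear_combination -e2
      simpa using this
    rcases mul_eq_zero.1 e3 with h0 | h0
    · right; exact ⟨b, hb, by rw [e1, h0]; ring⟩
    · left; exact ⟨a, ha, by rw [e1, h0]; ring⟩

theorem quad_finrank {F : IntermediateField ℚ L} {θ : L} (h : θ ^ 2 ∈ F) (hθ : θ ∉ F) [FiniteDimensional ℚ L] :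
    Module.finrank ℚ (quad F θ h) = 2 * Module.finrank ℚ F := by
  let f : (F × F) →ₗ[ℚ] L :=
    { toFun := fun p => (p.1 : L) + (p.2 : L) * θ
      map_add' := by intro p q; simp; ring
      map_smul' := by intro r p; simp [Algebra.smul_def]; ring }
  have hinj : Function.Injective f := by
    rintro ⟨a, b⟩ ⟨c, d⟩ hab
    obtain ⟨e1, e2⟩ := quad_uniq hθ a.2 b.2 c.2 d.2 hab
    exact Prod.ext (Subtype.ext e1) (Subtype.ext e2)
  have hr : LinearMap.range f = (quad F θ h).toSubalgebra.toSubmodule := by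
    ext x
    simp only [LinearMap.mem_range, Subalgebra.mem_toSubmodule, IntermediateField.mem_toSubalgebra]
    rw [mem_quad]
    constructor
    · rintro ⟨⟨a, b⟩, rfl⟩; exact ⟨a, a.2, b, b.2, rfl⟩
    · rintro ⟨a, ha, b, hb, rfl⟩; exact ⟨(⟨a, ha⟩, ⟨b, hb⟩), rfl⟩
  have h1 := LinearMap.finrank_range_of_inj hinj
  rw [hr, Module.finrank_prod] at h1
  rw [two_mul]; exact h1

/-- `[L:ℚ]` is odd or less than eight -/
def smallDeg (L : Type*) [Field L] [CharZero L] : Prop :=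
  Module.finrank ℚ L < 8 ∨ Odd (Module.finrank ℚ L)

variable [FiniteDimensional ℚ L]

theorem quad_dvd {F : IntermediateField ℚ L} : Module.finrank ℚ F ∣ Module.finrank ℚ L :=
  ⟨_, (Module.finrank_mul_finrank ℚ F L).symm⟩

theorem tower_top (hd : smallDeg L) {w θ : L} (hw : w ^ 2 ∈ (⊥ : IntermediateField ℚ L))
    (hw' : w ∉ (⊥ : IntermediateField ℚ L)) (hθ : θ ^ 2 ∈ quad ⊥ w hw) (hθ' : θ ∉ quad ⊥ w hw) :
    quad (quad ⊥ w hw) θ hθ = ⊤ := by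
  have h1 := quad_finrank hθ hθ'
  have h2 := quad_finrank hw hw'
  rw [IntermediateField.finrank_bot] at h2
  have h3 := quad_dvd (F := quad (quad ⊥ w hw) θ hθ)
  rw [h1, h2] at h3
  have hpos : 0 < Module.finrank ℚ L := Module.finrank_pos
  have h4 : Module.finrank ℚ L = 4 := by
    rcases hd with hd | hd
    · obtain ⟨k, hk⟩ := h3; omega
    · rw [Nat.odd_iff] at hd; obtain ⟨k, hk⟩ := h3; omega
  apply IntermediateField.eq_of_le_of_finrank_eq le_top
  rw [h1, h2, IntermediateField.finrank_top', h4]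

theorem ratSqrt_notMem {w : L} {m : ℚ} (hm : ¬ IsSquare m) (hw : w ^ 2 = m) :
    w ∉ (⊥ : IntermediateField ℚ L) := by
  rw [mem_botQ]
  rintro ⟨q, rfl⟩
  apply hm
  refine ⟨q, ?_⟩
  have : ((q ^ 2 : ℚ) : L) = m := by push_cast; exact hw
  rw [← Rat.cast_injective this]; ring

theorem even_deg {w : L} {m : ℚ} (hm : ¬ IsSquare m) (hw : w ^ 2 = m) :
    2 ∣ Module.finrank ℚ L := by
  have hw2 : w ^ 2 ∈ (⊥ : IntermediateField ℚ L) := mem_botQ.2 ⟨m, hw.symm⟩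
  have h2 := quad_finrank hw2 (ratSqrt_notMem hm hw)
  rw [IntermediateField.finrank_bot] at h2
  have h3 := quad_dvd (F := quad ⊥ w hw2)
  rwa [h2] at h3

theorem rat_isSquare_of {q c : ℚ} (h : (q : L) = (c : L) ^ 2) : IsSquare q := by
  refine ⟨c, ?_⟩
  have : ((q : ℚ) : L) = ((c * c : ℚ) : L) := by rw [h]; push_cast; ring
  exact Rat.cast_injective this

/-- square in `ℚ(w)`: norm test -/
theorem quadQ_norm {w x : L} {m : ℚ} (hm : ¬ IsSquare m) (hw : w ^ 2 = m)
    (hw2 : w ^ 2 ∈ (⊥ : IntermediateField ℚ L)) {p q : ℚ}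
    (hx : x ∈ quad ⊥ w hw2) (h : (p : L) + q * w = x ^ 2) : IsSquare (p ^ 2 - m * q ^ 2) := by
  obtain ⟨c, hc, hc2⟩ := quad_norm hw2 (ratSqrt_notMem hm hw) (ratCast_memF _ p) (ratCast_memF _ q) hx h
  obtain ⟨c, rfl⟩ := mem_botQ.1 hc
  apply rat_isSquare_of (L := L) (c := c)
  rw [← hc2, hw]; push_cast; ring

theorem quadQ_SD {w x : L} {m : ℚ} (hm0 : m ≠ 0) (hw : w ^ 2 = m)
    (hw2 : w ^ 2 ∈ (⊥ : IntermediateField ℚ L)) {p : ℚ}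
    (hx : x ∈ quad ⊥ w hw2) (h : (p : L) = x ^ 2) : IsSquare p ∨ IsSquare (p * m) := by
  rcases quad_SD hw2 (ratCast_memF _ p) hx h with ⟨c, hc, hc2⟩ | ⟨c, hc, hc2⟩
  · obtain ⟨c, rfl⟩ := mem_botQ.1 hc
    exact Or.inl (rat_isSquare_of hc2)
  · obtain ⟨c, rfl⟩ := mem_botQ.1 hc
    right
    apply rat_isSquare_of (L := L) (c := c * m)
    push_cast; rw [hc2, hw]; ring

theorem two_top (hd : smallDeg L) {w θ : L} {m n : ℚ} (hm : ¬ IsSquare m) (hn : ¬ IsSquare n)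
    (hmn : ¬ IsSquare (n * m)) (hw : w ^ 2 = m) (hθ : θ ^ 2 = n)
    (hw2 : w ^ 2 ∈ (⊥ : IntermediateField ℚ L)) (hθ2 : θ ^ 2 ∈ quad ⊥ w hw2) :
    θ ∉ quad ⊥ w hw2 ∧ quad (quad ⊥ w hw2) θ hθ2 = ⊤ := by
  have hm0 : m ≠ 0 := by rintro rfl; exact hm (IsSquare.zero)
  have h1 : θ ∉ quad ⊥ w hw2 := by
    intro h
    rcases quadQ_SD hm0 hw hw2 h hθ.symm with h | h
    · exact hn h
    · exact hmn h
  exact ⟨h1, tower_top hd hw2 (ratSqrt_notMem hm hw) hθ2 h1⟩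

theorem sq_memQ {w : L} {m : ℚ} (hw : w ^ 2 = m) : w ^ 2 ∈ (⊥ : IntermediateField ℚ L) :=
  mem_botQ.2 ⟨m, hw.symm⟩

theorem NL (hd : smallDeg L) {w θ : L} {m n : ℚ} (hm : ¬ IsSquare m) (hn : ¬ IsSquare n)
    (hmn : ¬ IsSquare (n * m)) (hw : w ^ 2 = m) (hθ : θ ^ 2 = n) {p q : ℚ}
    (h : IsSquare ((p : L) + q * w)) : IsSquare (p ^ 2 - m * q ^ 2) := by
  have hw2 := sq_memQ hw
  have hθ2 : θ ^ 2 ∈ quad ⊥ w hw2 := le_quad (sq_memQ hθ)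
  obtain ⟨h1, h2⟩ := two_top hd hm hn hmn hw hθ hw2 hθ2
  obtain ⟨x, hx⟩ := h
  have hn0 : n ≠ 0 := by rintro rfl; exact hn (IsSquare.zero)
  have hx' : x ∈ quad (quad ⊥ w hw2) θ hθ2 := by rw [h2]; trivial
  have hα : (p : L) + q * w ∈ quad ⊥ w hw2 := ⟨p, ratCast_memF _ p, q, ratCast_memF _ q, rfl⟩
  rcases quad_SD hθ2 hα hx' (by rw [hx]; ring) with ⟨c, hc, hc2⟩ | ⟨c, hc, hc2⟩
  · exact quadQ_norm hm hw hw2 hc hc2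
  · have h3 : ((p * n : ℚ) : L) + ((q * n : ℚ) : L) * w = (n * c) ^ 2 := by
      push_cast; rw [hθ] at hc2; linear_combination (n : L) * hc2
    have h4 := quadQ_norm hm hw hw2 ((quad ⊥ w hw2).mul_mem (ratCast_memF _ n) hc) h3
    obtain ⟨d, hd⟩ := h4
    refine ⟨d / n, ?_⟩
    field_simp
    linear_combination hd

theorem ratSq (hd : smallDeg L) {w θ : L} {m n : ℚ} (hm : ¬ IsSquare m) (hn : ¬ IsSquare n)
    (hmn : ¬ IsSquare (n * m)) (hw : w ^ 2 = m) (hθ : θ ^ 2 = n) {p : ℚ}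
    (h : IsSquare (p : L)) : IsSquare p ∨ IsSquare (p * m) ∨ IsSquare (p * n) ∨ IsSquare (p * n * m) := by
  have hw2 := sq_memQ hw
  have hθ2 : θ ^ 2 ∈ quad ⊥ w hw2 := le_quad (sq_memQ hθ)
  obtain ⟨h1, h2⟩ := two_top hd hm hn hmn hw hθ hw2 hθ2
  obtain ⟨x, hx⟩ := h
  have hm0 : m ≠ 0 := by rintro rfl; exact hm (IsSquare.zero)
  have hx' : x ∈ quad (quad ⊥ w hw2) θ hθ2 := by rw [h2]; trivial
  have hα : (p : L) ∈ quad ⊥ w hw2 := le_quad (ratCast_memF _ p)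
  rcases quad_SD hθ2 hα hx' (by rw [hx]; ring) with ⟨c, hc, hc2⟩ | ⟨c, hc, hc2⟩
  · rcases quadQ_SD hm0 hw hw2 hc hc2 with h | h
    · exact Or.inl h
    · exact Or.inr (Or.inl h)
  · have h3 : ((p * n : ℚ) : L) = (n * c) ^ 2 := by
      push_cast; rw [hθ] at hc2; linear_combination (n : L) * hc2
    rcases quadQ_SD hm0 hw hw2 ((quad ⊥ w hw2).mul_mem (ratCast_memF _ n) hc) h3 with h | h
    · exact Or.inr (Or.inr (Or.inl h))
    · exact Or.inr (Or.inr (Or.inr h))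

/-- norm to `ℚ(w)`, explicit coordinates -/
theorem NT (hd : smallDeg L) {w θ : L} {m n : ℚ} (hm : ¬ IsSquare m) (hn : ¬ IsSquare n)
    (hmn : ¬ IsSquare (n * m)) (hw : w ^ 2 = m) (hθ : θ ^ 2 = n) {p q r s : ℚ}
    (h : IsSquare ((p : L) + q * w + (r + s * w) * θ)) :
    ∃ c d : ℚ, c ^ 2 + m * d ^ 2 = p ^ 2 + m * q ^ 2 - n * (r ^ 2 + m * s ^ 2) ∧
      2 * c * d = 2 * p * q - n * (2 * r * s) := by
  have hw2 := sq_memQ hw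
  have hθ2 : θ ^ 2 ∈ quad ⊥ w hw2 := le_quad (sq_memQ hθ)
  obtain ⟨h1, h2⟩ := two_top hd hm hn hmn hw hθ hw2 hθ2
  obtain ⟨x, hx⟩ := h
  have hx' : x ∈ quad (quad ⊥ w hw2) θ hθ2 := by rw [h2]; trivial
  have hA : (p : L) + q * w ∈ quad ⊥ w hw2 := ⟨p, ratCast_memF _ p, q, ratCast_memF _ q, rfl⟩
  have hB : (r : L) + s * w ∈ quad ⊥ w hw2 := ⟨r, ratCast_memF _ r, s, ratCast_memF _ s, rfl⟩
  obtain ⟨c, hc, hc2⟩ := quad_norm hθ2 h1 hA hB hx' (by rw [hx]; ring)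
  obtain ⟨c, hcc, d, hdd, rfl⟩ := hc
  obtain ⟨c, rfl⟩ := mem_botQ.1 hcc
  obtain ⟨d, rfl⟩ := mem_botQ.1 hdd
  rw [hθ] at hc2
  have h3 : ((p ^ 2 + m * q ^ 2 - n * (r ^ 2 + m * s ^ 2) : ℚ) : L) +
      ((2 * p * q - n * (2 * r * s) : ℚ) : L) * w =
      ((c ^ 2 + m * d ^ 2 : ℚ) : L) + ((2 * c * d : ℚ) : L) * w := by
    push_cast
    linear_combination hc2 - ((q:L) ^ 2 - n * s ^ 2 - d ^ 2) * hw
  obtain ⟨e1, e2⟩ := quad_uniq (ratSqrt_notMem hm hw) (ratCast_memF _ _) (ratCast_memF _ _)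
    (ratCast_memF _ _) (ratCast_memF _ _) h3
  exact ⟨c, d, (Rat.cast_injective e1).symm, (Rat.cast_injective e2).symm⟩

/-- three independent square roots are impossible -/
theorem no_three (hd : smallDeg L) {m n r : ℚ} (hm : ¬ IsSquare m) (hn : ¬ IsSquare n)
    (hmn : ¬ IsSquare (n * m)) (hr : ¬ IsSquare r) (hrm : ¬ IsSquare (r * m))
    (hrn : ¬ IsSquare (r * n)) (hrmn : ¬ IsSquare (r * n * m))
    (h1 : IsSquare (m : L)) (h2 : IsSquare (n : L)) (h3 : IsSquare (r : L)) : False := by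
  obtain ⟨w, hw⟩ := h1
  obtain ⟨t, ht⟩ := h2
  rcases ratSq hd hm hn hmn (w := w) (θ := t) (by rw [hw]; ring) (by rw [ht]; ring) h3
    with h | h | h | h
  · exact hr h
  · exact hrm h
  · exact hrn h
  · exact hrmn h

/-- the field `ℚ(w)(θ)`, `w² = 3`, `θ² = 2w` -/
theorem exc_top (hd : smallDeg L) {w θ : L} (hw : w ^ 2 = ((3 : ℚ) : L)) (hθ : θ ^ 2 = 2 * w)
    (hw2 : w ^ 2 ∈ (⊥ : IntermediateField ℚ L)) (hθ2 : θ ^ 2 ∈ quad ⊥ w hw2) :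
    θ ∉ quad ⊥ w hw2 ∧ quad (quad ⊥ w hw2) θ hθ2 = ⊤ := by
  have hm : ¬ IsSquare (3 : ℚ) := by norm_num
  have h1 : θ ∉ quad ⊥ w hw2 := by
    intro h
    have := quadQ_norm (p := 0) (q := 2) hm hw hw2 h (by rw [hθ]; push_cast; ring)
    norm_num at this
  exact ⟨h1, tower_top hd hw2 (ratSqrt_notMem hm hw) hθ2 h1⟩

theorem exc_NL (hd : smallDeg L) {w θ : L} (hw : w ^ 2 = 3) (hθ : θ ^ 2 = 2 * w) {p q : ℚ}
    (h : IsSquare ((p : L) + q * w)) :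
    IsSquare (p ^ 2 - 3 * q ^ 2) ∨ IsSquare (-3 * (p ^ 2 - 3 * q ^ 2)) := by
  have hw : w ^ 2 = ((3 : ℚ) : L) := by rw [hw]; norm_num
  have hm : ¬ IsSquare (3 : ℚ) := by norm_num
  have hw2 := sq_memQ hw
  have hθ2 : θ ^ 2 ∈ quad ⊥ w hw2 := by
    rw [hθ]; exact ⟨0, IntermediateField.zero_mem _, 2, by simpa using ratCast_memF ⊥ 2, by simp⟩
  obtain ⟨h1, h2⟩ := exc_top hd hw hθ hw2 hθ2
  obtain ⟨x, hx⟩ := h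
  have hx' : x ∈ quad (quad ⊥ w hw2) θ hθ2 := by rw [h2]; trivial
  have hα : (p : L) + q * w ∈ quad ⊥ w hw2 := ⟨p, ratCast_memF _ p, q, ratCast_memF _ q, rfl⟩
  rcases quad_SD hθ2 hα hx' (by rw [hx]; ring) with ⟨c, hc, hc2⟩ | ⟨c, hc, hc2⟩
  · exact Or.inl (quadQ_norm hm hw hw2 hc hc2)
  · right
    have h3 : ((6 * q : ℚ) : L) + ((2 * p : ℚ) : L) * w = (θ ^ 2 * c) ^ 2 := by
      rw [hθ] at hc2 ⊢; push_cast at *; linear_combination (2 * w) * hc2 - 2 * q * hw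
    have h4 := quadQ_norm hm hw hw2 ((quad ⊥ w hw2).mul_mem hθ2 hc) h3
    obtain ⟨d, hd⟩ := h4
    refine ⟨d / 2, ?_⟩
    linear_combination hd / 4

/-- norm test for `A + Bθ` in the exceptional field -/
theorem exc_NT (hd : smallDeg L) {w θ A B : L} (hw : w ^ 2 = 3) (hθ : θ ^ 2 = 2 * w)
    (hA : ∃ p q : ℚ, A = p + q * w) (hB : ∃ p q : ℚ, B = p + q * w)
    (h : IsSquare (A + B * θ)) : ∃ p q : ℚ, A ^ 2 - 2 * w * B ^ 2 = (p + q * w) ^ 2 := by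
  have hw : w ^ 2 = ((3 : ℚ) : L) := by rw [hw]; norm_num
  have hm : ¬ IsSquare (3 : ℚ) := by norm_num
  have hw2 := sq_memQ hw
  have hθ2 : θ ^ 2 ∈ quad ⊥ w hw2 := by
    rw [hθ]; exact ⟨0, IntermediateField.zero_mem _, 2, by simpa using ratCast_memF ⊥ 2, by simp⟩
  obtain ⟨h1, h2⟩ := exc_top hd hw hθ hw2 hθ2
  obtain ⟨x, hx⟩ := h
  have hx' : x ∈ quad (quad ⊥ w hw2) θ hθ2 := by rw [h2]; trivial
  have hA' : A ∈ quad ⊥ w hw2 := by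
    obtain ⟨p, q, rfl⟩ := hA; exact ⟨p, ratCast_memF _ p, q, ratCast_memF _ q, rfl⟩
  have hB' : B ∈ quad ⊥ w hw2 := by
    obtain ⟨p, q, rfl⟩ := hB; exact ⟨p, ratCast_memF _ p, q, ratCast_memF _ q, rfl⟩
  obtain ⟨c, hc, hc2⟩ := quad_norm hθ2 h1 hA' hB' hx' (by rw [hx]; ring)
  obtain ⟨c, hcc, d, hdd, rfl⟩ := hc
  obtain ⟨c, rfl⟩ := mem_botQ.1 hcc
  obtain ⟨d, rfl⟩ := mem_botQ.1 hdd
  exact ⟨c, d, by rw [← hc2, hθ]⟩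

/-- square in `ℚ(w)`, explicit coordinates -/
theorem Q_norm {w : L} {m : ℚ} (hm : ¬ IsSquare m) (hw : w ^ 2 = m) {p q c d : ℚ}
    (h : (p : L) + q * w = (c + d * w) ^ 2) : IsSquare (p ^ 2 - m * q ^ 2) :=
  quadQ_norm hm hw (sq_memQ hw) ⟨c, ratCast_memF _ c, d, ratCast_memF _ d, rfl⟩ h

end Towers

set_option linter.unusedSectionVars false
set_option linter.unnecessarySimpa false
set_option linter.unusedVariables false

section PartC
variable {K : Type*} [Field K] [CharZero K]

def c6 (X : K) : K := X * (X + 3) * (X - 1)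
def d6 (X : K) : K := (X ^ 2 + 3) ^ 2 / (4 * c6 X)
def h6 (s : K) : Set K := {X | IsSquare (s * c6 X)}

theorem c6_zero {X : K} (h : c6 X = 0) : X = 0 ∨ X = -3 ∨ X = 1 := by
  unfold c6 at h
  rcases mul_eq_zero.1 h with h | h
  · rcases mul_eq_zero.1 h with h | h
    · exact Or.inl h
    · exact Or.inr (Or.inl (by linear_combination h))
  · exact Or.inr (Or.inr (by linear_combination h))

theorem c6_ne {X : K} (h : c6 X ≠ 0) : X ≠ 0 ∧ X + 3 ≠ 0 ∧ X - 1 ≠ 0 := by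
  unfold c6 at h
  exact ⟨left_ne_zero_of_mul (left_ne_zero_of_mul h), right_ne_zero_of_mul (left_ne_zero_of_mul h),
    right_ne_zero_of_mul h⟩

theorem halve6 {s X : K} (hs : s ^ 2 = 1) (hX : X ∈ h6 s) (h0 : c6 X ≠ 0) :
    ∃ a0 a1 a3 : K, a0 ^ 2 = s * d6 X ∧ a1 ^ 2 = s * (d6 X - 1) ∧ a3 ^ 2 = s * (d6 X + 3) ∧
      s * X = (a0 + a3) * (a0 + a1) ∧ s * (X + 3) = (a3 + a0) * (a3 + a1) ∧
      s * (X - 1) = (a1 + a0) * (a1 + a3) := by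
  obtain ⟨y, hy⟩ := hX
  have hs0 : s ≠ 0 := by rintro rfl; norm_num at hs
  have hy0 : y ≠ 0 := by
    rintro rfl
    have := mul_ne_zero hs0 h0
    simp [hy] at this
  have hc : c6 X = s * y ^ 2 := by linear_combination s * hy - c6 X * hs
  have hc' := hc
  unfold c6 at hc'
  have hd : d6 X = (X ^ 2 + 3) ^ 2 / (4 * (s * y ^ 2)) := by rw [d6, hc]
  have hss : s * s = 1 := by linear_combination hs
  refine ⟨(X ^ 2 + 3) / (2 * y), (X ^ 2 - 2 * X - 3) / (2 * y), (X ^ 2 + 6 * X - 3) / (2 * y),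
    ?_, ?_, ?_, ?_, ?_, ?_⟩
  · rw [hd]; field_simp; ring
  · rw [hd]; field_simp
    linear_combination (-16) * hc'
  · rw [hd]; field_simp
    linear_combination 48 * hc'
  · field_simp; linear_combination (-4 * X) * hc'
  · field_simp; linear_combination (-4 * (X + 3)) * hc'
  · field_simp; linear_combination (-4 * (X - 1)) * hc'

theorem d6_mem {s X : K} (hs : s ^ 2 = 1) (hX : X ∈ h6 s) (h0 : c6 X ≠ 0) : d6 X ∈ h6 s := by
  obtain ⟨a0, a1, a3, e0, e1, e3, -⟩ := halve6 hs hX h0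
  refine ⟨a0 * a1 * a3, ?_⟩
  have : (a0 * a1 * a3) * (a0 * a1 * a3) = a0 ^ 2 * a1 ^ 2 * a3 ^ 2 := by ring
  rw [this, e0, e1, e3]
  unfold c6
  linear_combination (-s * d6 X * (d6 X + 3) * (d6 X - 1)) * hs

theorem d6_eq_zero {X : K} (h0 : c6 X ≠ 0) (h : d6 X = 0) : X ^ 2 = -3 := by
  unfold d6 at h
  rw [div_eq_zero_iff] at h
  rcases h with h | h
  · have := pow_eq_zero_iff (two_ne_zero) |>.1 h
    linear_combination this
  · simp [h0] at h

theorem d6_eq_one {X : K} (h0 : c6 X ≠ 0) (h : d6 X = 1) : X = 3 ∨ X = -1 := by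
  unfold d6 at h
  rw [div_eq_one_iff_eq (by simp [h0])] at h
  have : ((X - 3) * (X + 1)) ^ 2 = 0 := by unfold c6 at h; linear_combination h
  rcases mul_eq_zero.1 (pow_eq_zero_iff (two_ne_zero) |>.1 this) with h | h
  · left; linear_combination h
  · right; linear_combination h

theorem d6_eq_neg_three {X : K} (h0 : c6 X ≠ 0) (h : d6 X = -3) : (X + 3) ^ 2 = 12 := by
  unfold d6 at h
  rw [div_eq_iff (by simp [h0])] at h
  have : ((X + 3) ^ 2 - 12) ^ 2 = 0 := by unfold c6 at h; linear_combination h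
  linear_combination pow_eq_zero_iff (two_ne_zero) |>.1 this

/-- isogeny to `E₁` -/
def g6 (X : K) : K := (X + 3) * (X - 1) / (4 * X)

theorem g6_q {X : K} (hX : X ≠ 0) : g6 X ^ 2 - g6 X + 1 = ((X ^ 2 + 3) / (4 * X)) ^ 2 := by
  unfold g6; field_simp; ring

theorem g6_mem {s X : K} (hX : X ∈ h6 s) (h0 : X ≠ 0) : g6 X ∈ fE s := by
  obtain ⟨y, hy⟩ := hX
  refine ⟨(X ^ 2 + 3) / (4 * X) * (y / (2 * X)), ?_⟩
  unfold qE
  rw [g6_q h0]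
  unfold g6 
  unfold c6 at hy
  field_simp
  linear_combination (4 * (X ^ 2 + 3) ^ 2) * hy

theorem g6_comm {X : K} (h0 : c6 X ≠ 0) (h1 : X ^ 2 + 3 ≠ 0) : dE (g6 X) = g6 (d6 X) := by
  obtain ⟨a, b, c⟩ := c6_ne h0
  have hd : d6 X ≠ 0 := by unfold d6; exact div_ne_zero (pow_ne_zero 2 h1) (by simp [h0])
  have hq : qE (g6 X) ≠ 0 := by
    unfold qE; rw [g6_q a]
    refine mul_ne_zero ?_ (pow_ne_zero 2 (div_ne_zero h1 (by simp [a])))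
    unfold g6; exact div_ne_zero (mul_ne_zero b c) (by simp [a])
  have hq2 : qE (g6 X) = (X + 3) * (X - 1) / (4 * X) * ((X ^ 2 + 3) / (4 * X)) ^ 2 := by
    unfold qE; rw [g6_q a]; rfl
  unfold dE
  rw [hq2]
  unfold g6 d6 c6
  field_simp
  ring

theorem ind6 {s : K} (o : OrdFn K) (hs : s = 1 ∨ s = -1) (hfin : (fE s).Finite) (P : K → Prop)
    (hP0 : ∀ X, c6 X = 0 → P X)
    (hP : ∀ X, X ∈ h6 s → c6 X ≠ 0 → P (d6 X) → P X) : ∀ X ∈ h6 s, P X := by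
  have hs2 : s ^ 2 = 1 := by rcases hs with rfl | rfl <;> norm_num
  have key : ∀ X ∈ h6 s, (c6 X ≠ 0) → X ^ 2 + 3 ≠ 0 → qE (g6 X) ≠ 0 := by
    intro X hX h0 h1
    obtain ⟨a, b, c⟩ := c6_ne h0
    unfold qE; rw [g6_q a]
    refine mul_ne_zero ?_ (pow_ne_zero 2 (div_ne_zero h1 (by simp [a])))
    unfold g6; exact div_ne_zero (mul_ne_zero b c) (by simp [a])
  have hz : ∀ X ∈ h6 s, X ^ 2 + 3 = 0 → P X := by
    intro X hX h
    by_cases h0 : c6 X = 0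
    · exact hP0 X h0
    · refine hP X hX h0 (hP0 _ ?_)
      have : d6 X = 0 := by unfold d6; rw [h]; simp
      rw [this]; simp [c6]
  intro X hX
  by_cases a0 : c6 X = 0
  · exact hP0 X a0
  by_cases b0 : X ^ 2 + 3 = 0
  · exact hz X hX b0
  refine hP X hX a0 ?_
  have hX1 := d6_mem hs2 hX a0
  by_cases a1 : c6 (d6 X) = 0
  · exact hP0 _ a1
  by_cases b1 : (d6 X) ^ 2 + 3 = 0
  · exact hz _ hX1 b1
  refine hP _ hX1 a1 ?_
  have hX2 := d6_mem hs2 hX1 a1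
  by_cases a2 : c6 (d6 (d6 X)) = 0
  · exact hP0 _ a2
  by_cases b2 : (d6 (d6 X)) ^ 2 + 3 = 0
  · exact hz _ hX2 b2
  exfalso
  refine lemmaN o hs hfin (g6_mem hX (c6_ne a0).1) (key X hX a0 b0) ?_ ?_
  · rw [g6_comm a0 b0]; exact key _ hX1 a1 b1
  · rw [g6_comm a0 b0, g6_comm a1 b1]; exact key _ hX2 a2 b2

end PartC

section PartE
variable {K : Type*} [Field K] [NumberField K]

theorem isSq_neg_one_of {a b : K} (h : a ^ 2 = -b ^ 2) (hb : b ≠ 0) : IsSquare (-1 : K) :=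
  ⟨a / b, by field_simp; linear_combination -h⟩

theorem inQ_sq {y : K} {q : ℚ} (h : inQ y) (h2 : y ^ 2 = q) : IsSquare q := by
  obtain ⟨c, rfl⟩ := h
  exact rat_isSquare_of (L := K) h2.symm

theorem condA_nsq (h : condA K) : ¬ IsSquare (-1 : K) ∧ ¬ IsSquare (3 : K) ∧ ¬ IsSquare (-3 : K) := by
  refine ⟨?_, ?_, ?_⟩
  · rintro ⟨i, hi⟩
    have := (h.1 i 1 (by linear_combination (i - 1) * hi)).1
    have := inQ_sq (q := -1) this (by push_cast; linear_combination -hi)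
    norm_num at this
  · rintro ⟨i, hi⟩
    have := (h.2.1 1 i (by linear_combination -hi)).2
    have := inQ_sq (q := 3) this (by push_cast; linear_combination -hi)
    norm_num at this
  · rintro ⟨i, hi⟩
    have := (h.1 (-1) i (by linear_combination -hi)).2
    have := inQ_sq (q := -3) this (by push_cast; linear_combination -hi)
    norm_num at this

theorem c6_cast (q : ℚ) : c6 (q : K) = ((c6 q : ℚ) : K) := by unfold c6; push_cast; ring

theorem c6_castz {q : ℚ} (h : c6 q = 0) : c6 (q : K) = 0 := by rw [c6_cast, h]; simp

theorem condA_E6 (h : condA K) {X : K} (hX : X ∈ h6 (1 : K)) : c6 X = 0 ∨ X = 3 ∨ X = -1 := by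
  obtain ⟨y, hy⟩ := hX
  obtain ⟨⟨x, hx⟩, ⟨t, rfl⟩⟩ := h.2.2.2.1 (X + 1) y (by unfold c6 at hy; linear_combination -hy)
  obtain rfl : X = ((x - 1 : ℚ) : K) := by push_cast; linear_combination -hx
  generalize x - 1 = X at *
  have hmem : X ∈ h6 (1 : ℚ) := by
    refine ⟨t, ?_⟩
    rw [c6_cast] at hy
    exact_mod_cast hy
  by_cases h0 : c6 X = 0
  · exact Or.inl (c6_castz h0)
  obtain ⟨a0, a1, a3, e0, e1, e3, -⟩ := halve6 (by norm_num) hmem h0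
  have h1 : a1 = 0 := sys1Q (y := a0) (z := a3) (by linear_combination e1 - e0) (by linear_combination e1 - e3)
  have hd : d6 X = 1 := by rw [h1] at e1; linear_combination -e1
  right
  rcases d6_eq_one h0 hd with rfl | rfl
  · left; norm_num
  · right; norm_num

theorem condA_E6' (h : condA K) {X : K} (hX : X ∈ h6 (-1 : K)) : c6 X = 0 := by
  obtain ⟨y, hy⟩ := hX
  obtain ⟨⟨x, hx⟩, ⟨t, rfl⟩⟩ := h.2.2.2.2 (-X - 1) y (by unfold c6 at hy; linear_combination -hy)
  obtain rfl : X = ((-x - 1 : ℚ) : K) := by push_cast; linear_combination hx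
  generalize -x - 1 = X at *
  have hmem : X ∈ h6 (-1 : ℚ) := by
    refine ⟨t, ?_⟩
    rw [c6_cast] at hy
    exact_mod_cast hy
  by_cases h0 : c6 X = 0
  · exact c6_castz h0
  obtain ⟨a0, a1, a3, e0, e1, e3, -⟩ := halve6 (by norm_num) hmem h0
  exact (sys2Q (x := a1) (y := a0) (z := a3) (by linear_combination e1 - e0) (by linear_combination e1 - e3)).elim

theorem sq_of_eq {a b : K} (h : a ^ 2 = b) : IsSquare b := ⟨a, by rw [← h]; ring⟩

theorem condB_small (h : condB K) : smallDeg K := h.2.2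

theorem condB_no6 (h : condB K) : ¬ IsSquare (6 : K) := by
  obtain ⟨o⟩ := exists_ordFn K h.2.2
  rintro ⟨a, ha⟩
  refine no_rat_pt o (s := 1) (by norm_num) (fE_one_finite h.1) (X := 3 / 8) (a := 3) (b := 8)
    ⟨7 * a / 32, ?_⟩ ?_ (by norm_num) OrdFn.E_eight (by have := o.two_pos; omega)
  · unfold qE; linear_combination (49 / 1024 : K) * ha
  · exact OrdFn.E_of_odd ⟨1, OrdFn.E_one.G le_rfl, by norm_num⟩

theorem condB_no5 (h : condB K) : ¬ IsSquare (5 : K) ∧ ¬ IsSquare (-5 : K) := by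
  obtain ⟨o⟩ := exists_ordFn K h.2.2
  have h16 : o.E (4 * o.ord 2) (16 : K) := by
    have := (OrdFn.E_four (o := o)).mul OrdFn.E_four
    convert this using 1
    · ring
    · norm_num
  have h5 : o.E 0 (-5 : K) := OrdFn.E_of_odd ⟨-3, by
    have : o.E 0 (3 : K) := OrdFn.E_of_odd ⟨1, OrdFn.E_one.G le_rfl, by norm_num⟩
    exact this.neg.G le_rfl, by norm_num⟩
  constructor
  · rintro ⟨a, ha⟩
    refine no_rat_pt o (s := -1) (by norm_num) (fE_neg_one_finite h.2.1) (X := -5 / 16) (a := -5) (b := 16)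
      ⟨19 * a / 64, ?_⟩ h5 (by norm_num) h16 (by have := o.two_pos; omega)
    unfold qE; linear_combination (19 ^ 2 / 64 ^ 2 : K) * ha
  · rintro ⟨a, ha⟩
    refine no_rat_pt o (s := 1) (by norm_num) (fE_one_finite h.1) (X := -5 / 16) (a := -5) (b := 16)
      ⟨19 * a / 64, ?_⟩ h5 (by norm_num) h16 (by have := o.two_pos; omega)
    unfold qE; linear_combination (19 ^ 2 / 64 ^ 2 : K) * ha

/-- `3 = (√3)²` type helper: from squares of `-1` and `a` get `-a`. -/
theorem sq_neg {a : K} (h1 : IsSquare (-1 : K)) (h : IsSquare a) : IsSquare (-a) := by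
  have := h1.mul h
  rwa [neg_one_mul] at this

theorem sq_div {a b : K} (h1 : IsSquare (a * b)) (h : IsSquare b) (hb : b ≠ 0) : IsSquare a := by
  have := h1.div h
  rwa [mul_div_cancel_right₀ _ hb] at this

theorem caseI (h : condB K) (h1 : ¬ (IsSquare (-1 : K) ∧ IsSquare (3 : K)))
    (h2 : ¬ (IsSquare (-1 : K) ∧ IsSquare (2 : K))) :
    ∀ X ∈ h6 (1 : K), c6 X = 0 ∨ X = 3 ∨ X = -1 := by
  obtain ⟨o⟩ := exists_ordFn K h.2.2
  refine ind6 o (Or.inl rfl) (fE_one_finite h.1) _ (fun X h => Or.inl h) ?_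
  intro X hX h0 hB
  obtain ⟨a0, a1, a3, e0, e1, e3, -⟩ := halve6 (by norm_num) hX h0
  rcases hB with hB | hB | hB
  · rcases c6_zero hB with hB | hB | hB
    · rw [hB] at e0 e1 e3
      exact (h1 ⟨sq_of_eq (a := a1) (by rw [e1]; ring), sq_of_eq (a := a3) (by rw [e3]; ring)⟩).elim
    · rw [hB] at e0 e1 e3
      refine (h1 ⟨sq_of_eq (a := a1 / 2) (by linear_combination e1 / 4), ?_⟩).elim
      have hi : IsSquare (-1 : K) := sq_of_eq (a := a1 / 2) (by linear_combination e1 / 4)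
      have := sq_neg hi (sq_of_eq (a := a0) e0)
      convert this using 1; ring
    · exact Or.inr (d6_eq_one h0 hB)
  · rw [hB] at e0 e1 e3
    refine (condB_no6 h ?_).elim
    exact sq_of_eq (a := a3) (by rw [e3]; norm_num)
  · rw [hB] at e0 e1 e3
    exact (h2 ⟨sq_of_eq (a := a0) (by rw [e0]; ring), sq_of_eq (a := a3) (by rw [e3]; ring)⟩).elim

/-- rational squares in `ℚ(i,√3)` -/
theorem ratSq3 (hd : smallDeg K) (h1 : IsSquare (-1 : K)) (h3 : IsSquare (3 : K)) {p : ℚ}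
    (h : IsSquare (p : K)) : IsSquare p ∨ IsSquare (p * 3) ∨ IsSquare (p * (-1)) ∨ IsSquare (p * (-1) * 3) := by
  obtain ⟨i, hi⟩ := h1
  obtain ⟨w, hw⟩ := h3
  exact ratSq hd (w := w) (θ := i) (m := 3) (n := -1) (by norm_num) (by norm_num) (by norm_num)
    (by push_cast; rw [hw]; ring) (by push_cast; rw [hi]; ring) h

theorem ratSq2 (hd : smallDeg K) (h1 : IsSquare (-1 : K)) (h3 : IsSquare (2 : K)) {p : ℚ}
    (h : IsSquare (p : K)) : IsSquare p ∨ IsSquare (p * 2) ∨ IsSquare (p * (-1)) ∨ IsSquare (p * (-1) * 2) := by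
  obtain ⟨i, hi⟩ := h1
  obtain ⟨w, hw⟩ := h3
  exact ratSq hd (w := w) (θ := i) (m := 2) (n := -1) (by norm_num) (by norm_num) (by norm_num)
    (by push_cast; rw [hw]; ring) (by push_cast; rw [hi]; ring) h

/-- `NL` with `θ = i` -/
theorem NLi (hd : smallDeg K) (h1 : IsSquare (-1 : K)) {w : K} {m : ℚ} (hm : ¬ IsSquare m)
    (hm' : ¬ IsSquare ((-1) * m)) (hw : w ^ 2 = m) (p q : ℚ) {α : K} (hα : α = p + q * w)
    (h : IsSquare α) : IsSquare (p ^ 2 - m * q ^ 2) := by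
  obtain ⟨i, hi⟩ := h1
  rw [hα] at h
  exact NL hd (n := -1) (θ := i) hm (by norm_num) hm' hw (by push_cast; rw [hi]; ring) h

theorem caseII (h : condB K) (h1 : IsSquare (-1 : K)) (h3 : IsSquare (3 : K)) :
    ∀ X ∈ h6 (1 : K), c6 X = 0 ∨ (c6 X ≠ 0 ∧ c6 (d6 X) = 0) := by
  obtain ⟨o⟩ := exists_ordFn K h.2.2
  have hd := condB_small h
  have n2 : ¬ IsSquare (2 : K) := by
    intro h2
    have := ratSq3 hd h1 h3 (p := 2) (by simpa using h2)
    norm_num at this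
  refine ind6 o (Or.inl rfl) (fE_one_finite h.1) _ (fun X h => Or.inl h) ?_
  intro X hX h0 hB
  right
  refine ⟨h0, ?_⟩
  obtain ⟨a0, a1, a3, e0, e1, e3, -⟩ := halve6 (by norm_num) hX h0
  generalize d6 X = B at *
  rcases hB with hB | ⟨hB0, hB⟩
  · exact hB
  exfalso
  rcases c6_zero hB with hB | hB | hB
  · have := d6_eq_zero hB0 hB
    have := NLi hd h1 (w := B) (m := -3) (by norm_num) (by norm_num) (by push_cast; exact this) 0 1
      (α := B) (by push_cast; ring) (sq_of_eq (a := a0) (by rw [e0]; ring))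
    norm_num at this
  · have := d6_eq_neg_three hB0 hB
    have := NLi hd h1 (w := (B + 3) / 2) (m := 3) (by norm_num) (by norm_num)
      (by push_cast; linear_combination this / 4) (-3) 2
      (α := B) (by push_cast; ring) (sq_of_eq (a := a0) (by rw [e0]; ring))
    norm_num at this
  · rcases d6_eq_one hB0 hB with hB | hB
    · rw [hB] at e1
      exact n2 (sq_of_eq (a := a1) (by rw [e1]; ring))
    · rw [hB] at e3
      exact n2 (sq_of_eq (a := a3) (by rw [e3]; ring))

theorem not_pm_sq {c d C : ℚ} (h1 : ¬ IsSquare C) (h2 : ¬ IsSquare (-C))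
    (e1 : c ^ 2 + (-1) * d ^ 2 = C) (e2 : 2 * c * d = 0) : False := by
  have : c * d = 0 := by linear_combination e2 / 2
  rcases mul_eq_zero.1 this with h | h
  · exact h2 ⟨d, by rw [h] at e1; linear_combination e1⟩
  · exact h1 ⟨c, by rw [h] at e1; linear_combination -e1⟩

theorem not_i_sq {c d C : ℚ} (h1 : ¬ IsSquare (C / 2)) (h2 : ¬ IsSquare (-(C / 2)))
    (e1 : c ^ 2 + (-1) * d ^ 2 = 0) (e2 : 2 * c * d = C) : False := by
  have : (c - d) * (c + d) = 0 := by linear_combination e1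
  rcases mul_eq_zero.1 this with h | h
  · exact h1 ⟨d, by rw [sub_eq_zero.1 h] at e2; linear_combination -e2 / 2⟩
  · exact h2 ⟨d, by rw [eq_neg_of_add_eq_zero_left h] at e2; linear_combination e2 / 2⟩

theorem caseIII (h : condB K) (h1 : IsSquare (-1 : K)) (h2 : IsSquare (2 : K)) :
    ∀ X ∈ h6 (1 : K), c6 X = 0 ∨ X = 3 ∨ X = -1 ∨ (c6 X ≠ 0 ∧ d6 X = -1) := by
  obtain ⟨o⟩ := exists_ordFn K h.2.2
  have hd := condB_small h
  have n3 : ¬ IsSquare (3 : K) := by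
    intro h3
    have := ratSq2 hd h1 h2 (p := 3) (by simpa using h3)
    norm_num at this
  have n3' : ¬ IsSquare (-3 : K) := by
    intro h3
    exact n3 (by simpa using sq_neg h1 h3)
  refine ind6 o (Or.inl rfl) (fE_one_finite h.1) _ (fun X h => Or.inl h) ?_
  intro X hX h0 hB
  obtain ⟨a0, a1, a3, e0, e1, e3, -⟩ := halve6 (by norm_num) hX h0
  have hX' := d6_mem (by norm_num) hX h0
  rcases hB with hB | hB | hB | ⟨hB0, hB⟩
  · rcases c6_zero hB with hB | hB | hB
    · rw [hB] at e3
      exact (n3 (sq_of_eq (a := a3) (by rw [e3]; ring))).elim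
    · rw [hB] at e0
      exact (n3' (sq_of_eq (a := a0) (by rw [e0]; ring))).elim
    · rcases d6_eq_one h0 hB with h | h
      · exact Or.inr (Or.inl h)
      · exact Or.inr (Or.inr (Or.inl h))
  · rw [hB] at e0
    exact (n3 (sq_of_eq (a := a0) (by rw [e0]; ring))).elim
  · exact Or.inr (Or.inr (Or.inr ⟨h0, hB⟩))
  · exfalso
    obtain ⟨b0, b1, b3, f0, f1, f3, f4, -⟩ := halve6 (by norm_num) hX' hB0
    rw [hB] at f0 f1 f3
    have f1' : (b1 - b0 * b3) * (b1 + b0 * b3) = 0 := by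
      linear_combination f1 - b3 ^ 2 * f0 + f3
    have f0' : b0 ^ 2 = ((-1 : ℚ) : K) := by push_cast; linear_combination f0
    have f3' : b3 ^ 2 = ((2 : ℚ) : K) := by push_cast; linear_combination f3
    have hsq : IsSquare ((b0 + b3) * (b0 + b1)) := by
      rw [← f4]; exact sq_of_eq (a := a0) e0
    rcases mul_eq_zero.1 f1' with hb | hb
    · have hb' : b1 = b0 * b3 := by linear_combination hb
      have : (b0 + b3) * (b0 + b1) = ((-1 : ℚ) : K) + ((2 : ℚ) : K) * b0 + (((-1 : ℚ) : K) + ((1 : ℚ) : K) * b0) * b3 := by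
        rw [hb']; push_cast; linear_combination (1 + b3) * f0 + b0 * f3
      rw [this] at hsq
      obtain ⟨c, d, hc, hcd⟩ := NT hd (by norm_num) (by norm_num) (by norm_num) f0' f3' hsq
      exact not_pm_sq (C := -3) (by norm_num) (by norm_num) (by rw [hc]; norm_num) (by rw [hcd]; norm_num)
    · have hb' : b1 = -(b0 * b3) := by linear_combination hb
      have : (b0 + b3) * (b0 + b1) = ((-1 : ℚ) : K) + ((-2 : ℚ) : K) * b0 + (((1 : ℚ) : K) + ((1 : ℚ) : K) * b0) * b3 := by
        rw [hb']; push_cast; linear_combination (1 - b3) * f0 - b0 * f3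
      rw [this] at hsq
      obtain ⟨c, d, hc, hcd⟩ := NT hd (by norm_num) (by norm_num) (by norm_num) f0' f3' hsq
      exact not_pm_sq (C := -3) (by norm_num) (by norm_num) (by rw [hc]; norm_num) (by rw [hcd]; norm_num)

/-- window link -/
theorem window_link {u y : K} (h : (u ^ 2 - 1) * (u ^ 2 - 9) = y ^ 2) :
    ∃ X ∈ h6 (1 : K), X ≠ 1 ∧ u ^ 2 * (X - 1) = X * (X + 3) := by
  have e1 : u ^ 2 * ((y + u ^ 2 - 3) / 2 - 1) = (y + u ^ 2 - 3) / 2 * ((y + u ^ 2 - 3) / 2 + 3) := by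
    linear_combination h / 4
  refine ⟨(y + u ^ 2 - 3) / 2, ⟨u * ((y + u ^ 2 - 3) / 2 - 1), ?_⟩, ?_, e1⟩
  · unfold c6
    linear_combination (-((y + u ^ 2 - 3) / 2 - 1)) * e1
  · intro h1
    rw [h1] at e1
    norm_num at e1

theorem window_Q5 {u X : K} (hX : c6 X = 0 ∨ X = 3 ∨ X = -1) (h1 : X ≠ 1)
    (h : u ^ 2 * (X - 1) = X * (X + 3)) : u = 0 ∨ u ^ 2 = 1 ∨ u ^ 2 = 9 := by
  rcases hX with hX | rfl | rfl
  · rcases c6_zero hX with rfl | rfl | rfl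
    · left; simpa using h
    · left; norm_num at h; exact h
    · exact (h1 rfl).elim
  · right; right; linear_combination h / 2
  · right; left; linear_combination -h / 2

/-- the trichotomy for windows -/
theorem trichotomy (h : condA K ∨ condB K) :
    (¬ (IsSquare (-1 : K) ∧ IsSquare (3 : K)) ∧ ¬ (IsSquare (-1 : K) ∧ IsSquare (2 : K)) ∧
      ¬ (IsSquare (2 : K) ∧ IsSquare (3 : K)) ∧
      ∀ u : K, IsSquare ((u ^ 2 - 1) * (u ^ 2 - 9)) → u = 0 ∨ u ^ 2 = 1 ∨ u ^ 2 = 9) ∨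
    (condB K ∧ IsSquare (-1 : K) ∧ IsSquare (3 : K) ∧
      ∀ u : K, IsSquare ((u ^ 2 - 1) * (u ^ 2 - 9)) → (u = 0 ∨ u ^ 2 = 1 ∨ u ^ 2 = 9) ∨
        u ^ 2 = 3 ∨ u ^ 2 = -3) ∨
    (condB K ∧ IsSquare (-1 : K) ∧ IsSquare (2 : K) ∧
      ∀ u : K, IsSquare ((u ^ 2 - 1) * (u ^ 2 - 9)) → (u = 0 ∨ u ^ 2 = 1 ∨ u ^ 2 = 9) ∨
        ∃ i t : K, i ^ 2 = -1 ∧ t ^ 2 = 2 ∧ u = i + t) := by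
  rcases h with h | h
  · left
    obtain ⟨n1, n3, -⟩ := condA_nsq h
    refine ⟨fun h => n1 h.1, fun h => n1 h.1, fun h => n3 h.2, ?_⟩
    rintro u ⟨y, hy⟩
    obtain ⟨X, hX, hX1, he⟩ := window_link (u := u) (y := y) (by rw [hy]; ring)
    exact window_Q5 (condA_E6 h hX) hX1 he
  · by_cases h1 : IsSquare (-1 : K) ∧ IsSquare (3 : K)
    · right; left
      refine ⟨h, h1.1, h1.2, ?_⟩
      rintro u ⟨y, hy⟩
      obtain ⟨X, hX, hX1, he⟩ := window_link (u := u) (y := y) (by rw [hy]; ring)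
      rcases caseII h h1.1 h1.2 X hX with hc | ⟨hc0, hc⟩
      · exact Or.inl (window_Q5 (Or.inl hc) hX1 he)
      · rcases c6_zero hc with hc | hc | hc
        · right; left
          have h2 := d6_eq_zero hc0 hc
          have : X - 1 ≠ 0 := sub_ne_zero.2 hX1
          apply mul_right_cancel₀ this
          linear_combination he + h2
        · right; right
          have h2 := d6_eq_neg_three hc0 hc
          have : X - 1 ≠ 0 := sub_ne_zero.2 hX1
          apply mul_right_cancel₀ this
          linear_combination he + h2
        · exact Or.inl (window_Q5 (Or.inr (d6_eq_one hc0 hc)) hX1 he)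
    · by_cases h2 : IsSquare (-1 : K) ∧ IsSquare (2 : K)
      · right; right
        refine ⟨h, h2.1, h2.2, ?_⟩
        rintro u ⟨y, hy⟩
        obtain ⟨X, hX, hX1, he⟩ := window_link (u := u) (y := y) (by rw [hy]; ring)
        rcases caseIII h h2.1 h2.2 X hX with hc | hc | hc | ⟨hc0, hc⟩
        · exact Or.inl (window_Q5 (Or.inl hc) hX1 he)
        · exact Or.inl (window_Q5 (Or.inr (Or.inl hc)) hX1 he)
        · exact Or.inl (window_Q5 (Or.inr (Or.inr hc)) hX1 he)
        · right
          obtain ⟨a0, a1, a3, e0, e1, e3, e4, e5, e6⟩ := halve6 (by norm_num) hX hc0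
          rw [hc] at e0 e1 e3
          have hXm : X - 1 ≠ 0 := sub_ne_zero.2 hX1
          have : u ^ 2 = (a0 + a3) ^ 2 := by
            apply mul_right_cancel₀ hXm
            rw [he]
            have e4' : X = (a0 + a3) * (a0 + a1) := by linear_combination e4
            have e5' : X + 3 = (a3 + a0) * (a3 + a1) := by linear_combination e5
            have e6' : X - 1 = (a1 + a0) * (a1 + a3) := by linear_combination e6
            rw [e6', e5', e4']
            ring
          rcases sq_eq_sq_iff_eq_or_eq_neg.1 this with h | h
          · exact ⟨a0, a3, by rw [e0]; ring, by rw [e3]; ring, h⟩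
          · exact ⟨-a0, -a3, by rw [neg_sq, e0]; ring, by rw [neg_sq, e3]; ring, by rw [h]; ring⟩
      · left
        refine ⟨h1, h2, fun hh => condB_no6 h ?_, ?_⟩
        · have := hh.1.mul hh.2
          rwa [show (2 : K) * 3 = 6 by norm_num] at this
        rintro u ⟨y, hy⟩
        obtain ⟨X, hX, hX1, he⟩ := window_link (u := u) (y := y) (by rw [hy]; ring)
        exact window_Q5 (caseI h h1 h2 X hX) hX1 he

end PartE

section PartF1
variable {K : Type*} [Field K] [NumberField K]

/-- exceptional outcomes of the second descent -/
def excP (X : K) : Prop :=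
  c6 X = 0 ∨ (IsSquare (-X) → IsSquare (-(X + 3)) → IsSquare (-(X - 1)) →
    (X = -1 ∧ IsSquare (-1 : K) ∧ IsSquare (2 : K)) ∨
    ∃ w θ : K, w ^ 2 = 3 ∧ θ ^ 2 = 2 * w ∧ X = -3 - 2 * w)

theorem excP_all (h : condB K) : ∀ X ∈ h6 (-1 : K), excP X := by
  obtain ⟨o⟩ := exists_ordFn K h.2.2
  have hd := condB_small h
  refine ind6 o (Or.inr rfl) (fE_neg_one_finite h.2.1) _ (fun X h => Or.inl h) ?_
  intro X hX h0 hB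
  right
  intro q0 q3 q1
  obtain ⟨a0, a1, a3, e0, e1, e3, f0, f3, f1⟩ := halve6 (by norm_num) hX h0
  have g0 : IsSquare (-d6 X) := sq_of_eq (a := a0) (by rw [e0]; ring)
  have g3 : IsSquare (-(d6 X + 3)) := sq_of_eq (a := a3) (by rw [e3]; ring)
  have g1 : IsSquare (-(d6 X - 1)) := sq_of_eq (a := a1) (by rw [e1]; ring)
  rcases hB with hB | hB
  · rcases c6_zero hB with hB | hB | hB
    · exfalso
      have hX2 := d6_eq_zero h0 hB
      obtain ⟨r, hr⟩ := q1
      have hX1 : 1 + X ≠ 0 := by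
        intro hh
        have : X = -1 := by linear_combination hh
        rw [this] at hX2
        norm_num at hX2
      have hθ : (2 * r / (1 + X)) ^ 2 = ((-2 : ℚ) : K) := by
        push_cast
        rw [div_pow, div_eq_iff (pow_ne_zero 2 hX1)]
        linear_combination (-4) * hr + 2 * hX2
      have hh : IsSquare (((0 : ℚ) : K) + ((-1 : ℚ) : K) * X) := by
        convert q0 using 1; push_cast; ring
      have := NL hd (m := -3) (n := -2) (by norm_num) (by norm_num) (by norm_num)
        (by push_cast; exact hX2) hθ hh
      norm_num at this
    · right
      have := d6_eq_neg_three h0 hB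
      obtain ⟨r, hr⟩ := q3
      exact ⟨-(X + 3) / 2, r, by linear_combination this / 4, by linear_combination -hr, by ring⟩
    · rcases d6_eq_one h0 hB with hB | hB
      · exfalso
        rw [hB] at q0 q3 q1
        refine no_three hd (m := -3) (n := -2) (r := -6) (by norm_num) (by norm_num) (by norm_num)
          (by norm_num) (by norm_num) (by norm_num) (by norm_num) ?_ ?_ ?_
        · convert q0 using 1; norm_num
        · convert q1 using 1; norm_num
        · convert q3 using 1; norm_num
      · left
        rw [hB] at q0 q3 q1
        have h2 : IsSquare (2 : K) := by convert q1 using 1; norm_num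
        refine ⟨hB, sq_div (b := 2) ?_ h2 (by norm_num), h2⟩
        convert q3 using 1; norm_num
  · exfalso
    rcases hB g0 g3 g1 with ⟨hB, -, -⟩ | ⟨w, θ', hw, -, hB⟩
    · rw [hB] at e0 e1 e3
      have a1n : a1 ≠ 0 := by rintro rfl; norm_num at e1
      have e1' : a1 ^ 2 = ((2 : ℚ) : K) := by push_cast; linear_combination e1
      have hi : (a3 / a1) ^ 2 = ((-1 : ℚ) : K) := by
        push_cast
        rw [div_pow, e3, e1]; norm_num
      have h3 : a3 = a3 / a1 * a1 := by field_simp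
      have h01 : (a0 - 1) * (a0 + 1) = 0 := by linear_combination e0
      generalize a3 / a1 = i at hi h3
      rcases mul_eq_zero.1 h01 with hh | hh
      · have hs : IsSquare (((2 : ℚ) : K) + ((2 : ℚ) : K) * i + (((1 : ℚ) : K) + ((1 : ℚ) : K) * i) * a1) := by
          convert q1 using 1
          push_cast
          rw [sub_eq_zero.1 hh, h3] at f1
          linear_combination -f1 - (1 + i) * e1
        obtain ⟨c, d, hc, hcd⟩ := NT hd (by norm_num) (by norm_num) (by norm_num) hi e1' hs
        exact not_i_sq (C := 4) (by norm_num) (by norm_num) (by rw [hc]; norm_num) (by rw [hcd]; norm_num)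
      · have hs : IsSquare (((2 : ℚ) : K) + ((2 : ℚ) : K) * i + (((-1 : ℚ) : K) + ((-1 : ℚ) : K) * i) * a1) := by
          convert q1 using 1
          push_cast
          rw [eq_neg_of_add_eq_zero_left hh, h3] at f1
          linear_combination -f1 - (1 + i) * e1
        obtain ⟨c, d, hc, hcd⟩ := NT hd (by norm_num) (by norm_num) (by norm_num) hi e1' hs
        exact not_i_sq (C := 4) (by norm_num) (by norm_num) (by rw [hc]; norm_num) (by rw [hcd]; norm_num)
    · rw [hB] at e0 e1 e3
      have hθ : a3 ^ 2 = 2 * w := by rw [e3]; ring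
      have h1 : (a1 - (1 + w)) * (a1 + (1 + w)) = 0 := by linear_combination e1 - hw
      have h0 : (a0 - (1 + w) * a3 / 2) * (a0 + (1 + w) * a3 / 2) = 0 := by
        linear_combination e0 - (1 + w) ^ 2 / 4 * hθ - (1 + w / 2) * hw
      have hw' : w ^ 2 = ((3 : ℚ) : K) := by push_cast; exact hw
      have key : ∀ δ : ℚ, δ ^ 2 = 1 → a1 = δ * (1 + w) → False := by
        intro δ hδ h1
        rcases mul_eq_zero.1 h0 with h0 | h0
        · have hA : -X = ((6 : ℚ) + (3 : ℚ) * w) + ((3 * δ : ℚ) + (2 * δ : ℚ) * w) * a3 := by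
            have h0' : a0 = (1 + w) * a3 / 2 := by linear_combination h0
            rw [h0', h1] at f0
            push_cast
            linear_combination f0 + (w ^ 2 / 4 + w + 3 / 4) * hθ + ((w + 4) / 2 + δ * a3 / 2) * hw
          rw [hA] at q0
          obtain ⟨p, q, hpq⟩ := exc_NT hd hw hθ ⟨_, _, rfl⟩ ⟨_, _, rfl⟩ q0
          have := Q_norm (p := -9) (q := -6) (by norm_num) hw' (c := p) (d := q) (by
            have hδ' : (δ : K) ^ 2 = 1 := by exact_mod_cast hδ
            rw [← hpq]; push_cast
            linear_combination (2 * w * (3 + 2 * w) ^ 2) * hδ' + (15 + 8 * w) * hw)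
          norm_num at this
        · have hA : -X = ((0 : ℚ) + (1 : ℚ) * w) + ((-δ : ℚ) + (0 : ℚ) * w) * a3 := by
            have h0' : a0 = -((1 + w) * a3 / 2) := by linear_combination h0
            rw [h0', h1] at f0
            push_cast
            linear_combination f0 + (w ^ 2 / 4 - 1 / 4) * hθ + (w / 2 - δ * a3 / 2) * hw
          rw [hA] at q0
          obtain ⟨p, q, hpq⟩ := exc_NT hd hw hθ ⟨_, _, rfl⟩ ⟨_, _, rfl⟩ q0
          have := Q_norm (p := 3) (q := -2) (by norm_num) hw' (c := p) (d := q) (by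
            have hδ' : (δ : K) ^ 2 = 1 := by exact_mod_cast hδ
            rw [← hpq]; push_cast
            linear_combination (2 * w) * hδ' - hw)
          norm_num at this
      rcases mul_eq_zero.1 h1 with h1 | h1
      · exact key 1 (by norm_num) (by push_cast; linear_combination h1)
      · exact key (-1) (by norm_num) (by push_cast; linear_combination h1)

theorem lemmaM (h : condA K ∨ condB K) {z : K} (h1 : IsSquare (z ^ 2 - 1)) (h4 : IsSquare (z ^ 2 - 4)) :
    (z = 0 ∨ z ^ 2 = 1 ∨ z ^ 2 = 4) ∨ (condB K ∧ ((z ^ 2 = 2 ∧ IsSquare (-1 : K) ∧ IsSquare (2 : K)) ∨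
      ∃ w θ : K, w ^ 2 = 3 ∧ θ ^ 2 = 2 * w ∧ z ^ 2 = (1 + w) ^ 2)) := by
  have q0 : IsSquare (-(1 - z ^ 2)) := by convert h1 using 1; ring
  have q3 : IsSquare (-(1 - z ^ 2 + 3)) := by convert h4 using 1; ring
  have q1 : IsSquare (-(1 - z ^ 2 - 1)) := sq_of_eq (a := z) (by ring)
  have hX : 1 - z ^ 2 ∈ h6 (-1 : K) := by
    have := (q0.mul q3).mul q1
    have e : -1 * c6 (1 - z ^ 2) = -(1 - z ^ 2) * -(1 - z ^ 2 + 3) * -(1 - z ^ 2 - 1) := by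
      unfold c6; ring
    change IsSquare (-1 * c6 (1 - z ^ 2))
    rw [e]
    exact this
  have hz : c6 (1 - z ^ 2) = 0 → (z = 0 ∨ z ^ 2 = 1 ∨ z ^ 2 = 4) := by
    intro hc
    rcases c6_zero hc with hc | hc | hc
    · right; left; linear_combination -hc
    · right; right; linear_combination -hc
    · left
      have : z ^ 2 = 0 := by linear_combination -hc
      exact pow_eq_zero_iff two_ne_zero |>.1 this
  rcases h with h | h
  · exact Or.inl (hz (condA_E6' h hX))
  · rcases excP_all h _ hX with hc | hc
    · exact Or.inl (hz hc)
    · right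
      refine ⟨h, ?_⟩
      rcases hc q0 q3 q1 with ⟨hc, ha, hb⟩ | ⟨w, θ, hw, hθ, hc⟩
      · left; exact ⟨by linear_combination -hc, ha, hb⟩
      · right; exact ⟨w, θ, hw, hθ, by linear_combination -hc - hw⟩

/-- killing the exceptional outcomes: `P j k` says `(j-z)(k-z)` is a square. -/
theorem lemmaM1 (h : condA K ∨ condB K) {z : K} (h1 : IsSquare ((-1 - z) * (1 - z)))
    (h4 : IsSquare ((-2 - z) * (2 - z)))
    (h5 : IsSquare ((-1 - z) * (0 - z)) ∨ IsSquare ((-2 - z) * (-1 - z))) :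
    z = 0 ∨ z ^ 2 = 1 ∨ z ^ 2 = 4 := by
  rcases lemmaM h (z := z) (by convert h1 using 1; ring) (by convert h4 using 1; ring) with h | ⟨hB, h⟩
  · exact h
  exfalso
  have hd := condB_small hB
  rcases h with ⟨hz, hi, h2⟩ | ⟨w, θ, hw, hθ, hz⟩
  · rcases h5 with h5 | h5
    · have := NLi hd hi (w := z) (m := 2) (by norm_num) (by norm_num) (by push_cast; exact hz) 2 1
        (by push_cast; linear_combination hz) h5
      norm_num at this
    · have := NLi hd hi (w := z) (m := 2) (by norm_num) (by norm_num) (by push_cast; exact hz) 4 3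
        (by push_cast; linear_combination hz) h5
      norm_num at this
  · have hz' : (z - (1 + w)) * (z + (1 + w)) = 0 := by linear_combination hz
    rcases mul_eq_zero.1 hz' with hz | hz
    · obtain rfl : z = 1 + w := by linear_combination hz
      rcases h5 with h5 | h5
      · rw [show (-1 - (1 + w)) * (0 - (1 + w)) = ((5 : ℚ) : K) + ((3 : ℚ) : K) * w by
          push_cast; linear_combination hw] at h5
        have := exc_NL hd hw hθ h5
        norm_num at this
      · rw [show (-2 - (1 + w)) * (-1 - (1 + w)) = ((9 : ℚ) : K) + ((5 : ℚ) : K) * w by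
          push_cast; linear_combination hw] at h5
        have := exc_NL hd hw hθ h5
        norm_num at this
    · obtain rfl : z = -1 - w := by linear_combination hz
      rcases h5 with h5 | h5
      · rw [show (-1 - (-1 - w)) * (0 - (-1 - w)) = ((3 : ℚ) : K) + ((1 : ℚ) : K) * w by
          push_cast; linear_combination hw] at h5
        have := exc_NL hd hw hθ h5
        norm_num at this
      · rw [show (-2 - (-1 - w)) * (-1 - (-1 - w)) = ((3 : ℚ) : K) + ((-1 : ℚ) : K) * w by
          push_cast; linear_combination hw] at h5
        have := exc_NL hd hw hθ h5
        norm_num at this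

end PartF1

section PartZ

theorem exists_conj (F L : Type*) [Field F] [CharZero F] [Field L] [Algebra F L]
    (h : Module.finrank F L = 2) :
    ∃ σ : L ≃ₐ[F] L, (∀ x, σ x = x → x ∈ Set.range (algebraMap F L)) ∧ ∀ x, σ (σ x) = x := by
  have : Algebra.IsQuadraticExtension F L := { finrank_eq_two' := h }
  have : FiniteDimensional F L := Module.finite_of_finrank_pos (by omega)
  have hc := IsGalois.card_aut_eq_finrank F L
  rw [h, Nat.card_eq_two_iff' 1] at hc
  obtain ⟨σ, hσ, hu⟩ := hc
  refine ⟨σ, ?_, ?_⟩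
  · intro x hx
    rw [IsGalois.mem_range_algebraMap_iff_fixed]
    intro f
    by_cases hf : f = 1
    · subst hf; rfl
    · rw [hu f hf]; exact hx
  · intro x
    have : σ * σ = 1 := by
      by_contra hne
      have := hu _ hne
      have : σ = 1 := by simpa using this
      exact hσ this
    exact DFunLike.congr_fun this x


theorem biquad_conj {K : Type*} [Field K] [NumberField K] (hd : smallDeg K) {w θ : K} {m n : ℚ}
    (hm : ¬ IsSquare m) (hn : ¬ IsSquare n)
    (hmn : ¬ IsSquare (n * m)) (hw : w ^ 2 = m) (hθ : θ ^ 2 = n) :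
    ∃ σ : K →+* K, σ w = w ∧ σ θ = -θ := by
  have hw2 := sq_memQ hw
  have hθ2 : θ ^ 2 ∈ quad ⊥ w hw2 := le_quad (sq_memQ hθ)
  obtain ⟨hnm, htop⟩ := two_top hd hm hn hmn hw hθ hw2 hθ2
  have h1 := quad_finrank hw2 (ratSqrt_notMem hm hw)
  have h2 := quad_finrank hθ2 hnm
  rw [htop] at h2
  have h3 := Module.finrank_mul_finrank ℚ (quad ⊥ w hw2) K
  have h4 : Module.finrank ℚ (⊤ : IntermediateField ℚ K) = Module.finrank ℚ K :=
    IntermediateField.finrank_top'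
  have h5 : 0 < Module.finrank ℚ (quad ⊥ w hw2) := Module.finrank_pos
  have h6 : Module.finrank (quad ⊥ w hw2) K = 2 := by
    rw [← h4, h2, mul_comm] at h3
    exact Nat.eq_of_mul_eq_mul_right h5 h3
  obtain ⟨σ, hσ, -⟩ := exists_conj (quad ⊥ w hw2) K h6
  refine ⟨(σ : K →+* K), ?_, ?_⟩
  · exact σ.commutes ⟨w, self_mem_quad⟩
  · have e : σ θ ^ 2 = θ ^ 2 := by
      rw [← map_pow, hθ]
      simp
    rcases sq_eq_sq_iff_eq_or_eq_neg.1 e with e | e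
    · obtain ⟨x, hx⟩ := hσ θ e
      exact (hnm (by rw [← hx]; exact x.2)).elim
    · exact e

theorem int_of_rat {K : Type*} [Field K] [NumberField K] {x : K} (hx : IsIntegral ℤ x) {q : ℚ} (h : x = q) :
    ∃ n : ℤ, q = n := by
  have : IsIntegral ℤ q := by
    rw [h] at hx
    have := (isIntegral_algebraMap_iff (R := ℤ) (A := ℚ) (B := K) (algebraMap ℚ K).injective (x := q)).1 (by simpa using hx)
    exact this
  obtain ⟨n, hn⟩ := IsIntegrallyClosed.isIntegral_iff.1 this
  exact ⟨n, by simpa using hn.symm⟩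

theorem mod3_no (P Q E F : ℤ) :
    (15 * (P ^ 2 - Q ^ 2) - (E ^ 2 - F ^ 2)) ^ 2 + (30 * (P * Q) - 2 * (E * F)) ^ 2 ≠ 240 ^ 2 * 5 := by
  intro h
  have key : ∀ a b : ZMod 3, (a ^ 2 - b ^ 2) ^ 2 + (2 * (a * b)) ^ 2 = 0 → a = 0 ∧ b = 0 := by decide
  have h3 : ((E : ZMod 3) ^ 2 - (F : ZMod 3) ^ 2) ^ 2 + (2 * ((E : ZMod 3) * F)) ^ 2 = 0 := by
    have := congrArg (Int.cast : ℤ → ZMod 3) h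
    push_cast at this
    have e15 : (15 : ZMod 3) = 0 := by decide
    have e30 : (30 : ZMod 3) = 0 := by decide
    have e240 : (288000 : ZMod 3) = 0 := by decide
    rw [e15, e30] at this
    rw [e240] at this
    linear_combination this
  obtain ⟨hE, hF⟩ := key _ _ h3
  obtain ⟨E', rfl⟩ := (ZMod.intCast_zmod_eq_zero_iff_dvd E 3).1 hE
  obtain ⟨F', rfl⟩ := (ZMod.intCast_zmod_eq_zero_iff_dvd F 3).1 hF
  have h' : (5 * (P ^ 2 - Q ^ 2) - 3 * (E' ^ 2 - F' ^ 2)) ^ 2 + (10 * (P * Q) - 6 * (E' * F')) ^ 2 = 80 ^ 2 * 5 := by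
    push_cast at h
    linarith
  have := congrArg (Int.cast : ℤ → ZMod 3) h'
  push_cast at this
  have key2 : ∀ a b c d : ZMod 3, (5 * (a ^ 2 - b ^ 2) - 3 * (c ^ 2 - d ^ 2)) ^ 2 + (10 * (a * b) - 6 * (c * d)) ^ 2 ≠ 80 ^ 2 * 5 := by
    decide
  exact key2 _ _ _ _ this

open NumberField in
theorem class15 {K : Type*} [Field K] [NumberField K] (hd : smallDeg K) {i r : K} (hi : i ^ 2 = -1)
    (hr : r ^ 2 = 15) : NumberField.classNumber K ≠ 1 := by
  intro hcl
  have hPID := NumberField.classNumber_eq_one_iff.1 hcl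
  have hi' : i ^ 2 = ((-1 : ℚ) : K) := by push_cast; exact hi
  have hr' : r ^ 2 = ((15 : ℚ) : K) := by push_cast; exact hr
  obtain ⟨σ, hσi, hσr⟩ := biquad_conj hd (w := i) (θ := r) (by norm_num) (by norm_num) (by norm_num) hi' hr'
  obtain ⟨τ, hτr, hτi⟩ := biquad_conj hd (w := r) (θ := i) (by norm_num) (by norm_num) (by norm_num) hr' hi'
  have coords : ∀ g : K, ∃ a b c d : ℚ, g = a + b * i + (c + d * i) * r := by
    intro g
    have hw2 := sq_memQ hi'
    have hθ2 : r ^ 2 ∈ quad ⊥ i hw2 := le_quad (sq_memQ hr')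
    obtain ⟨-, htop⟩ := two_top hd (by norm_num) (by norm_num) (by norm_num) hi' hr' hw2 hθ2
    have hg : g ∈ quad (quad ⊥ i hw2) r hθ2 := by rw [htop]; trivial
    obtain ⟨x, ⟨a, ha, b, hb, rfl⟩, y, ⟨c, hc, d, hd, rfl⟩, rfl⟩ := hg
    obtain ⟨a, rfl⟩ := mem_botQ.1 ha
    obtain ⟨b, rfl⟩ := mem_botQ.1 hb
    obtain ⟨c, rfl⟩ := mem_botQ.1 hc
    obtain ⟨d, rfl⟩ := mem_botQ.1 hd
    exact ⟨a, b, c, d, rfl⟩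
  have hσ : ∀ a b c d : ℚ, σ (a + b * i + (c + d * i) * r) = a + b * i - (c + d * i) * r := by
    intro a b c d
    simp only [map_add, map_mul, hσi, hσr, map_ratCast]; ring
  have hτ : ∀ a b c d : ℚ, τ (a + b * i + (c + d * i) * r) = a - b * i + (c - d * i) * r := by
    intro a b c d
    simp only [map_add, map_mul, hτi, hτr, map_ratCast]; ring
  have hστ : ∀ a b c d : ℚ, σ (τ (a + b * i + (c + d * i) * r)) = a - b * i - (c - d * i) * r := by
    intro a b c d
    rw [hτ]
    simp only [map_add, map_sub, map_mul, hσi, hσr, map_ratCast]; ring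
  -- the norm
  let Nm : K → K := fun g => g * σ g * τ g * σ (τ g)
  have Nm_mul : ∀ x y, Nm (x * y) = Nm x * Nm y := by
    intro x y; simp only [Nm, map_mul]; ring
  have Nm_val : ∀ a b c d : ℚ, Nm (a + b * i + (c + d * i) * r) =
      (((a ^ 2 - b ^ 2 - 15 * (c ^ 2 - d ^ 2)) ^ 2 + (2 * a * b - 30 * c * d) ^ 2 : ℚ) : K) := by
    intro a b c d
    have e1 : ((a : K) + b * i + (c + d * i) * r) * σ (a + b * i + (c + d * i) * r) =
        ((a ^ 2 - b ^ 2 - 15 * (c ^ 2 - d ^ 2) : ℚ) : K) + ((2 * a * b - 30 * c * d : ℚ) : K) * i := by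
      rw [hσ]; push_cast
      linear_combination (-((c : K) + d * i) ^ 2) * hr + ((b : K) ^ 2 - 15 * d ^ 2) * hi
    have e2 : τ (a + b * i + (c + d * i) * r) * σ (τ (a + b * i + (c + d * i) * r)) =
        ((a ^ 2 - b ^ 2 - 15 * (c ^ 2 - d ^ 2) : ℚ) : K) - ((2 * a * b - 30 * c * d : ℚ) : K) * i := by
      rw [hστ, hτ]; push_cast
      linear_combination (-((c : K) - d * i) ^ 2) * hr + ((b : K) ^ 2 - 15 * d ^ 2) * hi
    simp only [Nm]
    rw [e1, mul_assoc, e2]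
    push_cast
    linear_combination (-(2 * (a : K) * b - 30 * c * d) ^ 2) * hi
  have Nm_int : ∀ g : K, IsIntegral ℤ g → ∃ n : ℤ, 0 ≤ n ∧ Nm g = n := by
    intro g hg
    have hI : IsIntegral ℤ (Nm g) :=
      ((hg.mul (map_isIntegral_int σ hg)).mul (map_isIntegral_int τ hg)).mul
        (map_isIntegral_int σ (map_isIntegral_int τ hg))
    obtain ⟨a, b, c, d, rfl⟩ := coords g
    obtain ⟨n, hn⟩ := int_of_rat hI (Nm_val a b c d)
    refine ⟨n, ?_, ?_⟩
    · have : (0 : ℚ) ≤ n := by rw [← hn]; positivity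
      exact_mod_cast this
    · rw [Nm_val, hn]; simp
  have tr_int : ∀ a b c d : ℚ, IsIntegral ℤ ((a : K) + b * i + (c + d * i) * r) → ∃ n : ℤ, 4 * a = n := by
    intro a b c d hg
    have hI := ((hg.add (map_isIntegral_int σ hg)).add (map_isIntegral_int τ hg)).add
        (map_isIntegral_int σ (map_isIntegral_int τ hg))
    refine int_of_rat hI ?_
    rw [hστ, hσ, hτ]; push_cast; ring
  have iI : IsIntegral ℤ i := IsIntegral.of_pow (n := 2) (by norm_num) (by
    rw [hi]; exact isIntegral_one.neg)
  have rI : IsIntegral ℤ r := IsIntegral.of_pow (n := 2) (by norm_num) (by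
    rw [hr]; simpa using (isIntegral_algebraMap (R := ℤ) (A := K) (x := 15)))
  -- the generator
  obtain ⟨I, hI⟩ : ∃ I : 𝓞 K, (I : K) = i := ⟨⟨i, iI⟩, rfl⟩
  obtain ⟨R, hR⟩ : ∃ R : 𝓞 K, (R : K) = r := ⟨⟨r, rI⟩, rfl⟩
  have hI2 : I ^ 2 = -1 := by
    apply RingOfIntegers.ext; simp [hI, hi]
  have hR2 : R ^ 2 = 15 := by
    apply RingOfIntegers.ext; simp only [map_pow, hR, hr]; exact (map_ofNat (algebraMap (𝓞 K) K) 15).symm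
  obtain ⟨g, hg⟩ := hPID.principal (Ideal.span {2 + I, R})
  have hg1 : 2 + I ∈ Ideal.span {2 + I, R} := Ideal.subset_span (by simp)
  have hg2 : R ∈ Ideal.span {2 + I, R} := Ideal.subset_span (by simp)
  have hg3 : g ∈ Ideal.span {2 + I, R} := by rw [hg]; exact Submodule.mem_span_singleton_self g
  rw [hg] at hg1 hg2
  obtain ⟨x, hx⟩ := Ideal.mem_span_singleton'.1 hg1
  obtain ⟨y, hy⟩ := Ideal.mem_span_singleton'.1 hg2
  obtain ⟨p, q, hpq⟩ := Ideal.mem_span_pair.1 hg3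
  -- `2+i = u g²`, `g² = v (2+i)`
  obtain ⟨u, hu⟩ : ∃ u, 2 + I = u * g ^ 2 := ⟨-(5 - 7 * I) * x ^ 2 + 3 * y ^ 2, by
    have e1 : x ^ 2 * g ^ 2 = (2 + I) ^ 2 := by rw [← hx]; ring
    have e2 : y ^ 2 * g ^ 2 = 15 := by rw [← hR2, ← hy]; ring
    linear_combination (5 - 7 * I) * e1 - 3 * e2 + (-7 * I - 23) * hI2⟩
  obtain ⟨v, hv⟩ : ∃ v, g ^ 2 = v * (2 + I) := ⟨p ^ 2 * (2 + I) + 2 * p * q * R + q ^ 2 * 3 * (2 - I), by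
    rw [← hpq]; linear_combination q ^ 2 * hR2 + 3 * q ^ 2 * hI2⟩
  have hu' : (2 : K) + i = u * (g : K) ^ 2 := by
    have := congrArg (algebraMap (𝓞 K) K) hu
    rw [map_add, map_ofNat, map_mul, map_pow] at this; rw [← hI]; exact this
  have hv' : (g : K) ^ 2 = v * (2 + i) := by
    have := congrArg (algebraMap (𝓞 K) K) hv
    rw [map_mul, map_add, map_ofNat, map_pow] at this; rw [← hI]; exact this
  have N2 : Nm (2 + i) = 25 := by
    have := Nm_val 2 1 0 0
    norm_num at this
    exact this
  obtain ⟨nu, nu0, hnu⟩ := Nm_int u u.2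
  obtain ⟨nv, nv0, hnv⟩ := Nm_int v v.2
  obtain ⟨ng, ng0, hng⟩ := Nm_int g g.2
  have e1 : 25 = nu * ng ^ 2 := by
    have := congrArg Nm hu'
    rw [pow_two, Nm_mul, Nm_mul, N2, hnu, hng] at this
    have : (25 : K) = ((nu * ng ^ 2 : ℤ) : K) := by push_cast; rw [this]; ring
    exact_mod_cast this
  have e2 : ng ^ 2 = nv * 25 := by
    have := congrArg Nm hv'
    rw [pow_two, Nm_mul, Nm_mul, N2, hnv, hng] at this
    have : ((ng ^ 2 : ℤ) : K) = ((nv * 25 : ℤ) : K) := by push_cast; rw [← this]; ring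
    exact_mod_cast this
  have e3 : ng = 5 := by
    have h1 : nv * nu = 1 := by
      rw [e2] at e1; linarith
    have h2 : nv = 1 := Int.eq_one_of_mul_eq_one_right nv0 h1
    rw [h2] at e2
    nlinarith
  obtain ⟨a, b, c, d, habcd⟩ := coords g
  have gI : IsIntegral ℤ (g : K) := g.2
  obtain ⟨P, hP⟩ := tr_int a b c d (habcd ▸ gI)
  obtain ⟨Q, hQ⟩ := tr_int b (-a) d (-c) (by
    have := (gI.mul iI).neg
    rw [habcd] at this
    refine (congrArg (fun t : K => IsIntegral ℤ t) ?_).mp this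
    push_cast
    linear_combination -(((b : K) + d * r) * hi))
  obtain ⟨E, hE⟩ := tr_int (15 * c) (15 * d) a b (by
    have := gI.mul rI
    rw [habcd] at this
    refine (congrArg (fun t : K => IsIntegral ℤ t) ?_).mp this
    push_cast
    linear_combination -((-((c : K) + d * i)) * hr))
  obtain ⟨F, hF⟩ := tr_int (15 * d) (-15 * c) b (-a) (by
    have := ((gI.mul rI).mul iI).neg
    rw [habcd] at this
    refine (congrArg (fun t : K => IsIntegral ℤ t) ?_).mp this
    push_cast
    linear_combination -((((c : K) + d * i) * i) * hr + ((b : K) * r + 15 * d) * hi))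
  have e4 : (a ^ 2 - b ^ 2 - 15 * (c ^ 2 - d ^ 2)) ^ 2 + (2 * a * b - 30 * c * d) ^ 2 = 5 := by
    have := Nm_val a b c d
    rw [← habcd, hng, e3] at this
    exact_mod_cast this.symm
  apply mod3_no P Q E F
  have : ((15 * (P ^ 2 - Q ^ 2) - (E ^ 2 - F ^ 2)) ^ 2 + (30 * (P * Q) - 2 * (E * F)) ^ 2 : ℚ) = 240 ^ 2 * 5 := by
    rw [← hP, ← hQ, ← hE, ← hF, ← e4]; ring
  exact_mod_cast this

/-- Lemma Z -/
theorem lemmaZ {K : Type*} [Field K] [NumberField K] (hcond : condA K ∨ condB K)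
    (hE : (∀ x y : K, y ^ 2 = x ^ 3 - x ^ 2 - 9 * x + 9 → inQ x ∧ inQ y) ∨ NumberField.classNumber K = 1)
    (S : K → Prop) (hS : ∀ x y, x ≠ 0 → S x → S y → IsSquare x ∨ IsSquare y ∨ IsSquare (x * y))
    (h1 : S (-1)) (h3 : S 3) (h5 : S 5) : condB K ∧ IsSquare (-1 : K) ∧ IsSquare (3 : K) := by
  have hB : condB K := by
    rcases hcond with h | h
    · obtain ⟨a, b, c⟩ := condA_nsq h
      rcases hS _ _ (by norm_num) h1 h3 with h | h | h
      · exact (a h).elim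
      · exact (b h).elim
      · exact (c (by simpa using h)).elim
    · exact h
  obtain ⟨n5, n5'⟩ := condB_no5 hB
  have hi : IsSquare (-1 : K) := by
    rcases hS _ _ (by norm_num) h1 h5 with h | h | h
    · exact h
    · exact (n5 h).elim
    · exact (n5' (by simpa using h)).elim
  refine ⟨hB, hi, ?_⟩
  rcases hS _ _ (by norm_num) h3 h5 with h | h | h
  · exact h
  · exact (n5 h).elim
  · exfalso
    obtain ⟨i, hi⟩ := hi
    obtain ⟨r, hr⟩ := h
    rcases hE with hE | hE
    · have := (hE 6 (3 * r) (by linear_combination (-9) * hr)).2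
      have := inQ_sq (q := 135) this (by push_cast; linear_combination (-9) * hr)
      norm_num at this
    · exact class15 (condB_small hB) (i := i) (r := r) (by rw [hi]; ring) (by linear_combination -hr) hE

end PartZ

set_option linter.unusedSectionVars false

section PartF2
variable {K L : Type*} [Field K] [NumberField K] [Field L] [NumberField L]

/-- quadratic extension with its conjugation -/
structure QE (f : K →+* L) (σ : L →+* L) : Prop where
  comm : ∀ a, σ (f a) = f a
  fix : ∀ x, σ x = x → ∃ a, f a = x
  inv : ∀ x, σ (σ x) = x

variable {f : K →+* L} {σ : L →+* L}

theorem QE.tr (q : QE f σ) (x : L) : ∃ a, f a = x + σ x := q.fix _ (by rw [map_add, q.inv]; ring)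
theorem QE.nm (q : QE f σ) (x : L) : ∃ a, f a = x * σ x := q.fix _ (by rw [map_mul, q.inv]; ring)

theorem QE.tower (q : QE f σ) {δ : L} {D : K} (hδ : δ ^ 2 = f D) (hK : ∀ a, f a ≠ δ) (x : L) :
    ∃ a b : K, x = f a + f b * δ := by
  have hc : σ δ = -δ := by
    have : σ δ ^ 2 = δ ^ 2 := by rw [← map_pow, hδ, q.comm]
    rcases sq_eq_sq_iff_eq_or_eq_neg.1 this with h | h
    · obtain ⟨a, ha⟩ := q.fix _ h
      exact (hK a ha).elim
    · exact h
  have h0 : δ ≠ 0 := by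
    intro h
    exact hK 0 (by rw [h, map_zero])
  obtain ⟨a, ha⟩ := q.tr (x / 2)
  obtain ⟨b, hb⟩ := q.fix ((x - σ x) / (2 * δ)) (by
    simp only [map_div₀, map_sub, map_mul, q.inv, hc, map_ofNat]
    field_simp
    ring)
  refine ⟨a, b, ?_⟩
  rw [ha, hb]
  simp only [map_div₀, map_ofNat]
  field_simp
  ring

/-- squares of `L` lying in `K` -/
theorem QE.sq (q : QE f σ) {x y : K} (hx : IsSquare (f x)) (hy : IsSquare (f y)) :
    IsSquare x ∨ IsSquare y ∨ IsSquare (x * y) := by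
  obtain ⟨r, hr⟩ := hx
  obtain ⟨s, hs⟩ := hy
  have hr2 : σ r ^ 2 = r ^ 2 := by rw [← map_pow, pow_two, ← hr, q.comm]
  have hs2 : σ s ^ 2 = s ^ 2 := by rw [← map_pow, pow_two, ← hs, q.comm]
  have finish : ∀ (z : K) (t : L), f z = t * t → σ t = t → IsSquare z := by
    intro z t h1 h2
    obtain ⟨a, rfl⟩ := q.fix _ h2
    exact ⟨a, f.injective (by rw [h1, map_mul])⟩
  rcases sq_eq_sq_iff_eq_or_eq_neg.1 hr2 with h | h
  · exact Or.inl (finish _ _ hr h)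
  rcases sq_eq_sq_iff_eq_or_eq_neg.1 hs2 with h' | h'
  · exact Or.inr (Or.inl (finish _ _ hs h'))
  · exact Or.inr (Or.inr (finish _ (r * s) (by rw [map_mul, hr, hs]; ring) (by rw [map_mul, h, h']; ring)))

theorem QE.trace (q : QE f σ) {A B : K} (hAB : A ≠ B) {t y : L} (ht : ∀ a, f a ≠ t)
    (hy : y ^ 2 = (t ^ 2 - f A) * (t ^ 2 - f B)) :
    σ t = -t ∨ ∃ r N : K, f N = t * σ t ∧ IsSquare ((r ^ 2 - A) * (r ^ 2 - B)) ∧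
      (∀ s s' : K, (s ^ 2 - A) * (s ^ 2 - B) = 0 → (s' ^ 2 - A) * (s' ^ 2 - B) = 0 →
        IsSquare ((f s - t) * (f s' - t)) → IsSquare ((s - r) * (s' - r))) ∧
      (r = 0 → N ^ 2 = A * B) := by
  have htt : t - σ t ≠ 0 := by
    intro h
    obtain ⟨a, ha⟩ := q.fix t (by linear_combination -h)
    exact ht a ha
  obtain ⟨T, hT⟩ := q.tr t
  obtain ⟨N, hN⟩ := q.nm t
  obtain ⟨b, hb⟩ := q.fix ((y - σ y - (t ^ 2 - σ t ^ 2)) / (t - σ t)) (by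
    have htt' : σ t - t ≠ 0 := fun h => htt (by linear_combination -h)
    simp only [map_div₀, map_sub, map_pow, q.inv]
    rw [div_eq_div_iff htt' htt]; ring)
  rw [eq_div_iff htt] at hb
  obtain ⟨g, hg⟩ := q.fix (y - t ^ 2 - f b * t) (by
    simp only [map_sub, map_mul, map_pow, q.comm]
    linear_combination hb)
  have hyt : y = t ^ 2 + f b * t + f g := by rw [hg]; ring
  have hys : σ y = σ t ^ 2 + f b * σ t + f g := by
    rw [hyt]; simp only [map_add, map_mul, map_pow, q.comm]
  have hy' : σ y ^ 2 = (σ t ^ 2 - f A) * (σ t ^ 2 - f B) := by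
    rw [← map_pow, hy]; simp only [map_mul, map_sub, map_pow, q.comm]
  rw [hyt] at hy
  rw [hys] at hy'
  by_cases hb0 : b = 0
  · left
    rw [hb0, map_zero] at hy hy'
    have e : (f A + f B + 2 * f g) * (t + σ t) * (t - σ t) = 0 := by linear_combination hy - hy'
    have e2 := (mul_eq_zero.1 e).resolve_right htt
    rcases mul_eq_zero.1 e2 with e2 | e2
    · exfalso
      have e3 : f ((A - B) ^ 2) = 0 := by
        simp only [map_pow, map_sub]
        linear_combination 4 * hy + (f A + f B - 2 * f g - 4 * t ^ 2) * e2
      have := (map_eq_zero f).1 e3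
      exact hAB (sub_eq_zero.1 (pow_eq_zero_iff two_ne_zero |>.1 this))
    · linear_combination e2
  · right
    have hfb : f b ≠ 0 := by simpa using hb0
    obtain ⟨r, hr⟩ : ∃ r : K, 2 * b * (r + T) = -(A + B + b ^ 2 + 2 * g) :=
      ⟨-(A + B + b ^ 2 + 2 * g) / (2 * b) - T, by field_simp; ring⟩
    have hr' : 2 * f b * (f r + f T) = -(f A + f B + f b ^ 2 + 2 * f g) := by
      have := congrArg f hr
      simp only [map_mul, map_add, map_neg, map_pow, map_ofNat] at this
      exact this
    -- the two Vieta relations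
    have k1 : f (2 * b * (g - N - r * T)) = 0 := by
      have : f (2 * b * (g - N - r * T)) * (t - σ t) = 0 := by
        simp only [map_mul, map_sub, map_ofNat]
        rw [hN]
        rw [hT] at hr' ⊢
        linear_combination hy - hy' - (t + σ t) * (t - σ t) * hr'
      exact (mul_eq_zero.1 this).resolve_right htt
    have k1' := (map_eq_zero f).1 k1
    have k1'' : g = N + r * T := by
      rcases mul_eq_zero.1 k1' with h | h
      · simp [hb0] at h
      · linear_combination h
    have k2 : g ^ 2 - A * B = -2 * b * r * N := by
      apply f.injective
      have k1f : f g = f N + f r * f T := by rw [k1'']; simp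
      simp only [map_sub, map_pow, map_mul, map_neg, map_ofNat]
      rw [hT] at hr' k1f
      rw [hN] at k1f ⊢
      linear_combination hy - t ^ 2 * hr' - 2 * f b * t * k1f
    have ident : ∀ x : K, (x ^ 2 + b * x + g) ^ 2 = (x ^ 2 - A) * (x ^ 2 - B) + 2 * b * (x - r) * (x ^ 2 - T * x + N) := by
      intro x
      linear_combination (x ^ 2) * hr + 2 * b * x * k1'' + k2
    refine ⟨r, N, hN, ⟨r ^ 2 + b * r + g, by linear_combination -ident r⟩, ?_, ?_⟩
    · intro s s' hs hs' hsq
      obtain ⟨x, hx⟩ := hsq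
      obtain ⟨m, hm⟩ := q.nm x
      have hM : (s ^ 2 - T * s + N) * (s' ^ 2 - T * s' + N) = m ^ 2 := by
        apply f.injective
        simp only [map_mul, map_sub, map_add, map_pow]
        have e2 := congrArg σ hx
        simp only [map_mul, map_sub, q.comm] at e2
        rw [hT, hN, hm]
        linear_combination (f s - σ t) * (f s' - σ t) * hx + x * x * e2
      have hne : ∀ s : K, s ^ 2 - T * s + N ≠ 0 := by
        intro s h
        have h' := congrArg f h
        simp only [map_sub, map_add, map_mul, map_pow, map_zero] at h'
        rw [hT, hN] at h'
        have : (f s - t) * (f s - σ t) = 0 := by linear_combination h'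
        rcases mul_eq_zero.1 this with h | h
        · exact ht s (by linear_combination h)
        · refine ht s ?_
          have := congrArg σ h
          simp only [map_sub, q.comm, q.inv, map_zero] at this
          linear_combination this
      have hm0 : m ≠ 0 := by
        rintro rfl
        have := mul_ne_zero (hne s) (hne s')
        rw [hM] at this
        simp at this
      refine ⟨(s ^ 2 + b * s + g) * (s' ^ 2 + b * s' + g) / (2 * b * m), ?_⟩
      have i1 := ident s
      have i2 := ident s'
      rw [hs, zero_add] at i1
      rw [hs', zero_add] at i2
      have e : (s ^ 2 + b * s + g) * (s' ^ 2 + b * s' + g) / (2 * b * m) * ((s ^ 2 + b * s + g) * (s' ^ 2 + b * s' + g) / (2 * b * m))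
          = (s ^ 2 + b * s + g) ^ 2 * (s' ^ 2 + b * s' + g) ^ 2 / (4 * b ^ 2 * m ^ 2) := by
        field_simp; ring
      rw [e, i1, i2]
      have h4 : 4 * b ^ 2 * m ^ 2 ≠ 0 := mul_ne_zero (mul_ne_zero (by norm_num) (pow_ne_zero _ hb0)) (pow_ne_zero _ hm0)
      rw [eq_div_iff h4]
      linear_combination (-4 * b ^ 2 * (s - r) * (s' - r)) * hM
    · intro h0
      rw [h0] at k1'' k2
      have : g = N := by linear_combination k1''
      rw [← this]; linear_combination k2

end PartF2

set_option linter.unusedSectionVars false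
set_option linter.unusedVariables false

section PartF3
variable {K L : Type*} [Field K] [NumberField K] [Field L] [NumberField L]
variable {f : K →+* L} {σ : L →+* L}

/-- trace trick for a window `{±a, ±b}` -/
theorem QE.win (q : QE f σ) (a b : ℚ) (hab : a ^ 2 ≠ b ^ 2) {t : L} (ht : ∀ x, f x ≠ t)
    (H : ∀ s s' : ℚ, (s = a ∨ s = -a ∨ s = b ∨ s = -b) → (s' = a ∨ s' = -a ∨ s' = b ∨ s' = -b) →
      IsSquare (((s : L) - t) * ((s' : L) - t))) :
    σ t = -t ∨ ∃ r N : K, f N = t * σ t ∧ IsSquare ((r ^ 2 - (a : K) ^ 2) * (r ^ 2 - (b : K) ^ 2)) ∧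
      (∀ s s' : ℚ, (s = a ∨ s = -a ∨ s = b ∨ s = -b) → (s' = a ∨ s' = -a ∨ s' = b ∨ s' = -b) →
        IsSquare (((s : K) - r) * ((s' : K) - r))) ∧
      (r = 0 → N ^ 2 = (a : K) ^ 2 * (b : K) ^ 2) := by
  obtain ⟨y, hy⟩ := (H a (-a) (by simp) (by simp)).mul (H b (-b) (by simp) (by simp))
  have hK : ((a : K) ^ 2 : K) ≠ (b : K) ^ 2 := by exact_mod_cast hab
  have key : ∀ s : ℚ, (s = a ∨ s = -a ∨ s = b ∨ s = -b) →
      ((s : K) ^ 2 - (a : K) ^ 2) * ((s : K) ^ 2 - (b : K) ^ 2) = 0 := by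
    rintro s (rfl | rfl | rfl | rfl) <;> push_cast <;> ring
  rcases q.trace hK ht (y := y) (by
    simp only [map_pow, map_ratCast]; push_cast at hy; linear_combination -hy) with h | ⟨r, N, h1, h2, h3, h4⟩
  · exact Or.inl h
  · refine Or.inr ⟨r, N, h1, h2, ?_, h4⟩
    intro s s' hs hs'
    exact h3 s s' (key s hs) (key s' hs') (by simpa using H s s' hs hs')

/-- the six points of the progression -/
def six (s : ℚ) : Prop := s = -5 ∨ s = -3 ∨ s = -1 ∨ s = 1 ∨ s = 3 ∨ s = 5

theorem six_win {v : L} (H : ∀ s s' : ℚ, six s → six s' → IsSquare (((s : L) - v) * ((s' : L) - v)))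
    (e : ℚ) (he : e = 2 ∨ e = 0 ∨ e = -2) : 
    ∀ s s' : ℚ, (s = 1 ∨ s = -1 ∨ s = 3 ∨ s = -3) → (s' = 1 ∨ s' = -1 ∨ s' = 3 ∨ s' = -3) →
      IsSquare (((s : L) - (v + (e : L))) * ((s' : L) - (v + (e : L)))) := by
  intro s s' hs hs'
  have key : ∀ s : ℚ, (s = 1 ∨ s = -1 ∨ s = 3 ∨ s = -3) → six (s - e) := by
    rintro s (rfl | rfl | rfl | rfl) <;> rcases he with rfl | rfl | rfl <;> norm_num [six]
  have := H _ _ (key s hs) (key s' hs')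
  convert this using 1
  push_cast; ring

theorem sq_four {a b : K} (h : IsSquare a) (e : a = 4 * b) : IsSquare b := by
  obtain ⟨c, hc⟩ := h
  exact ⟨c / 2, by linear_combination (hc - e) / 4⟩

theorem eq_pm {K : Type*} [Field K] {u a : K} (h : u ^ 2 = a ^ 2) : u = a ∨ u = -a := sq_eq_sq_iff_eq_or_eq_neg.1 h

theorem v_notin_I (q : QE f σ) {v : L} (hv : ∀ a, f a ≠ v)
    (H : ∀ s s' : ℚ, six s → six s' → IsSquare (((s : L) - v) * ((s' : L) - v)))
    (n1 : ¬ (IsSquare (-1 : K) ∧ IsSquare (3 : K))) (n2 : ¬ (IsSquare (-1 : K) ∧ IsSquare (2 : K)))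
    (n3 : ¬ (IsSquare (2 : K) ∧ IsSquare (3 : K)))
    (hu : ∀ u : K, IsSquare ((u ^ 2 - 1) * (u ^ 2 - 9)) → u = 0 ∨ u ^ 2 = 1 ∨ u ^ 2 = 9) : False := by
  have key : ∀ e : ℚ, (e = 2 ∨ e = 0 ∨ e = -2) → σ (v + e) = -(v + e) := by
    intro e he
    have hne : ∀ x, f x ≠ v + e := by
      intro x hx
      exact hv (x - e) (by rw [map_sub, hx, map_ratCast]; ring)
    rcases q.win 1 3 (by norm_num) hne (six_win H e he) with h | ⟨r, N, -, h2, h3, -⟩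
    · exact h
    exfalso
    rcases hu r (by norm_num at h2; exact h2) with rfl | h | h
    · refine n1 ⟨?_, ?_⟩
      · have := h3 (-1) 1 (by norm_num) (by norm_num)
        norm_num at this; exact this
      · have := h3 1 3 (by norm_num) (by norm_num)
        norm_num at this; exact this
    · rcases eq_pm (u := r) (a := 1) (by rw [h]; norm_num) with rfl | rfl
      · have a := h3 (-1) 3 (by norm_num) (by norm_num)
        have b := h3 (-1) (-3) (by norm_num) (by norm_num)
        exact n2 ⟨sq_four a (by norm_num), sq_four b (by norm_num)⟩
      · have a := h3 1 (-3) (by norm_num) (by norm_num)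
        have b := h3 1 3 (by norm_num) (by norm_num)
        exact n2 ⟨sq_four a (by norm_num), sq_four b (by norm_num)⟩
    · rcases eq_pm (u := r) (a := 3) (by rw [h]; norm_num) with rfl | rfl
      · have a := h3 1 (-1) (by norm_num) (by norm_num)
        have b := h3 1 (-3) (by norm_num) (by norm_num)
        exact n3 ⟨sq_four a (by norm_num), sq_four b (by norm_num)⟩
      · have a := h3 1 (-1) (by norm_num) (by norm_num)
        have b := h3 (-1) 3 (by norm_num) (by norm_num)
        exact n3 ⟨sq_four a (by norm_num), sq_four b (by norm_num)⟩
  have k1 := key 0 (by norm_num)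
  have k2 := key 2 (by norm_num)
  rw [map_add, map_ratCast] at k1 k2
  push_cast at k1 k2
  have : (4 : L) = 0 := by linear_combination k2 - k1
  norm_num at this

theorem v_notin_II (q : QE f σ) {v : L} (hv : ∀ a, f a ≠ v)
    (H : ∀ s s' : ℚ, six s → six s' → IsSquare (((s : L) - v) * ((s' : L) - v)))
    (hB : condB K) (h1 : IsSquare (-1 : K)) (h3' : IsSquare (3 : K))
    (hu : ∀ u : K, IsSquare ((u ^ 2 - 1) * (u ^ 2 - 9)) → (u = 0 ∨ u ^ 2 = 1 ∨ u ^ 2 = 9) ∨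
        u ^ 2 = 3 ∨ u ^ 2 = -3) : False := by
  have hd := condB_small hB
  obtain ⟨T, hT⟩ := q.tr v
  obtain ⟨N, hN⟩ := q.nm v
  have n8 : ¬ IsSquare (8 : K) := by
    intro h
    have := ratSq3 hd h1 h3' (p := 8) (by exact_mod_cast h)
    norm_num at this
  have key : ∀ e : ℚ, (e = 2 ∨ e = 0 ∨ e = -2) → T + 2 * e = 0 ∨ (N + e * T + e ^ 2) ^ 2 = 9 := by
    intro e he
    have hne : ∀ x, f x ≠ v + e := by
      intro x hx
      exact hv (x - e) (by rw [map_sub, hx, map_ratCast]; ring)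
    rcases q.win 1 3 (by norm_num) hne (six_win H e he) with h | ⟨r, N', hN', h2, h3, h4⟩
    · left
      rw [map_add, map_ratCast] at h
      apply f.injective
      simp only [map_add, map_mul, map_ofNat, map_ratCast, map_zero]
      rw [hT]; linear_combination h
    have hNN : N' = N + e * T + e ^ 2 := by
      apply f.injective
      simp only [map_add, map_mul, map_pow, map_ratCast]
      rw [hN', hT, hN, map_add, map_ratCast]; ring
    right
    rcases hu r (by norm_num at h2; exact h2) with (rfl | h | h) | h | h
    · rw [← hNN, h4 rfl]; norm_num
    · exfalso
      rcases eq_pm (u := r) (a := 1) (by rw [h]; norm_num) with rfl | rfl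
      · have b := h3 (-1) (-3) (by norm_num) (by norm_num)
        norm_num at b; exact n8 b
      · have b := h3 1 3 (by norm_num) (by norm_num)
        norm_num at b; exact n8 b
    · exfalso
      rcases eq_pm (u := r) (a := 3) (by rw [h]; norm_num) with rfl | rfl
      · have a := h3 1 (-1) (by norm_num) (by norm_num)
        norm_num at a; exact n8 a
      · have a := h3 1 (-1) (by norm_num) (by norm_num)
        norm_num at a; exact n8 a
    · exfalso
      have a := h3 1 3 (by norm_num) (by norm_num)
      have := NLi hd h1 (w := r) (m := 3) (by norm_num) (by norm_num) (by rw [h]; norm_num) 6 (-4)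
        (by push_cast; linear_combination h) a
      norm_num at this
    · exfalso
      have a := h3 1 3 (by norm_num) (by norm_num)
      have := NLi hd h1 (w := r) (m := -3) (by norm_num) (by norm_num) (by rw [h]; norm_num) 0 (-4)
        (by push_cast; linear_combination h) a
      norm_num at this
  have k0 := key 0 (by norm_num)
  have k1 := key 2 (by norm_num)
  have k2 := key (-2) (by norm_num)
  push_cast at k0 k1 k2
  have sp : ∀ x : K, x ^ 2 = 9 → x = 3 ∨ x = -3 := fun x h => eq_pm (by rw [h]; norm_num)
  by_cases hT0 : T = 0
  · rw [hT0] at k1 hT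
    rw [map_zero] at hT
    have hσ : σ v = -v := by linear_combination -hT
    rw [hσ] at hN
    rcases k1 with k1 | k1
    · norm_num at k1
    rcases sp _ k1 with k | k
    · have : N = -1 := by linear_combination k
      rw [this, map_neg, map_one] at hN
      have : v ^ 2 = 1 ^ 2 := by linear_combination hN
      rcases eq_pm this with h | h
      · exact hv 1 (by rw [h, map_one])
      · exact hv (-1) (by rw [h, map_neg, map_one])
    · have : N = -7 := by linear_combination k
      rw [this, map_neg, map_ofNat] at hN
      have hv7 : v ^ 2 = 7 := by linear_combination hN
      obtain ⟨x, hx⟩ := H (-5) (-3) (by norm_num [six]) (by norm_num [six])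
      push_cast at hx
      have h0 : 2 + v ≠ 0 := fun h => hv (-2) (by rw [map_neg, map_ofNat]; linear_combination -h)
      have s2 : IsSquare (f 2) := ⟨x / (2 + v), by
        rw [map_ofNat]; field_simp; linear_combination hx + hv7⟩
      have s7 : IsSquare (f 7) := ⟨v, by rw [map_ofNat, ← hv7]; ring⟩
      rcases q.sq s2 s7 with h | h | h
      · have := ratSq3 hd h1 h3' (p := 2) (by exact_mod_cast h)
        norm_num at this
      · have := ratSq3 hd h1 h3' (p := 7) (by exact_mod_cast h)
        norm_num at this
      · have := ratSq3 hd h1 h3' (p := 14) (by norm_num at h; exact_mod_cast h)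
        norm_num at this
  · have k0' : N = 3 ∨ N = -3 := by
      rcases k0 with h | h
      · exact (hT0 (by linear_combination h)).elim
      · exact sp N (by linear_combination h)
    have k1' : T = -4 ∨ N + 2 * T + 4 = 3 ∨ N + 2 * T + 4 = -3 := by
      rcases k1 with h | h
      · left; linear_combination h
      · right; exact sp _ (by linear_combination h)
    have k2' : T = 4 ∨ N - 2 * T + 4 = 3 ∨ N - 2 * T + 4 = -3 := by
      rcases k2 with h | h
      · left; linear_combination h
      · right; exact sp _ (by linear_combination h)
    clear k0 k1 k2 key hu H
    rcases k1' with h | h | h <;> rcases k2' with h' | h' | h' <;> rcases k0' with h'' | h'' <;> grind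

/-- norm test in `L = ℚ(δ, √2, i)` -/
theorem NL3 (q : QE f σ) (hd : smallDeg K) (h1 : IsSquare (-1 : K)) (h2 : IsSquare (2 : K))
    {δ : L} {m : ℚ} (hm : ¬ IsSquare m) (hδ : δ ^ 2 = m) (hK : ∀ a, f a ≠ δ) {p r : ℚ}
    (h : IsSquare ((p : L) + r * δ)) : IsSquare (p ^ 2 - m * r ^ 2) := by
  obtain ⟨i, hi⟩ := h1
  obtain ⟨t, ht⟩ := h2
  obtain ⟨x, hx⟩ := h
  have hi' : i ^ 2 = ((-1 : ℚ) : K) := by push_cast; rw [hi]; ring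
  have ht' : t ^ 2 = ((2 : ℚ) : K) := by push_cast; rw [ht]; ring
  have hfi : f i ^ 2 = ((-1 : ℚ) : L) := by rw [← map_pow, hi', map_ratCast]
  have hft : f t ^ 2 = ((2 : ℚ) : L) := by rw [← map_pow, ht', map_ratCast]
  obtain ⟨-, htop⟩ := two_top hd (by norm_num) (by norm_num) (by norm_num) ht' hi' (sq_memQ ht')
    (le_quad (sq_memQ hi'))
  have hG := sq_memQ hδ
  have hF : f t ^ 2 ∈ quad ⊥ δ hG := le_quad (sq_memQ hft)
  have hE : f i ^ 2 ∈ quad (quad ⊥ δ hG) (f t) hF := le_quad (le_quad (sq_memQ hfi))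
  set G := quad ⊥ δ hG with hGdef
  set F := quad G (f t) hF with hFdef
  set E := quad F (f i) hE with hEdef
  have hGF : G ≤ F := le_quad
  have hFE : F ≤ E := le_quad
  have mt : f t ∈ F := self_mem_quad
  have mi : f i ∈ E := self_mem_quad
  have mδ : δ ∈ G := self_mem_quad
  have hfa : ∀ a : K, f a ∈ E := by
    intro a
    have : a ∈ quad (quad ⊥ t (sq_memQ ht')) i (le_quad (sq_memQ hi')) := by rw [htop]; trivial
    obtain ⟨a1, ⟨p1, hp1, q1, hq1, rfl⟩, a2, ⟨p2, hp2, q2, hq2, rfl⟩, rfl⟩ := this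
    obtain ⟨p1, rfl⟩ := mem_botQ.1 hp1
    obtain ⟨q1, rfl⟩ := mem_botQ.1 hq1
    obtain ⟨p2, rfl⟩ := mem_botQ.1 hp2
    obtain ⟨q2, rfl⟩ := mem_botQ.1 hq2
    simp only [map_add, map_mul, map_ratCast]
    exact E.add_mem (E.add_mem (ratCast_memF _ _) (E.mul_mem (ratCast_memF _ _) (hFE mt)))
      (E.mul_mem (E.add_mem (ratCast_memF _ _) (E.mul_mem (ratCast_memF _ _) (hFE mt))) mi)
  have hxE : x ∈ E := by
    obtain ⟨a, b, rfl⟩ := q.tower (D := (m : K)) (by rw [hδ, map_ratCast]) hK x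
    exact E.add_mem (hfa a) (E.mul_mem (hfa b) (hFE (hGF mδ)))
  have mα : (p : L) + r * δ ∈ G := G.add_mem (ratCast_memF _ _) (G.mul_mem (ratCast_memF _ _) mδ)
  have step : ∀ (c : L) (p r : ℚ), c ∈ F → (p : L) + r * δ = c ^ 2 → IsSquare (p ^ 2 - m * r ^ 2) := by
    intro c p r hc hcc
    have mα : (p : L) + r * δ ∈ G := G.add_mem (ratCast_memF _ _) (G.mul_mem (ratCast_memF _ _) mδ)
    rcases quad_SD hF mα hc hcc with ⟨d, hd, hdd⟩ | ⟨d, hd, hdd⟩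
    · exact quadQ_norm hm hδ hG hd hdd
    · have := quadQ_norm (p := p / 2) (q := r / 2) hm hδ hG hd (by
        rw [hft] at hdd; push_cast at hdd ⊢; linear_combination hdd / 2)
      obtain ⟨y, hy⟩ := this
      exact ⟨2 * y, by linear_combination 4 * hy⟩
  rcases quad_SD hE (hGF mα) hxE (by rw [hx]; ring) with ⟨c, hc, hcc⟩ | ⟨c, hc, hcc⟩
  · exact step c p r hc hcc
  · have := step c (-p) (-r) hc (by rw [hfi] at hcc; push_cast at hcc ⊢; linear_combination -hcc)
    convert this using 1; ring

theorem III_kill (q : QE f σ) (hd : smallDeg K) (h1 : IsSquare (-1 : K)) (h2 : IsSquare (2 : K))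
    {z : L} (s n : ℚ) (hz : z ^ 2 = s * z - n) (hK : ∀ a, f a ≠ z) (hm : ¬ IsSquare (s ^ 2 - 4 * n))
    (j k : ℚ) (h : IsSquare (((j : L) - z) * ((k : L) - z))) :
    IsSquare ((j ^ 2 - j * s + n) * (k ^ 2 - k * s + n)) := by
  have hδ : (2 * z - s) ^ 2 = ((s ^ 2 - 4 * n : ℚ) : L) := by push_cast; linear_combination 4 * hz
  have := NL3 q hd h1 h2 hm hδ (by
    intro a ha
    exact hK ((a + s) / 2) (by
      simp only [map_div₀, map_add, map_ofNat, map_ratCast]; rw [ha]; ring))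
    (p := (j - s / 2) * (k - s / 2) + (s ^ 2 - 4 * n) / 4) (r := - (j + k - s) / 2) (by
      convert h using 1
      push_cast
      linear_combination -hz)
  convert this using 1
  ring

theorem v_notin_III (q : QE f σ) (hcond : condA K ∨ condB K) {z : L} (hz : ∀ a, f a ≠ z)
    (H : ∀ s s' : ℚ, (s = -2 ∨ s = -1 ∨ s = 0 ∨ s = 1 ∨ s = 2 ∨ s = 3) →
      (s' = -2 ∨ s' = -1 ∨ s' = 0 ∨ s' = 1 ∨ s' = 2 ∨ s' = 3) → IsSquare (((s : L) - z) * ((s' : L) - z)))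
    (hB : condB K) (h1 : IsSquare (-1 : K)) (h2 : IsSquare (2 : K)) : False := by
  have hd := condB_small hB
  obtain ⟨S, hS⟩ := q.tr z
  obtain ⟨N, hN⟩ := q.nm z
  have n3 : ¬ IsSquare (3 : K) := by
    intro h
    have := ratSq2 hd h1 h2 (p := 3) (by exact_mod_cast h)
    norm_num at this
  have key : ∀ e : ℚ, (e = 0 ∨ e = 1) → S - 2 * e = 0 ∨ (N - e * S + e ^ 2) ^ 2 = 4 := by
    intro e he
    have hne : ∀ x, f x ≠ z - e := by
      intro x hx
      exact hz (x + e) (by rw [map_add, hx, map_ratCast]; ring)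
    have mem : ∀ s : ℚ, (s = 1 ∨ s = -1 ∨ s = 2 ∨ s = -2) → 
        (s + e = -2 ∨ s + e = -1 ∨ s + e = 0 ∨ s + e = 1 ∨ s + e = 2 ∨ s + e = 3) := by
      rintro s (rfl | rfl | rfl | rfl) <;> rcases he with rfl | rfl <;> norm_num
    rcases q.win 1 2 (by norm_num) hne (by
      intro s s' hs hs'
      have := H _ _ (mem s hs) (mem s' hs')
      convert this using 1
      push_cast; ring) with h | ⟨r, N', hN', -, h3, h4⟩
    · left
      rw [map_sub, map_ratCast] at h
      apply f.injective
      simp only [map_sub, map_mul, map_ofNat, map_ratCast, map_zero]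
      rw [hS]; linear_combination h
    have hNN : N' = N - e * S + e ^ 2 := by
      apply f.injective
      simp only [map_add, map_sub, map_mul, map_pow, map_ratCast]
      rw [hN', hS, hN, map_sub, map_ratCast]; ring
    right
    have q1 := h3 1 (-1) (by norm_num) (by norm_num)
    have q2 := h3 2 (-2) (by norm_num) (by norm_num)
    rcases lemmaM hcond (z := r) (by convert q1 using 1; push_cast; ring)
      (by convert q2 using 1; push_cast; ring) with (rfl | h | h) | ⟨-, ⟨h, -⟩ | ⟨w, θ, hw, -⟩⟩
    · rw [← hNN, h4 rfl]; norm_num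
    · exfalso
      refine n3 ?_
      have : IsSquare (-(3 : K)) := by
        convert q2 using 1; push_cast; linear_combination -h
      simpa using sq_neg h1 this
    · exfalso
      refine n3 ?_
      convert q1 using 1; push_cast; linear_combination -h
    · exfalso
      have a := h3 1 2 (by norm_num) (by norm_num)
      have := NLi hd h1 (w := r) (m := 2) (by norm_num) (by norm_num) (by rw [h]; norm_num) 4 (-3)
        (by push_cast; linear_combination h) a
      norm_num at this
    · exact (n3 (sq_of_eq hw)).elim
  have k0 := key 0 (by norm_num)
  have k1 := key 1 (by norm_num)
  push_cast at k0 k1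
  have sp : ∀ x : K, x ^ 2 = 4 → x = 2 ∨ x = -2 := fun x h => eq_pm (by rw [h]; norm_num)
  have quadr : z ^ 2 = f S * z - f N := by rw [hS, hN]; ring
  have final : (S = 0 ∧ N = 1) ∨ (S = 2 ∧ N = 2) ∨ (S = 1 ∧ N = -2) ∨ (S = 0 ∧ N = -3) ∨ (S = 2 ∧ N = -2)
      ∨ (S = 1 ∧ N = 2) ∨ (S = 5 ∧ N = 2) ∨ (S = -3 ∧ N = -2) := by
    have k0' : S = 0 ∨ N = 2 ∨ N = -2 := by
      rcases k0 with h | h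
      · left; linear_combination h
      · right; exact sp N (by linear_combination h)
    have k1' : S = 2 ∨ N - S + 1 = 2 ∨ N - S + 1 = -2 := by
      rcases k1 with h | h
      · left; linear_combination h
      · right; exact sp _ (by linear_combination h)
    clear k0 k1 key H
    rcases k0' with h | h | h <;> rcases k1' with h' | h' | h' <;> grind
  obtain ⟨i, hi⟩ := h1
  have h1 : IsSquare (-1 : K) := ⟨i, hi⟩
  have hfi : f i * f i = -1 := by rw [← map_mul, ← hi, map_neg, map_one]
  have fin : ∀ (s n j k : ℚ), f S = s → f N = n → ¬ IsSquare (s ^ 2 - 4 * n) →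
      (j = -2 ∨ j = -1 ∨ j = 0 ∨ j = 1 ∨ j = 2 ∨ j = 3) → (k = -2 ∨ k = -1 ∨ k = 0 ∨ k = 1 ∨ k = 2 ∨ k = 3) →
      ¬ IsSquare ((j ^ 2 - j * s + n) * (k ^ 2 - k * s + n)) → False := by
    intro s n j k hs hn hm hj hk hnot
    exact hnot (III_kill q hd h1 h2 s n (by rw [quadr, hs, hn]) hz hm j k (H j k hj hk))
  rcases final with ⟨rfl, rfl⟩ | ⟨rfl, rfl⟩ | ⟨rfl, rfl⟩ | ⟨rfl, rfl⟩ | ⟨rfl, rfl⟩ | ⟨rfl, rfl⟩ | ⟨rfl, rfl⟩ | ⟨rfl, rfl⟩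
  · rw [map_zero, map_one] at quadr
    rcases eq_pm (u := z) (a := f i) (by linear_combination quadr - hfi) with h | h
    · exact hz i h.symm
    · exact hz (-i) (by rw [h, map_neg])
  · rw [map_ofNat] at quadr
    rcases eq_pm (u := z - 1) (a := f i) (by linear_combination quadr - hfi) with h | h
    · exact hz (i + 1) (by rw [map_add, map_one]; linear_combination -h)
    · exact hz (-i + 1) (by rw [map_add, map_neg, map_one]; linear_combination -h)
  · rw [map_one, map_neg, map_ofNat] at quadr
    have : (z - 2) * (z + 1) = 0 := by linear_combination quadr
    rcases mul_eq_zero.1 this with h | h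
    · exact hz 2 (by rw [map_ofNat]; linear_combination -h)
    · exact hz (-1) (by rw [map_neg, map_one]; linear_combination -h)
  · exact fin 0 (-3) 1 2 (by simp [map_ofNat f]) (by simp [map_ofNat f]) (by norm_num) (by norm_num) (by norm_num) (by norm_num)
  · exact fin 2 (-2) 0 (-1) (by simp [map_ofNat f]) (by simp [map_ofNat f]) (by norm_num) (by norm_num) (by norm_num) (by norm_num)
  · exact fin 1 2 1 2 (by simp [map_ofNat f]) (by simp [map_ofNat f]) (by norm_num) (by norm_num) (by norm_num) (by norm_num)
  · exact fin 5 2 1 2 (by simp [map_ofNat f]) (by simp [map_ofNat f]) (by norm_num) (by norm_num) (by norm_num) (by norm_num)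
  · exact fin (-3) (-2) 1 (-1) (by simp [map_ofNat f]) (by simp [map_ofNat f]) (by norm_num) (by norm_num) (by norm_num) (by norm_num)

/-- the parameter lies in `K` -/
theorem v_in (q : QE f σ) (hcond : condA K ∨ condB K) {v : L}
    (H : ∀ s s' : ℚ, six s → six s' → IsSquare (((s : L) - v) * ((s' : L) - v))) : ∃ a, f a = v := by
  by_contra hv
  push Not at hv
  rcases trichotomy hcond with ⟨a, b, c, d⟩ | ⟨a, b, c, d⟩ | ⟨a, b, c, -⟩
  · exact v_notin_I q hv H a b c d
  · exact v_notin_II q hv H a b c d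
  · refine v_notin_III q hcond (z := (v + 1) / 2) ?_ ?_ a b c
    · intro x hx
      exact hv (2 * x - 1) (by rw [map_sub, map_mul, hx, map_ofNat, map_one]; ring)
    · intro s s' hs hs'
      have mem : ∀ s : ℚ, (s = -2 ∨ s = -1 ∨ s = 0 ∨ s = 1 ∨ s = 2 ∨ s = 3) → six (2 * s - 1) := by
        rintro s (rfl | rfl | rfl | rfl | rfl | rfl) <;> norm_num [six]
      obtain ⟨x, hx⟩ := H _ _ (mem s hs) (mem s' hs')
      refine ⟨x / 2, ?_⟩
      push_cast at hx
      linear_combination hx / 4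

end PartF3

set_option linter.unusedSectionVars false
set_option linter.unusedVariables false

section PartF4
variable {K L : Type*} [Field K] [NumberField K] [Field L] [NumberField L]
variable {f : K →+* L} {σ : L →+* L}

theorem sq_cancel {a b c : K} (ha : a ≠ 0) (h : IsSquare (a * b * (a * c))) : IsSquare (b * c) := by
  obtain ⟨x, hx⟩ := h
  exact ⟨x / a, by field_simp; linear_combination hx⟩

/-- among three elements two have a square product -/
theorem QE.pigeon (q : QE f σ) {a b c : K} (ha : a ≠ 0) (h1 : IsSquare (f (a * b))) (h2 : IsSquare (f (a * c))) :
    IsSquare (a * b) ∨ IsSquare (a * c) ∨ IsSquare (b * c) := by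
  rcases q.sq h1 h2 with h | h | h
  · exact Or.inl h
  · exact Or.inr (Or.inl h)
  · exact Or.inr (Or.inr (sq_cancel ha h))

theorem window_zero (q : QE f σ) (hcond : condA K ∨ condB K) {v : K} (hne : ∀ s : ℚ, six s → (s : K) - v ≠ 0)
    (H : ∀ s s' : ℚ, six s → six s' → IsSquare (f (((s : K) - v) * ((s' : K) - v))))
    (e : ℚ) (he : e = 2 ∨ e = 0 ∨ e = -2)
    (hw : IsSquare (((v + e) ^ 2 - 1) * ((v + e) ^ 2 - 9))) : v = -e := by
  set u := v + (e : K) with hu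
  have hv : v = u - e := by rw [hu]; ring
  have mem : ∀ s : ℚ, (s = 1 ∨ s = -1 ∨ s = 3 ∨ s = -3) → six (s - e) := by
    rintro s (rfl | rfl | rfl | rfl) <;> rcases he with rfl | rfl | rfl <;> norm_num [six]
  have ne : ∀ s : ℚ, six (s - e) → (s : K) - u ≠ 0 := by
    intro s hs h
    exact hne _ hs (by push_cast; linear_combination h + hv)
  have HH : ∀ s s' : ℚ, six (s - e) → six (s' - e) → IsSquare (f (((s : K) - u) * ((s' : K) - u))) := by
    intro s s' hs hs'
    have := H _ _ hs hs'
    convert this using 2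
    push_cast; rw [hv]; ring
  have pg : ∀ a b c : ℚ, six (a - e) → six (b - e) → six (c - e) →
      IsSquare (((a : K) - u) * ((b : K) - u)) ∨ IsSquare (((a : K) - u) * ((c : K) - u)) ∨
      IsSquare (((b : K) - u) * ((c : K) - u)) := by
    intro a b c ha hb hc
    exact q.pigeon (ne a ha) (HH a b ha hb) (HH a c ha hc)
  have fin1 : u = 0 ∨ u ^ 2 = 1 ∨ u ^ 2 = 9 → v = -e := by
    rintro (h | h | h)
    · rw [hv, h]; ring
    · exfalso
      rcases eq_pm (u := u) (a := 1) (by rw [h]; norm_num) with h | h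
      · exact ne 1 (mem 1 (by norm_num)) (by rw [h]; norm_num)
      · exact ne (-1) (mem (-1) (by norm_num)) (by rw [h]; norm_num)
    · exfalso
      rcases eq_pm (u := u) (a := 3) (by rw [h]; norm_num) with h | h
      · exact ne 3 (mem 3 (by norm_num)) (by rw [h]; norm_num)
      · exact ne (-3) (mem (-3) (by norm_num)) (by rw [h]; norm_num)
  clear_value u
  have m1 := mem 1 (by norm_num)
  have m3 := mem 3 (by norm_num)
  have m1' := mem (-1) (by norm_num)
  have m3' := mem (-3) (by norm_num)
  rcases trichotomy hcond with ⟨-, -, -, d⟩ | ⟨hB, h1, h3, d⟩ | ⟨hB, h1, h2, d⟩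
  · exact fin1 (d u hw)
  · have hd := condB_small hB
    rcases d u hw with h | h | h
    · exact fin1 h
    · exfalso
      rcases pg 1 3 (-1) m1 m3 m1' with a | a | a
      · have := NLi hd h1 (w := u) (m := 3) (by norm_num) (by norm_num) (by rw [h]; norm_num) 6 (-4)
          (by push_cast; linear_combination h) a
        norm_num at this
      · have := ratSq3 hd h1 h3 (p := 2) (by
          convert a using 1; push_cast; linear_combination -h)
        norm_num at this
      · have := NLi hd h1 (w := u) (m := 3) (by norm_num) (by norm_num) (by rw [h]; norm_num) 0 (-2)
          (by push_cast; linear_combination h) a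
        norm_num at this
    · exfalso
      have hne2 : six (5 - e) ∨ six (-5 - e) := by
        rcases he with rfl | rfl | rfl <;> norm_num [six]
      rcases hne2 with m5 | m5
      · rcases pg 5 3 1 m5 m3 m1 with a | a | a
        · have := NLi hd h1 (w := u) (m := -3) (by norm_num) (by norm_num) (by rw [h]; norm_num) 12 (-8)
            (by push_cast; linear_combination h) a
          norm_num at this
        · have := NLi hd h1 (w := u) (m := -3) (by norm_num) (by norm_num) (by rw [h]; norm_num) 2 (-6)
            (by push_cast; linear_combination h) a
          norm_num at this
        · have := NLi hd h1 (w := u) (m := -3) (by norm_num) (by norm_num) (by rw [h]; norm_num) 0 (-4)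
            (by push_cast; linear_combination h) a
          norm_num at this
      · rcases pg (-5) (-3) (-1) m5 m3' m1' with a | a | a
        · have := NLi hd h1 (w := u) (m := -3) (by norm_num) (by norm_num) (by rw [h]; norm_num) 12 8
            (by push_cast; linear_combination h) a
          norm_num at this
        · have := NLi hd h1 (w := u) (m := -3) (by norm_num) (by norm_num) (by rw [h]; norm_num) 2 6
            (by push_cast; linear_combination h) a
          norm_num at this
        · have := NLi hd h1 (w := u) (m := -3) (by norm_num) (by norm_num) (by rw [h]; norm_num) 0 4
            (by push_cast; linear_combination h) a
          norm_num at this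
  · have hd := condB_small hB
    rcases d u hw with h | ⟨i, t, hi, ht, h⟩
    · exact fin1 h
    · exfalso
      have nt : ∀ (p r s x : ℚ) (α : K), α = p + r * i + (s + x * i) * t → IsSquare α →
          ∃ c d : ℚ, c ^ 2 + (-1) * d ^ 2 = p ^ 2 + (-1) * r ^ 2 - 2 * (s ^ 2 + (-1) * x ^ 2) ∧
            2 * c * d = 2 * p * r - 2 * (2 * s * x) := by
        intro p r s x α hα hsq
        rw [hα] at hsq
        exact NT hd (w := i) (θ := t) (m := -1) (n := 2) (by norm_num) (by norm_num) (by norm_num)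
          (by rw [hi]; norm_num) (by rw [ht]; norm_num) hsq
      rcases pg 1 3 (-1) m1 m3 m1' with a | a | a
      · obtain ⟨c, d, e1, e2⟩ := nt 4 (-4) (-4) 2 _ (by push_cast; rw [h]; linear_combination hi + ht) a
        exact not_pm_sq (C := -24) (by norm_num) (by norm_num) (by rw [e1]; norm_num) (by rw [e2]; norm_num)
      · obtain ⟨c, d, e1, e2⟩ := nt 0 0 0 2 _ (by push_cast; rw [h]; linear_combination hi + ht) a
        exact not_pm_sq (C := 8) (by norm_num) (by norm_num) (by rw [e1]; norm_num) (by rw [e2]; norm_num)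
      · obtain ⟨c, d, e1, e2⟩ := nt (-2) (-2) (-2) 2 _ (by push_cast; rw [h]; linear_combination hi + ht) a
        exact not_i_sq (C := 24) (by norm_num) (by norm_num) (by rw [e1]; norm_num) (by rw [e2]; norm_num)

theorem v_zero_of (q : QE f σ) (hcond : condA K ∨ condB K)
    (hE : (∀ x y : K, y ^ 2 = x ^ 3 - x ^ 2 - 9 * x + 9 → inQ x ∧ inQ y) ∨ NumberField.classNumber K = 1)
    {v : K} 
    (H : ∀ s s' : ℚ, six s → six s' → IsSquare (f (((s : K) - v) * ((s' : K) - v))))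
    (e : ℚ) (he : e = 2 ∨ e = 0 ∨ e = -2) (hv : v = -e) :
    v = 0 ∧ condB K ∧ IsSquare (-1 : K) ∧ IsSquare (3 : K) := by
  have HH : ∀ (s s' : ℚ) (x : K), six (s - e) → six (s' - e) → x = s * s' → IsSquare (f x) := by
    intro s s' x hs hs' hx
    have := H _ _ hs hs'
    convert this using 2
    push_cast; rw [hv, hx]; ring
  have mem : ∀ s : ℚ, (s = 1 ∨ s = -1 ∨ s = 3 ∨ s = -3) → six (s - e) := by
    rintro s (rfl | rfl | rfl | rfl) <;> rcases he with rfl | rfl | rfl <;> norm_num [six]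
  have f5 : IsSquare (f 5) := by
    rcases he with rfl | rfl | rfl
    · exact HH 5 1 _ (by norm_num [six]) (by norm_num [six]) (by norm_num)
    · exact HH 5 1 _ (by norm_num [six]) (by norm_num [six]) (by norm_num)
    · exact HH (-5) (-1) _ (by norm_num [six]) (by norm_num [six]) (by norm_num)
  obtain ⟨hB, h1, h3⟩ := lemmaZ hcond hE (fun x => IsSquare (f x)) (fun x y _ hx hy => q.sq hx hy)
    (HH 1 (-1) _ (mem _ (by norm_num)) (mem _ (by norm_num)) (by norm_num))
    (HH 1 3 _ (mem _ (by norm_num)) (mem _ (by norm_num)) (by norm_num)) f5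
  refine ⟨?_, hB, h1, h3⟩
  have hd := condB_small hB
  have no : IsSquare (f 7) → False := by
    intro f7
    rcases q.sq f5 f7 with h | h | h
    · exact (condB_no5 hB).1 h
    · have := ratSq3 hd h1 h3 (p := 7) (by exact_mod_cast h)
      norm_num at this
    · have := ratSq3 hd h1 h3 (p := 35) (by norm_num at h; exact_mod_cast h)
      norm_num at this
  rcases he with rfl | rfl | rfl
  · exact (no (HH 7 1 _ (by norm_num [six]) (by norm_num [six]) (by norm_num))).elim
  · rw [hv]; norm_num
  · exact (no (HH (-7) (-1) _ (by norm_num [six]) (by norm_num [six]) (by norm_num))).elim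

set_option maxHeartbeats 2000000 in
theorem main_K (q : QE f σ) (hcond : condA K ∨ condB K)
    (hE : (∀ x y : K, y ^ 2 = x ^ 3 - x ^ 2 - 9 * x + 9 → inQ x ∧ inQ y) ∨ NumberField.classNumber K = 1)
    {v : K} (hne : ∀ s : ℚ, six s → (s : K) - v ≠ 0)
    (H : ∀ s s' : ℚ, six s → six s' → IsSquare (f (((s : K) - v) * ((s' : K) - v)))) :
    v = 0 ∧ condB K ∧ IsSquare (-1 : K) ∧ IsSquare (3 : K) := by
  by_cases hex : ∃ e : ℚ, (e = 2 ∨ e = 0 ∨ e = -2) ∧ IsSquare (((v + e) ^ 2 - 1) * ((v + e) ^ 2 - 9))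
  · obtain ⟨e, he, hw⟩ := hex
    exact v_zero_of q hcond hE H e he (window_zero q hcond hne H e he hw)
  exfalso
  push Not at hex
  have tr : ∀ {a b c : K}, a ≠ 0 → IsSquare (a * b) → IsSquare (a * c) → IsSquare (b * c) :=
    fun ha h1 h2 => sq_cancel ha (h1.mul h2)
  have m5' : six (-5) := by norm_num [six]
  have m3' : six (-3) := by norm_num [six]
  have m1' : six (-1) := by norm_num [six]
  have m1 : six 1 := by norm_num [six]
  have m3 : six 3 := by norm_num [six]
  have m5 : six 5 := by norm_num [six]
  obtain ⟨c, hc⟩ : ∃ c : ℚ → Prop, ∀ s s', six s → six s' →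
      (IsSquare (((s : K) - v) * ((s' : K) - v)) ↔ (c s ↔ c s')) := by
    refine ⟨fun s => IsSquare ((((-5 : ℚ) : K) - v) * ((s : K) - v)), ?_⟩
    intro s s' hs hs'
    have h5 := hne _ m5'
    have hs0 := hne _ hs
    have hs0' := hne _ hs'
    have pg := q.pigeon h5 (H _ _ m5' hs) (H _ _ m5' hs')
    have t1 := tr (a := ((-5 : ℚ) : K) - v) (b := (s : K) - v) (c := (s' : K) - v) h5
    have t2 := tr (a := (s : K) - v) (b := ((-5 : ℚ) : K) - v) (c := (s' : K) - v) hs0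
    have t3 := tr (a := (s' : K) - v) (b := ((-5 : ℚ) : K) - v) (c := (s : K) - v) hs0'
    rw [mul_comm] at t2 t3
    rw [mul_comm ((s' : K) - v) ((s : K) - v)] at t3
    tauto
  have win : ∀ e a b x y : ℚ, (e = 2 ∨ e = 0 ∨ e = -2) → six a → six b → six x → six y →
      (∀ V : K, ((a : K) - V) * ((b : K) - V) * (((x : K) - V) * ((y : K) - V)) = ((V + e) ^ 2 - 1) * ((V + e) ^ 2 - 9)) →
      (c a ↔ c b) → (c x ↔ c y) → False := by
    intro e a b x y he ha hb hx hy hV h1 h2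
    refine hex e he ?_
    rw [← hV]
    exact ((hc a b ha hb).2 h1).mul ((hc x y hx hy).2 h2)
  have w1 := win 2 (-5) (-3) (-1) 1 (by norm_num) m5' m3' m1' m1 (by intro V; push_cast; ring)
  have w2 := win 2 (-5) (-1) (-3) 1 (by norm_num) m5' m1' m3' m1 (by intro V; push_cast; ring)
  have w3 := win 2 (-5) 1 (-3) (-1) (by norm_num) m5' m1 m3' m1' (by intro V; push_cast; ring)
  have w4 := win 0 (-3) (-1) 1 3 (by norm_num) m3' m1' m1 m3 (by intro V; push_cast; ring)
  have w5 := win 0 (-3) 1 (-1) 3 (by norm_num) m3' m1 m1' m3 (by intro V; push_cast; ring)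
  have w6 := win 0 (-3) 3 (-1) 1 (by norm_num) m3' m3 m1' m1 (by intro V; push_cast; ring)
  have w7 := win (-2) (-1) 1 3 5 (by norm_num) m1' m1 m3 m5 (by intro V; push_cast; ring)
  have w8 := win (-2) (-1) 3 1 5 (by norm_num) m1' m3 m1 m5 (by intro V; push_cast; ring)
  have w9 := win (-2) (-1) 5 1 3 (by norm_num) m1' m5 m1 m3 (by intro V; push_cast; ring)
  have col : ((c (-3) ↔ c 1) ∧ (c (-5) ↔ c 3) ∧ ((c (-3) ↔ c (-1)) ∨ (c (-5) ↔ c (-3)))) ∨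
      ((c 3 ↔ c (-1)) ∧ (c 5 ↔ c (-3)) ∧ ((c 3 ↔ c 1) ∨ (c 5 ↔ c 3))) := by
    clear win hc hex tr H hne hE hcond
    generalize c (-5) = p0 at *
    generalize c (-3) = p1 at *
    generalize c (-1) = p2 at *
    generalize c 1 = p3 at *
    generalize c 3 = p4 at *
    generalize c 5 = p5 at *
    by_cases h0 : p0 <;> by_cases h1 : p1 <;> by_cases h2 : p2 <;> by_cases h3 : p3 <;>
      by_cases h4 : p4 <;> by_cases h5 : p5 <;> simp_all
  have S : ∀ s s' : ℚ, six s → six s' → (c s ↔ c s') → ∀ x : K, ((s : K) - v) * ((s' : K) - v) = 4 * x → IsSquare x :=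
    fun s s' hs hs' h x hx => sq_four ((hc s s' hs hs').2 h) hx
  have ne : ∀ s : ℚ, six s → ∀ x : K, x = s → v = x → False := by
    intro s hs x hx h
    exact hne s hs (by rw [h, hx]; ring)
  rcases col with ⟨a1, a2, a3⟩ | ⟨a1, a2, a3⟩
  · have := lemmaM1 hcond (z := (v + 1) / 2) (S _ _ m3' m1 a1 _ (by push_cast; ring))
      (S _ _ m5' m3 a2 _ (by push_cast; ring))
      (a3.imp (fun h => S _ _ m3' m1' h _ (by push_cast; ring)) (fun h => S _ _ m5' m3' h _ (by push_cast; ring)))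
    rcases this with h | h | h
    · exact ne _ m1' (-1) (by norm_num) (by linear_combination 2 * h)
    · rcases eq_pm (a := (1 : K)) (by rw [h]; norm_num) with h | h
      · exact ne _ m1 1 (by norm_num) (by linear_combination 2 * h)
      · exact ne _ m3' (-3) (by norm_num) (by linear_combination 2 * h)
    · rcases eq_pm (a := (2 : K)) (by rw [h]; norm_num) with h | h
      · exact ne _ m3 3 (by norm_num) (by linear_combination 2 * h)
      · exact ne _ m5' (-5) (by norm_num) (by linear_combination 2 * h)
  · have := lemmaM1 hcond (z := (-v + 1) / 2) (S _ _ m3 m1' a1 _ (by push_cast; ring))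
      (S _ _ m5 m3' a2 _ (by push_cast; ring))
      (a3.imp (fun h => S _ _ m3 m1 h _ (by push_cast; ring)) (fun h => S _ _ m5 m3 h _ (by push_cast; ring)))
    rcases this with h | h | h
    · exact ne _ m1 1 (by norm_num) (by linear_combination -2 * h)
    · rcases eq_pm (a := (1 : K)) (by rw [h]; norm_num) with h | h
      · exact ne _ m1' (-1) (by norm_num) (by linear_combination -2 * h)
      · exact ne _ m3 3 (by norm_num) (by linear_combination -2 * h)
    · rcases eq_pm (a := (2 : K)) (by rw [h]; norm_num) with h | h
      · exact ne _ m3' (-3) (by norm_num) (by linear_combination -2 * h)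
      · exact ne _ m5 5 (by norm_num) (by linear_combination -2 * h)

theorem cyc12 (hd : smallDeg K) (h1 : IsSquare (-1 : K)) (h3 : IsSquare (3 : K)) :
    IsCyclotomicExtension {12} ℚ K := by
  obtain ⟨i, hi⟩ := h1
  obtain ⟨w, hw⟩ := h3
  have hi' : i ^ 2 = ((-1 : ℚ) : K) := by push_cast; rw [hi]; ring
  have hw' : w ^ 2 = ((3 : ℚ) : K) := by push_cast; rw [hw]; ring
  obtain ⟨-, htop⟩ := two_top hd (by norm_num) (by norm_num) (by norm_num) hw' hi' (sq_memQ hw')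
    (le_quad (sq_memQ hi'))
  obtain ⟨ζ, hζ⟩ : ∃ ζ : K, ζ = (w + i) / 2 := ⟨_, rfl⟩
  have e2 : ζ ^ 2 = (1 + w * i) / 2 := by rw [hζ]; linear_combination (-hw - hi) / 4
  have e3 : ζ ^ 3 = i := by
    have : ζ ^ 3 = ζ ^ 2 * ζ := by ring
    rw [this, e2, hζ]; linear_combination (-i * hw - w * hi) / 4
  have e4 : ζ ^ 4 = (w * i - 1) / 2 := by
    have : ζ ^ 4 = ζ ^ 3 * ζ := by ring
    rw [this, e3, hζ]; linear_combination (-hi) / 2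
  have e6 : ζ ^ 6 = -1 := by
    have : ζ ^ 6 = ζ ^ 3 * ζ ^ 3 := by ring
    rw [this, e3]; exact hi.symm
  have e12 : ζ ^ 12 = 1 := by
    have : ζ ^ 12 = ζ ^ 6 * ζ ^ 6 := by ring
    rw [this, e6]; ring
  have hprim : IsPrimitiveRoot ζ 12 := by
    have : orderOf ζ = 12 := by
      refine orderOf_eq_of_pow_and_pow_div_prime (by norm_num) e12 ?_
      intro p hp hdvd
      have : p ∣ 2 ^ 2 * 3 := by norm_num; exact hdvd
      rcases (Nat.Prime.dvd_mul hp).1 this with h | h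
      · have := (Nat.prime_dvd_prime_iff_eq hp Nat.prime_two).1 (hp.dvd_of_dvd_pow h)
        subst this
        norm_num [e6]
      · have := (Nat.prime_dvd_prime_iff_eq hp Nat.prime_three).1 h
        subst this
        norm_num [e4]
        intro h
        have h' : w * i = 3 := by linear_combination 2 * h
        have : (12 : K) = 0 := by linear_combination -(w * i + 3) * h' - w * w * hi + hw
        norm_num at this
    rw [← this]; exact IsPrimitiveRoot.orderOf ζ
  rw [IsCyclotomicExtension.iff_adjoin_eq_top]
  refine ⟨?_, ?_⟩
  · intro n hn _
    rw [Set.mem_singleton_iff] at hn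
    subst hn
    exact ⟨ζ, hprim⟩
  · rw [eq_top_iff]
    intro x _
    set A := Algebra.adjoin ℚ {b : K | ∃ n ∈ ({12} : Set ℕ), n ≠ 0 ∧ b ^ n = 1} with hA
    have mζ : ζ ∈ A := Algebra.subset_adjoin ⟨12, rfl, by norm_num, e12⟩
    have mi : i ∈ A := by rw [← e3]; exact A.pow_mem mζ 3
    have mw : w ∈ A := by
      have : w = ζ + ζ - i := by rw [hζ]; ring
      rw [this]; exact A.sub_mem (A.add_mem mζ mζ) mi
    have mr : ∀ r : ℚ, (r : K) ∈ A := by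
      intro r
      have := A.algebraMap_mem r
      simpa using this
    have : x ∈ quad (quad ⊥ w (sq_memQ hw')) i (le_quad (sq_memQ hi')) := by rw [htop]; trivial
    obtain ⟨a1, ⟨p1, hp1, q1, hq1, rfl⟩, a2, ⟨p2, hp2, q2, hq2, rfl⟩, rfl⟩ := this
    obtain ⟨p1, rfl⟩ := mem_botQ.1 hp1
    obtain ⟨q1, rfl⟩ := mem_botQ.1 hq1
    obtain ⟨p2, rfl⟩ := mem_botQ.1 hp2
    obtain ⟨q2, rfl⟩ := mem_botQ.1 hq2
    exact A.add_mem (A.add_mem (mr _) (A.mul_mem (mr _) mw))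
      (A.mul_mem (A.add_mem (mr _) (A.mul_mem (mr _) mw)) mi)

end PartF4

theorem six_squares_over_quadratic_ext
    (K L : Type*) [Field K] [NumberField K] [Field L] [NumberField L] [Algebra K L]
    (hquad : Module.finrank K L = 2)
    (hcond : condA K ∨ condB K)
    (hE0orClass : (∀ x y : K, y ^ 2 = x ^ 3 - x ^ 2 - 9 * x + 9 → inQ x ∧ inQ y) ∨
      NumberField.classNumber K = 1)
    (n : ℕ) (hn : 6 ≤ n) (b : ℕ → L)
    (hAP : ∀ i, i + 2 < n → b i ^ 2 + b (i + 2) ^ 2 = 2 * b (i + 1) ^ 2)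
    (hnz : ∀ i < n, b i ≠ 0)
    (hnc : ¬ ∀ i < n, ∀ j < n, b i ^ 2 = b j ^ 2)
    (hproper : IntermediateField.adjoin ℚ (b '' Set.Iio n) = ⊤) :
    n = 6 ∧ IsCyclotomicExtension {12} ℚ K ∧
      (∃ r : L, r ^ 2 = 5 ∧ r ∉ Set.range (algebraMap K L)) ∧
      ∃ s : L, s ≠ 0 ∧
        ((∀ i < 6, s ^ 2 * b i ^ 2 = 2 * (i : L) - 5) ∨
         (∀ i < 6, s ^ 2 * b i ^ 2 = 5 - 2 * (i : L))) := by
  obtain ⟨σ', hσ1, hσ2⟩ := exists_conj K L hquad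
  have q : QE (algebraMap K L) (σ' : L →+* L) :=
    { comm := fun a => by simp
      fix := fun x hx => hσ1 x hx
      inv := fun x => hσ2 x }
  set f := algebraMap K L with hf
  obtain ⟨d, hd⟩ : ∃ d, d = b 1 ^ 2 - b 0 ^ 2 := ⟨_, rfl⟩
  have lin : ∀ i, (i < n → b i ^ 2 = b 0 ^ 2 + i * d) ∧ (i + 1 < n → b (i + 1) ^ 2 = b 0 ^ 2 + (i + 1) * d) := by
    intro i
    induction i with
    | zero =>
      refine ⟨fun _ => by push_cast; ring, fun _ => ?_⟩
      rw [hd]; push_cast; ring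
    | succ k ih =>
      refine ⟨fun h => by push_cast; exact ih.2 h, fun h => ?_⟩
      have h0 := hAP k (by omega)
      rw [ih.1 (by omega), ih.2 (by omega)] at h0
      push_cast
      linear_combination h0
  have hlin : ∀ i < n, b i ^ 2 = b 0 ^ 2 + i * d := fun i hi => (lin i).1 hi
  have hd0 : d ≠ 0 := by
    intro h0
    refine hnc fun i hi j hj => ?_
    rw [hlin i hi, hlin j hj, h0]; ring
  obtain ⟨v, hv⟩ : ∃ v : L, v = -5 - 2 * b 0 ^ 2 / d := ⟨_, rfl⟩
  have hvd : v * d = -5 * d - 2 * b 0 ^ 2 := by rw [hv]; field_simp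
  have hsv : ∀ i < n, (2 * (i : L) - 5 - v) * d = 2 * b i ^ 2 := by
    intro i hi
    rw [hlin i hi]; linear_combination -hvd
  have six_idx : ∀ s : ℚ, six s → ∃ i < 6, s = 2 * ((i : ℕ) : ℚ) - 5 := by
    rintro s (rfl | rfl | rfl | rfl | rfl | rfl)
    · exact ⟨0, by norm_num, by norm_num⟩
    · exact ⟨1, by norm_num, by norm_num⟩
    · exact ⟨2, by norm_num, by norm_num⟩
    · exact ⟨3, by norm_num, by norm_num⟩
    · exact ⟨4, by norm_num, by norm_num⟩
    · exact ⟨5, by norm_num, by norm_num⟩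
  have H : ∀ s s' : ℚ, six s → six s' → IsSquare (((s : L) - v) * ((s' : L) - v)) := by
    intro s s' hs hs'
    obtain ⟨i, hi, rfl⟩ := six_idx s hs
    obtain ⟨j, hj, rfl⟩ := six_idx s' hs'
    refine ⟨2 * b i * b j / d, ?_⟩
    have e1 := hsv i (by omega)
    have e2 := hsv j (by omega)
    push_cast
    field_simp
    linear_combination (2 * (j : L) - 5 - v) * d * e1 + 2 * b i ^ 2 * e2
  obtain ⟨a, ha⟩ := v_in q hcond H
  have hne : ∀ s : ℚ, six s → (s : K) - a ≠ 0 := by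
    intro s hs h0
    obtain ⟨i, hi, rfl⟩ := six_idx s hs
    have e0 := congrArg f h0
    rw [map_sub, map_ratCast, ha, map_zero] at e0
    push_cast at e0
    have e1 := hsv i (by omega)
    rw [e0, zero_mul] at e1
    exact hnz i (by omega) (by simpa using e1.symm)
  obtain ⟨ha0, hB, h1, h3⟩ := main_K q hcond hE0orClass hne (by
    intro s s' hs hs'
    have := H s s' hs hs'
    simpa [← ha] using this)
  have hv0 : v = 0 := by rw [← ha, ha0, map_zero]
  rw [hv0] at hsv
  have b3 := hnz 3 (by omega)
  have hb3 : d = 2 * b 3 ^ 2 := by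
    have := hsv 3 (by omega)
    push_cast at this
    linear_combination this
  have hall : ∀ i < n, b i ^ 2 = (2 * (i : L) - 5) * b 3 ^ 2 := by
    intro i hi
    have := hsv i hi
    rw [hb3] at this
    linear_combination -this / 2
  have s5 : IsSquare (f 5) := ⟨b 5 / b 3, by
    have := hall 5 (by omega)
    rw [map_ofNat]
    field_simp
    push_cast at this
    linear_combination -this⟩
  refine ⟨?_, cyc12 (condB_small hB) h1 h3, ?_, (b 3)⁻¹, inv_ne_zero b3, Or.inl ?_⟩
  · by_contra hn6
    have s7 : IsSquare (f 7) := ⟨b 6 / b 3, by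
      have := hall 6 (by omega)
      rw [map_ofNat]
      field_simp
      push_cast at this
      linear_combination -this⟩
    have hsd := condB_small hB
    rcases q.sq s5 s7 with h | h | h
    · exact (condB_no5 hB).1 h
    · have := ratSq3 hsd h1 h3 (p := 7) (by exact_mod_cast h)
      norm_num at this
    · have := ratSq3 hsd h1 h3 (p := 35) (by norm_num at h; exact_mod_cast h)
      norm_num at this
  · obtain ⟨r, hr⟩ := s5
    rw [map_ofNat] at hr
    refine ⟨r, by rw [hr]; ring, ?_⟩
    rintro ⟨x, rfl⟩
    refine (condB_no5 hB).1 ⟨x, f.injective ?_⟩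
    rw [map_ofNat, map_mul, hr]
  · intro i hi
    rw [hall i (by omega)]
    field_simp
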